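/- There exists an uncountable family 𝒫 of subsets of the Euclidean plane ℝ² such that: each P ∈ 𝒫 is compact, equals the closure of its interior, and is homeomorphic to the closed unit disk; each P ∈ 𝒫 admits a tiling of the plane by isometric copies; no P ∈ 𝒫 admits a tiling invariant under a nonzero translation; and the members of 𝒫 are pairwise non-similar, i.e. for distinct P, Q ∈ 𝒫 there is no map f : ℝ² → ℝ² of the form f(x) = c·g(x) + b with g a linear isometry of ℝ², c > 0 and b ∈ ℝ², such that f(P) = Q. -/

import Mathlib

noncomputable section

/-- The Euclidean plane. -/
abbrev Plane : Type := EuclideanSpace ℝ (Fin 2)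

/-- `S` is a tiling of the plane by the prototile `P`: the images `g '' P` for
`g ∈ S` cover the plane and have pairwise disjoint interiors. -/
def IsTiling (P : Set Plane) (S : Set (Plane ≃ᵢ Plane)) : Prop :=
  (⋃ g ∈ S, g '' P) = Set.univ ∧
  S.Pairwise fun g h => Disjoint (interior (g '' P)) (interior (h '' P))

/-- The tiling `S` of the plane by `P` is invariant under translation by `v`. -/
def TilingTransInvariant (P : Set Plane) (S : Set (Plane ≃ᵢ Plane)) (v : Plane) : Prop :=
  (fun A => (fun x => v + x) '' A) '' ((fun g : Plane ≃ᵢ Plane => g '' P) '' S) =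
    (fun g : Plane ≃ᵢ Plane => g '' P) '' S

/-- `P` and `Q` are similar: `Q` is the image of `P` under a map
`x ↦ c • g x + b` with `g` a linear isometry, `c > 0` and `b` a vector. -/
def AreSimilar (P Q : Set Plane) : Prop :=
  ∃ (c : ℝ) (g : Plane ≃ₗᵢ[ℝ] Plane) (b : Plane),
    0 < c ∧ (fun x => c • g x + b) '' P = Q

namespace HatFamily

open Topology Filter Complex
open scoped ComplexConjugate

/-- Formal positions `(m, n, p, q)`, standing for `A = m + n ω` and `B = p + q ω`
with `ω = exp (iπ/3)`. -/
abbrev V : Type := ℤ × ℤ × ℤ × ℤ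

/-- Formal rotation by `π/3`. -/
def rot (x : V) : V := (-x.2.1, x.1 + x.2.1, -x.2.2.2, x.2.2.1 + x.2.2.2)

/-- Formal reflection in the line at angle `π/6`. -/
def ref (x : V) : V := (x.2.1, x.1, -x.2.2.2, -x.2.2.1)

/-- The vertices of the prototile, counterclockwise. -/
def fv : Fin 14 → V := ![(0, 0, 0, 0), (0, 0, -1, 1), (1, -1, -1, 1), (2, -1, -1, 1),
  (3, -1, -1, 1), (3, 0, -1, 1), (3, 0, -1, 0), (3, 0, 0, -1), (2, 1, 0, -1), (1, 1, 0, -1),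
  (1, 1, 1, -1), (1, 1, 1, 0), (1, 0, 1, 0), (0, 0, 1, 0)]

/-- The directions of the edges of the prototile, in multiples of `π/6`. -/
def dir : Fin 14 → Fin 12 := ![7, 10, 0, 0, 2, 11, 1, 4, 6, 3, 5, 8, 6, 9]

/-- A formal placement of the prototile: reflect if `s`, rotate `k` times, translate by `x`. -/
@[ext] structure Pl where
  s : Bool
  k : ℕ
  x : V
deriving DecidableEq

/-- The linear part of a placement. -/
def lin (s : Bool) (k : ℕ) (y : V) : V := rot^[k] (if s then ref y else y)

/-- The action of a placement on formal positions. -/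
def Pl.act (t : Pl) (y : V) : V := lin t.s t.k y + t.x

/-- The vertices of a placed tile. -/
def Pl.vert (t : Pl) (i : Fin 14) : V := t.act (fv i)

lemma rot_add (x y : V) : rot (x + y) = rot x + rot y := by
  ext <;> simp [rot] <;> ring

lemma ref_add (x y : V) : ref (x + y) = ref x + ref y := by
  ext <;> simp [ref] <;> ring

lemma rot_iter_add (k : ℕ) (x y : V) : rot^[k] (x + y) = rot^[k] x + rot^[k] y := by
  induction k generalizing x y with
  | zero => rfl
  | succ k ih => simp [Function.iterate_succ, rot_add, ih]

lemma lin_add (s : Bool) (k : ℕ) (x y : V) : lin s k (x + y) = lin s k x + lin s k y := by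
  cases s <;> simp [lin, ref_add, rot_iter_add]

lemma lin_neg (s : Bool) (k : ℕ) (x : V) : lin s k (-x) = -lin s k x := by
  have h := lin_add s k x (-x)
  have h0 : lin s k 0 = 0 := by simpa using lin_add s k 0 0
  rw [add_neg_cancel, h0] at h
  exact (neg_eq_of_add_eq_zero_right h.symm).symm

lemma lin_sub (s : Bool) (k : ℕ) (x y : V) : lin s k (x - y) = lin s k x - lin s k y := by
  rw [sub_eq_add_neg, lin_add, lin_neg, sub_eq_add_neg]

lemma rot_six (x : V) : rot^[6] x = x := by
  ext <;> simp [rot]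

lemma rot_iter_mod (k : ℕ) (x : V) : rot^[k % 6] x = rot^[k] x := by
  conv_rhs => rw [← Nat.div_add_mod k 6, add_comm, Function.iterate_add_apply]
  congr 1
  rw [Function.iterate_mul]
  have : (rot^[6]) = id := funext rot_six
  rw [this, Function.iterate_id]; rfl

/-- `√3`. -/
abbrev r3 : ℝ := √3

lemma r3_pos : 0 < r3 := by positivity
lemma r3_sq : r3 * r3 = 3 := Real.mul_self_sqrt (by norm_num)

/-- `exp (iπ/3)`. -/
def om : ℂ := ⟨1 / 2, r3 / 2⟩

/-- The point of the plane with formal position `x`. -/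
def zpt (β : ℝ) (x : V) : ℂ :=
  ⟨x.1 + x.2.1 / 2 - 3 / 2 * β * x.2.2.2, r3 * (x.2.1 / 2 + β * (x.2.2.1 + x.2.2.2 / 2))⟩

lemma zpt_add (β : ℝ) (x y : V) : zpt β (x + y) = zpt β x + zpt β y := by
  apply Complex.ext <;> simp [zpt] <;> ring

lemma zpt_zero (β : ℝ) : zpt β 0 = 0 := by
  apply Complex.ext <;> simp [zpt]

lemma zpt_neg (β : ℝ) (x : V) : zpt β (-x) = -zpt β x := by
  apply Complex.ext <;> simp [zpt] <;> ring

lemma zpt_sub (β : ℝ) (x y : V) : zpt β (x - y) = zpt β x - zpt β y := by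
  rw [sub_eq_add_neg, zpt_add, zpt_neg, sub_eq_add_neg]

lemma zpt_rot (β : ℝ) (x : V) : zpt β (rot x) = om * zpt β x := by
  have h := r3_sq
  apply Complex.ext
  · simp [zpt, rot, om]
    linear_combination (1 / 2 * (x.2.1 / 2 + β * (x.2.2.1 + x.2.2.2 / 2)) : ℝ) * h
  · simp [zpt, rot, om]
    ring

lemma zpt_ref (β : ℝ) (x : V) : zpt β (ref x) = om * (starRingEnd ℂ) (zpt β x) := by
  have h := r3_sq
  apply Complex.ext
  · simp [zpt, ref, om]
    linear_combination (-1 / 2 * (x.2.1 / 2 + β * (x.2.2.1 + x.2.2.2 / 2)) : ℝ) * h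
  · simp [zpt, ref, om]
    ring

lemma zpt_rot_iter (β : ℝ) (k : ℕ) (x : V) : zpt β (rot^[k] x) = om ^ k * zpt β x := by
  induction k generalizing x with
  | zero => simp
  | succ k ih => rw [Function.iterate_succ_apply, ih, zpt_rot, pow_succ]; ring

/-- The geometric action of a placement. -/
def Pl.iso (β : ℝ) (t : Pl) (z : ℂ) : ℂ :=
  om ^ t.k * (if t.s then om * (starRingEnd ℂ) z else z) + zpt β t.x

lemma zpt_act (β : ℝ) (t : Pl) (y : V) : zpt β (t.act y) = t.iso β (zpt β y) := by
  obtain ⟨s, k, x⟩ := t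
  cases s <;> simp [Pl.act, Pl.iso, lin, zpt_add, zpt_rot_iter, zpt_ref]

lemma om_normSq : normSq om = 1 := by
  have h := r3_sq
  simp only [om, normSq_mk]
  linear_combination (1 / 4 : ℝ) * h

lemma norm_om : ‖om‖ = 1 := by
  have h := Complex.normSq_eq_norm_sq om
  rw [om_normSq] at h
  exact (pow_eq_one_iff_of_nonneg (norm_nonneg _) two_ne_zero).1 h.symm

lemma om_ne_zero : om ≠ 0 := norm_ne_zero_iff.1 (by rw [norm_om]; norm_num)

/-- If `β` is irrational then formal positions are determined by points. -/
lemma zpt_injective {β : ℝ} (hβ : Irrational β) : Function.Injective (zpt β) := by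
  intro x y h
  have key : ∀ a b : ℤ, (a : ℝ) + β * b = 0 → a = 0 ∧ b = 0 := by
    intro a b hab
    have hb : b = 0 := by
      by_contra hb
      have hb' : (b : ℝ) ≠ 0 := by exact_mod_cast hb
      apply hβ
      refine ⟨(-a : ℚ) / b, ?_⟩
      push_cast
      field_simp
      linarith
    subst hb
    refine ⟨?_, rfl⟩
    have : (a : ℝ) = 0 := by simpa using hab
    exact_mod_cast this
  have h1 := congrArg Complex.re h
  have h2 := congrArg Complex.im h
  simp only [zpt] at h1 h2
  have h3 := mul_left_cancel₀ r3_pos.ne' h2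
  obtain ⟨e1, e2⟩ := key (2 * (x.1 - y.1) + (x.2.1 - y.2.1)) (-3 * (x.2.2.2 - y.2.2.2))
    (by push_cast; linarith)
  obtain ⟨e3, e4⟩ := key (x.2.1 - y.2.1) (2 * (x.2.2.1 - y.2.2.1) + (x.2.2.2 - y.2.2.2))
    (by push_cast; linarith)
  ext <;> omega

/-- The rescaled ordinate `im z / √3`. -/
def yc (z : ℂ) : ℝ := z.im / r3

lemma im_eq_yc (z : ℂ) : z.im = r3 * yc z := by
  unfold yc; field_simp

lemma yc_add (z w : ℂ) : yc (z + w) = yc z + yc w := by simp [yc, add_div]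
lemma yc_sub (z w : ℂ) : yc (z - w) = yc z - yc w := by simp [yc, sub_div]
lemma yc_smul (c : ℝ) (z : ℂ) : yc (c * z) = c * yc z := by simp [yc, mul_div_assoc]

lemma yc_zpt (β : ℝ) (x : V) : yc (zpt β x) = x.2.1 / 2 + β * (x.2.2.1 + x.2.2.2 / 2) := by
  have := r3_pos
  simp only [yc, zpt]; field_simp

lemma re_zpt (β : ℝ) (x : V) : (zpt β x).re = x.1 + x.2.1 / 2 - 3 / 2 * β * x.2.2.2 := rfl

/-- Coefficients of the linear forms `sd`. -/
def cX : Fin 12 → ℤ := ![0, -1, -1, -1, -1, -1, 0, 1, 1, 1, 1, 1]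

/-- Coefficients of the linear forms `sd`. -/
def cY : Fin 12 → ℤ := ![1, 3, 1, 0, -1, -3, -1, -3, -1, 0, 1, 3]

/-- A linear form that is nonnegative exactly to the left of the direction `dπ/6`. -/
def sd (d : Fin 12) (z : ℂ) : ℝ := cX d * z.re + cY d * yc z

lemma sd_add (d : Fin 12) (z w : ℂ) : sd d (z + w) = sd d z + sd d w := by
  simp only [sd, yc_add, add_re]; ring

lemma sd_sub (d : Fin 12) (z w : ℂ) : sd d (z - w) = sd d z - sd d w := by
  simp only [sd, yc_sub, sub_re]; ring

lemma sd_smul (d : Fin 12) (c : ℝ) (z : ℂ) : sd d (c * z) = c * sd d z := by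
  simp only [sd, yc_smul, re_ofReal_mul]; ring

lemma continuous_yc : Continuous yc := by unfold yc; fun_prop

lemma continuous_sd (d : Fin 12) : Continuous (sd d) := by
  have := continuous_yc
  unfold sd; fun_prop

/-- The linear form of the `i`-th edge of the prototile. -/
def ln (β : ℝ) (i : Fin 14) (z : ℂ) : ℝ := sd (dir i) (z - zpt β (fv i))

lemma continuous_ln (β : ℝ) (i : Fin 14) : Continuous (ln β i) :=
  (continuous_sd _).comp (continuous_id.sub continuous_const)

/-- The prototile `Tile(1, √3 β)`. -/
def tile (β : ℝ) : Set ℂ :=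
  {z | 0 ≤ ln β 1 z ∧ 0 ≤ ln β 2 z ∧ (0 ≤ ln β 4 z ∨ (0 ≤ ln β 5 z ∧ 0 ≤ ln β 6 z)) ∧
    0 ≤ ln β 7 z ∧ (0 ≤ ln β 8 z ∨ (0 ≤ ln β 9 z ∧ 0 ≤ ln β 10 z)) ∧
    (0 ≤ ln β 0 z ∨ (0 ≤ ln β 13 z ∧ (0 ≤ ln β 12 z ∨ 0 ≤ ln β 11 z)))}

section

variable (β : ℝ) (z : ℂ)

lemma ln0 : ln β 0 z = z.re - 3 * yc z := by
  simp [ln, sd, dir, fv, cX, cY, yc_sub, yc_zpt, re_zpt]; try ring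
lemma ln1 : ln β 1 z = z.re + yc z + (2 * β) := by
  simp [ln, sd, dir, fv, cX, cY, yc_sub, yc_zpt, re_zpt]; try ring
lemma ln2 : ln β 2 z = yc z + (1 / 2 + 1 / 2 * β) := by
  simp [ln, sd, dir, fv, cX, cY, yc_sub, yc_zpt, re_zpt]; try ring
lemma ln3 : ln β 3 z = yc z + (1 / 2 + 1 / 2 * β) := by
  simp [ln, sd, dir, fv, cX, cY, yc_sub, yc_zpt, re_zpt]; try ring
lemma ln4 : ln β 4 z = -z.re + yc z + (3 - β) := by
  simp [ln, sd, dir, fv, cX, cY, yc_sub, yc_zpt, re_zpt]; try ring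
lemma ln5 : ln β 5 z = z.re + 3 * yc z + (-3 + 3 * β) := by
  simp [ln, sd, dir, fv, cX, cY, yc_sub, yc_zpt, re_zpt]; try ring
lemma ln6 : ln β 6 z = -z.re + 3 * yc z + (3 + 3 * β) := by
  simp [ln, sd, dir, fv, cX, cY, yc_sub, yc_zpt, re_zpt]; try ring
lemma ln7 : ln β 7 z = -z.re - yc z + (3 + β) := by
  simp [ln, sd, dir, fv, cX, cY, yc_sub, yc_zpt, re_zpt]; try ring
lemma ln8 : ln β 8 z = -yc z + (1 / 2 - 1 / 2 * β) := by
  simp [ln, sd, dir, fv, cX, cY, yc_sub, yc_zpt, re_zpt]; try ring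
lemma ln9 : ln β 9 z = -z.re + (3 / 2 + 3 / 2 * β) := by
  simp [ln, sd, dir, fv, cX, cY, yc_sub, yc_zpt, re_zpt]; try ring
lemma ln10 : ln β 10 z = -z.re - 3 * yc z + (3 + 3 * β) := by
  simp [ln, sd, dir, fv, cX, cY, yc_sub, yc_zpt, re_zpt]; try ring
lemma ln11 : ln β 11 z = z.re - yc z + (-1 + β) := by
  simp [ln, sd, dir, fv, cX, cY, yc_sub, yc_zpt, re_zpt]; try ring
lemma ln12 : ln β 12 z = -yc z + (β) := by
  simp [ln, sd, dir, fv, cX, cY, yc_sub, yc_zpt, re_zpt]; try ring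
lemma ln13 : ln β 13 z = z.re := by
  simp [ln, sd, dir, fv, cX, cY, yc_sub, yc_zpt, re_zpt]; try ring

end

lemma isClosed_tile (β : ℝ) : IsClosed (tile β) := by
  have h : ∀ i, IsClosed {z | 0 ≤ ln β i z} := fun i =>
    isClosed_le continuous_const (continuous_ln β i)
  exact (h 1).inter ((h 2).inter (((h 4).union ((h 5).inter (h 6))).inter ((h 7).inter
    (((h 8).union ((h 9).inter (h 10))).inter
      ((h 0).union ((h 13).inter ((h 12).union (h 11))))))))

/-- Twice the constant coefficient of `sd d (zpt β x)` as a polynomial in `β`. -/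
def s0 (d : Fin 12) (x : V) : ℤ := cX d * (2 * x.1 + x.2.1) + cY d * x.2.1

/-- Twice the linear coefficient of `sd d (zpt β x)` as a polynomial in `β`. -/
def s1 (d : Fin 12) (x : V) : ℤ := -3 * cX d * x.2.2.2 + cY d * (2 * x.2.2.1 + x.2.2.2)

lemma sd_zpt (β : ℝ) (d : Fin 12) (x : V) : sd d (zpt β x) = (s0 d x + s1 d x * β) / 2 := by
  simp only [sd, yc_zpt, re_zpt, s0, s1]; push_cast; ring

/-- `a + b β` is nonnegative for all `β` between `3/5` and `2/3`. -/
abbrev Nn (a b : ℤ) : Prop := 0 ≤ 5 * a + 3 * b ∧ 0 ≤ 3 * a + 2 * b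

/-- `a + b β` is positive for all `β` strictly between `3/5` and `2/3`. -/
abbrev Ps (a b : ℤ) : Prop := Nn a b ∧ ¬ (a = 0 ∧ b = 0)

lemma Nn.nonneg {a b : ℤ} (h : Nn a b) {β : ℝ} (hβ : β ∈ Set.Ioo (3 / 5 : ℝ) (2 / 3)) :
    0 ≤ (a : ℝ) + b * β := by
  obtain ⟨h1, h2⟩ := h
  obtain ⟨h3, h4⟩ := hβ
  have h1' : (0 : ℝ) ≤ 5 * a + 3 * b := by exact_mod_cast h1
  have h2' : (0 : ℝ) ≤ 3 * a + 2 * b := by exact_mod_cast h2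
  nlinarith [mul_nonneg h1' (sub_nonneg.2 h4.le), mul_nonneg h2' (sub_nonneg.2 h3.le)]

lemma Ps.pos {a b : ℤ} (h : Ps a b) {β : ℝ} (hβ : β ∈ Set.Ioo (3 / 5 : ℝ) (2 / 3)) :
    0 < (a : ℝ) + b * β := by
  obtain ⟨⟨h1, h2⟩, h0⟩ := h
  obtain ⟨h3, h4⟩ := hβ
  have h1' : (0 : ℝ) ≤ 5 * a + 3 * b := by exact_mod_cast h1
  have h2' : (0 : ℝ) ≤ 3 * a + 2 * b := by exact_mod_cast h2
  have h5 : 0 < 5 * a + 3 * b ∨ 0 < 3 * a + 2 * b := by omega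
  rcases h5 with h5 | h5
  · have h5' : (0 : ℝ) < 5 * a + 3 * b := by exact_mod_cast h5
    nlinarith [mul_pos h5' (sub_pos.2 h4), mul_nonneg h2' (sub_nonneg.2 h3.le)]
  · have h5' : (0 : ℝ) < 3 * a + 2 * b := by exact_mod_cast h5
    nlinarith [mul_nonneg h1' (sub_nonneg.2 h4.le), mul_pos h5' (sub_pos.2 h3)]

/-- The Boolean combination of half-planes defining the prototile. -/
def Bf (h : Fin 14 → Bool) : Bool :=
  h 1 && h 2 && (h 4 || (h 5 && h 6)) && h 7 && (h 8 || (h 9 && h 10)) &&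
    (h 0 || (h 13 && (h 12 || h 11)))

lemma mem_tile {β : ℝ} {z : ℂ} :
    z ∈ tile β ↔ Bf (fun k => decide (0 ≤ ln β k z)) = true := by
  simp [Bf, tile, and_assoc]

lemma Bf_mono {h h' : Fin 14 → Bool} (H : ∀ k, h k = true → h' k = true) :
    Bf h = true → Bf h' = true := by
  simp only [Bf, Bool.and_eq_true, Bool.or_eq_true]
  exact And.imp (And.imp (And.imp (And.imp (And.imp (H 1) (H 2)) (Or.imp (H 4) (And.imp (H 5) (H 6))))
    (H 7)) (Or.imp (H 8) (And.imp (H 9) (H 10))))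
    (Or.imp (H 0) (And.imp (H 13) (Or.imp (H 12) (H 11))))

/-- The index of a half-plane occurring in `Bf` bounded by the line of the `i`-th edge. -/
def rep (i : Fin 14) : Fin 14 := if i = 3 then 2 else i

/-- Signs of the linear forms at the vertices: the form `k` is positive on the open segment
between the vertices `i` and `j`. -/
abbrev PosE (k i j : Fin 14) : Prop :=
  let a := fv i - fv k
  let b := fv j - fv k
  let d := dir k
  Nn (s0 d a) (s1 d a) ∧ Nn (s0 d b) (s1 d b) ∧ (Ps (s0 d a) (s1 d a) ∨ Ps (s0 d b) (s1 d b))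

/-- The form `k` is negative on the open segment between the vertices `i` and `j`. -/
abbrev NegE (k i j : Fin 14) : Prop :=
  let a := fv k - fv i
  let b := fv k - fv j
  let d := dir k
  Nn (s0 d a) (s1 d a) ∧ Nn (s0 d b) (s1 d b) ∧ (Ps (s0 d a) (s1 d a) ∨ Ps (s0 d b) (s1 d b))

/-- A point of the segment between two vertices. -/
def segpt (β : ℝ) (i j : Fin 14) (t : ℝ) : ℂ :=
  ((1 - t : ℝ) : ℂ) * zpt β (fv i) + (t : ℂ) * zpt β (fv j)

lemma ln_vert (β : ℝ) (k i : Fin 14) : ln β k (zpt β (fv i)) =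
    (s0 (dir k) (fv i - fv k) + s1 (dir k) (fv i - fv k) * β) / 2 := by
  rw [ln, ← zpt_sub, sd_zpt]

lemma ln_segpt (β : ℝ) (k i j : Fin 14) (t : ℝ) : ln β k (segpt β i j t) =
    (1 - t) * ln β k (zpt β (fv i)) + t * ln β k (zpt β (fv j)) := by
  simp only [ln, segpt, sd_sub, sd_add, sd_smul]; ring

lemma s0_neg (d : Fin 12) (x : V) : s0 d (-x) = -s0 d x := by simp [s0]; ring
lemma s1_neg (d : Fin 12) (x : V) : s1 d (-x) = -s1 d x := by simp [s1]; ring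

lemma PosE.pos {k i j : Fin 14} (h : PosE k i j) {β : ℝ} (hβ : β ∈ Set.Ioo (3 / 5 : ℝ) (2 / 3))
    {t : ℝ} (ht : t ∈ Set.Ioo (0 : ℝ) 1) : 0 < ln β k (segpt β i j t) := by
  obtain ⟨ha, hb, hc⟩ := h
  obtain ⟨t0, t1⟩ := ht
  rw [ln_segpt, ln_vert, ln_vert]
  have ha' := ha.nonneg hβ
  have hb' := hb.nonneg hβ
  have ht' := sub_pos.2 t1
  rcases hc with hc | hc
  · have := hc.pos hβ
    positivity
  · have := hc.pos hβ
    positivity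

lemma NegE.neg {k i j : Fin 14} (h : NegE k i j) {β : ℝ} (hβ : β ∈ Set.Ioo (3 / 5 : ℝ) (2 / 3))
    {t : ℝ} (ht : t ∈ Set.Ioo (0 : ℝ) 1) : ln β k (segpt β i j t) < 0 := by
  obtain ⟨ha, hb, hc⟩ := h
  obtain ⟨t0, t1⟩ := ht
  rw [ln_segpt, ln_vert, ln_vert, ← neg_pos]
  have ha' := ha.nonneg hβ
  have hb' := hb.nonneg hβ
  have ht' := sub_pos.2 t1
  rw [← neg_sub, s0_neg, s1_neg] at ha' hb'
  rw [← neg_sub (fv i), ← neg_sub (fv j), s0_neg, s1_neg, s0_neg, s1_neg] at hc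
  push_cast at ha' hb'
  rcases hc with hc | hc
  · have := hc.pos hβ
    push_cast at this
    nlinarith [mul_pos ht' this, mul_nonneg t0.le hb']
  · have := hc.pos hβ
    push_cast at this
    nlinarith [mul_nonneg ht'.le ha', mul_pos t0 this]

/-- Near a point of a segment between vertices, the prototile is given by the half-planes whose
sign is not constant. -/
lemma germ_aux {β : ℝ} (hβ : β ∈ Set.Ioo (3 / 5 : ℝ) (2 / 3)) {i j : Fin 14} {t : ℝ}
    (ht : t ∈ Set.Ioo (0 : ℝ) 1) (op : Bool → Bool → Bool) (a b : Fin 14)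
    (H : ∀ c d : Bool, (a = b → c = d) →
      Bf (fun k => if k = a then c else if k = b then d else decide (PosE k i j)) = op c d ∧
      Bf (fun k => if k = a then c else if k = b then d else !decide (NegE k i j)) = op c d) :
    ∀ᶠ z in 𝓝 (segpt β i j t),
      z ∈ tile β ↔ op (decide (0 ≤ ln β a z)) (decide (0 ≤ ln β b z)) = true := by
  have h1 : ∀ᶠ z in 𝓝 (segpt β i j t), ∀ k, PosE k i j → 0 ≤ ln β k z := by
    rw [eventually_all]
    intro k
    by_cases hk : PosE k i j
    · filter_upwards [(continuous_ln β k).continuousAt.eventually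
        (lt_mem_nhds (hk.pos hβ ht))] with z hz _ using hz.le
    · simp [hk]
  have h2 : ∀ᶠ z in 𝓝 (segpt β i j t), ∀ k, NegE k i j → ¬ 0 ≤ ln β k z := by
    rw [eventually_all]
    intro k
    by_cases hk : NegE k i j
    · filter_upwards [(continuous_ln β k).continuousAt.eventually
        (gt_mem_nhds (hk.neg hβ ht))] with z hz _ using not_le.2 hz
    · simp [hk]
  filter_upwards [h1, h2] with z hz1 hz2
  obtain ⟨H1, H2⟩ := H (decide (0 ≤ ln β a z)) (decide (0 ≤ ln β b z)) (by rintro rfl; rfl)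
  rw [mem_tile]
  constructor
  · intro h
    rw [← H2]
    refine Bf_mono (fun k hk => ?_) h
    split_ifs with ha hb
    · rwa [← ha]
    · rwa [← hb]
    · simp only [Bool.not_eq_true', decide_eq_false_iff_not]
      intro hn
      exact hz2 k hn (by simpa using hk)
  · intro h
    rw [← H1] at h
    refine Bf_mono (fun k hk => ?_) h
    split_ifs at hk with ha hb
    · rwa [ha]
    · rwa [hb]
    · simpa using hz1 k (of_decide_eq_true hk)

/-- The germ of the prototile at an open edge. -/
lemma germ_edge {β : ℝ} (hβ : β ∈ Set.Ioo (3 / 5 : ℝ) (2 / 3)) (i : Fin 14) {t : ℝ}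
    (ht : t ∈ Set.Ioo (0 : ℝ) 1) :
    ∀ᶠ z in 𝓝 (segpt β i (i + 1) t), z ∈ tile β ↔ 0 ≤ ln β (rep i) z := by
  have := germ_aux hβ (i := i) (j := i + 1) ht (fun c _ => c) (rep i) (rep i) (by
    revert i; decide +kernel)
  simpa using this

/-- The prototile is concave at the vertices `0`, `5`, `9`, `12`. -/
def reflex (i : Fin 14) : Bool := i = 0 || i = 5 || i = 9 || i = 12

/-- The germ of the prototile at a vertex. -/
lemma germ_vert {β : ℝ} (hβ : β ∈ Set.Ioo (3 / 5 : ℝ) (2 / 3)) (i : Fin 14) :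
    ∀ᶠ z in 𝓝 (zpt β (fv i)), z ∈ tile β ↔
      if reflex i then 0 ≤ ln β (rep (i - 1)) z ∨ 0 ≤ ln β (rep i) z
      else 0 ≤ ln β (rep (i - 1)) z ∧ 0 ≤ ln β (rep i) z := by
  have := germ_aux hβ (i := i) (j := i) (t := 1 / 2) (by norm_num)
    (fun c d => if reflex i then c || d else c && d) (rep (i - 1)) (rep i) (by
    revert i; decide +kernel)
  have e : segpt β i i (1 / 2) = zpt β (fv i) := by
    simp only [segpt]; push_cast; ring
  rw [e] at this
  filter_upwards [this] with z hz
  rw [hz]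
  split_ifs <;> simp

/-- The closed edge number `i` of the prototile. -/
def seg (β : ℝ) (i : Fin 14) : Set ℂ := segpt β i (i + 1) '' Set.Icc 0 1

lemma ext_yc {z w : ℂ} (h1 : z.re = w.re) (h2 : yc z = yc w) : z = w :=
  Complex.ext h1 (by rw [im_eq_yc, im_eq_yc, h2])

lemma segpt_re (β : ℝ) (i j : Fin 14) (t : ℝ) : (segpt β i j t).re =
    (1 - t) * (zpt β (fv i)).re + t * (zpt β (fv j)).re := by
  simp only [segpt, add_re, re_ofReal_mul]

lemma yc_segpt (β : ℝ) (i j : Fin 14) (t : ℝ) : yc (segpt β i j t) =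
    (1 - t) * yc (zpt β (fv i)) + t * yc (zpt β (fv j)) := by
  simp only [segpt, yc_add, yc_smul]

lemma mem_seg_of {β : ℝ} {i : Fin 14} {z : ℂ} (t : ℝ) (h0 : 0 ≤ t) (h1 : t ≤ 1)
    (hx : z.re = (1 - t) * (zpt β (fv i)).re + t * (zpt β (fv (i + 1))).re)
    (hy : yc z = (1 - t) * yc (zpt β (fv i)) + t * yc (zpt β (fv (i + 1)))) : z ∈ seg β i :=
  ⟨t, ⟨h0, h1⟩, (ext_yc (by rw [hx, segpt_re]) (by rw [hy, yc_segpt])).symm⟩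

section

variable {β : ℝ} {z : ℂ}

lemma mem_seg0 (h0 : 0 < β) (h : ln β 0 z = 0) (h1 : -3/2 * β ≤ z.re) (h2 : z.re ≤ 0) :
    z ∈ seg β 0 := by
  rw [ln0] at h
  refine mem_seg_of (((0) - z.re) / (3/2 * β)) (by apply div_nonneg <;> linarith)
    (by rw [div_le_one] <;> linarith) ?_ ?_ <;>
    (simp [re_zpt, yc_zpt, fv]; field_simp; try linarith)

lemma mem_seg1 (h : ln β 1 z = 0) (h1 : -3/2 * β ≤ z.re) (h2 : z.re ≤ 1/2 + -3/2 * β) :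
    z ∈ seg β 1 := by
  rw [ln1] at h
  refine mem_seg_of ((z.re - (-3/2 * β)) / (1/2)) (by apply div_nonneg <;> linarith)
    (by rw [div_le_one] <;> linarith) ?_ ?_ <;>
    (simp [re_zpt, yc_zpt, fv]; try field_simp; linarith)

lemma mem_seg2 (h : ln β 2 z = 0) (h1 : 1/2 + -3/2 * β ≤ z.re) (h2 : z.re ≤ 3/2 + -3/2 * β) :
    z ∈ seg β 2 := by
  rw [ln2] at h
  refine mem_seg_of ((z.re - (1/2 + -3/2 * β)) / (1)) (by apply div_nonneg <;> linarith)
    (by rw [div_le_one] <;> linarith) ?_ ?_ <;>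
    (simp [re_zpt, yc_zpt, fv]; try field_simp; linarith)

lemma mem_seg3 (h : ln β 3 z = 0) (h1 : 3/2 + -3/2 * β ≤ z.re) (h2 : z.re ≤ 5/2 + -3/2 * β) :
    z ∈ seg β 3 := by
  rw [ln3] at h
  refine mem_seg_of ((z.re - (3/2 + -3/2 * β)) / (1)) (by apply div_nonneg <;> linarith)
    (by rw [div_le_one] <;> linarith) ?_ ?_ <;>
    (simp [re_zpt, yc_zpt, fv]; try field_simp; linarith)

lemma mem_seg4 (h : ln β 4 z = 0) (h1 : 5/2 + -3/2 * β ≤ z.re) (h2 : z.re ≤ 3 + -3/2 * β) :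
    z ∈ seg β 4 := by
  rw [ln4] at h
  refine mem_seg_of ((z.re - (5/2 + -3/2 * β)) / (1/2)) (by apply div_nonneg <;> linarith)
    (by rw [div_le_one] <;> linarith) ?_ ?_ <;>
    (simp [re_zpt, yc_zpt, fv]; try field_simp; linarith)

lemma mem_seg5 (h0 : 0 < β) (h : ln β 5 z = 0) (h1 : 3 + -3/2 * β ≤ z.re) (h2 : z.re ≤ 3) :
    z ∈ seg β 5 := by
  rw [ln5] at h
  refine mem_seg_of ((z.re - (3 + -3/2 * β)) / (3/2 * β)) (by apply div_nonneg <;> linarith)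
    (by rw [div_le_one] <;> linarith) ?_ ?_ <;>
    (simp [re_zpt, yc_zpt, fv]; try field_simp; linarith)

lemma mem_seg6 (h0 : 0 < β) (h : ln β 6 z = 0) (h1 : 3 ≤ z.re) (h2 : z.re ≤ 3 + 3/2 * β) :
    z ∈ seg β 6 := by
  rw [ln6] at h
  refine mem_seg_of ((z.re - (3)) / (3/2 * β)) (by apply div_nonneg <;> linarith)
    (by rw [div_le_one] <;> linarith) ?_ ?_ <;>
    (simp [re_zpt, yc_zpt, fv]; try field_simp; linarith)

lemma mem_seg7 (h : ln β 7 z = 0) (h1 : 5/2 + 3/2 * β ≤ z.re) (h2 : z.re ≤ 3 + 3/2 * β) :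
    z ∈ seg β 7 := by
  rw [ln7] at h
  refine mem_seg_of (((3 + 3/2 * β) - z.re) / (1/2)) (by apply div_nonneg <;> linarith)
    (by rw [div_le_one] <;> linarith) ?_ ?_ <;>
    (simp [re_zpt, yc_zpt, fv]; try field_simp; linarith)

lemma mem_seg8 (h : ln β 8 z = 0) (h1 : 3/2 + 3/2 * β ≤ z.re) (h2 : z.re ≤ 5/2 + 3/2 * β) :
    z ∈ seg β 8 := by
  rw [ln8] at h
  refine mem_seg_of (((5/2 + 3/2 * β) - z.re) / (1)) (by apply div_nonneg <;> linarith)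
    (by rw [div_le_one] <;> linarith) ?_ ?_ <;>
    (simp [re_zpt, yc_zpt, fv]; try field_simp; linarith)

lemma mem_seg9 (h0 : 0 < β) (h : ln β 9 z = 0) (h1 : 1/2 + -1/2 * β ≤ yc z) (h2 : yc z ≤ 1/2 + 1/2 * β) :
    z ∈ seg β 9 := by
  rw [ln9] at h
  refine mem_seg_of ((yc z - (1/2 + -1/2 * β)) / (β)) (by apply div_nonneg <;> linarith)
    (by rw [div_le_one] <;> linarith) ?_ ?_ <;>
    (simp [re_zpt, yc_zpt, fv]; try field_simp; first
      | linarith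
      | linear_combination (-4 * β) * h)

lemma mem_seg10 (h0 : 0 < β) (h : ln β 10 z = 0) (h1 : 3/2 ≤ z.re) (h2 : z.re ≤ 3/2 + 3/2 * β) :
    z ∈ seg β 10 := by
  rw [ln10] at h
  refine mem_seg_of (((3/2 + 3/2 * β) - z.re) / (3/2 * β)) (by apply div_nonneg <;> linarith)
    (by rw [div_le_one] <;> linarith) ?_ ?_ <;>
    (simp [re_zpt, yc_zpt, fv]; try field_simp; first
      | linarith
      | linear_combination (-2 * β) * h)

lemma mem_seg11 (h : ln β 11 z = 0) (h1 : 1 ≤ z.re) (h2 : z.re ≤ 3/2) :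
    z ∈ seg β 11 := by
  rw [ln11] at h
  refine mem_seg_of (((3/2) - z.re) / (1/2)) (by apply div_nonneg <;> linarith)
    (by rw [div_le_one] <;> linarith) ?_ ?_ <;>
    (simp [re_zpt, yc_zpt, fv]; try field_simp; linarith)

lemma mem_seg12 (h : ln β 12 z = 0) (h1 : 0 ≤ z.re) (h2 : z.re ≤ 1) :
    z ∈ seg β 12 := by
  rw [ln12] at h
  refine mem_seg_of (((1) - z.re) / (1)) (by apply div_nonneg <;> linarith)
    (by rw [div_le_one] <;> linarith) ?_ ?_ <;>
    (simp [re_zpt, yc_zpt, fv]; try field_simp; linarith)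

lemma mem_seg13 (h0 : 0 < β) (h : ln β 13 z = 0) (h1 : 0 ≤ yc z) (h2 : yc z ≤ β) :
    z ∈ seg β 13 := by
  rw [ln13] at h
  refine mem_seg_of (((β) - yc z) / (β)) (by apply div_nonneg <;> linarith)
    (by rw [div_le_one] <;> linarith) ?_ ?_ <;>
    (simp [re_zpt, yc_zpt, fv]; first | linarith | (field_simp; linarith))

/-- The strict version of the half-plane description. -/
def tileO (β : ℝ) : Set ℂ := {z | Bf (fun k => decide (0 < ln β k z)) = true}

lemma mem_tileO : z ∈ tileO β ↔ 0 < ln β 1 z ∧ 0 < ln β 2 z ∧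
    (0 < ln β 4 z ∨ (0 < ln β 5 z ∧ 0 < ln β 6 z)) ∧
    0 < ln β 7 z ∧ (0 < ln β 8 z ∨ (0 < ln β 9 z ∧ 0 < ln β 10 z)) ∧
    (0 < ln β 0 z ∨ (0 < ln β 13 z ∧ (0 < ln β 12 z ∨ 0 < ln β 11 z))) := by
  simp [Bf, tileO, and_assoc]

lemma tileO_subset_tile : tileO β ⊆ tile β := by
  intro z hz
  rw [mem_tile]
  exact Bf_mono (fun k hk => by simpa using (of_decide_eq_true hk).le) hz

lemma isOpen_tileO : IsOpen (tileO β) := by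
  have h : ∀ i, IsOpen {z | 0 < ln β i z} := fun i =>
    isOpen_lt continuous_const (continuous_ln β i)
  have e : tileO β = _ := Set.ext fun z => mem_tileO
  rw [e]
  exact (h 1).inter ((h 2).inter (((h 4).union ((h 5).inter (h 6))).inter ((h 7).inter
    (((h 8).union ((h 9).inter (h 10))).inter
      ((h 0).union ((h 13).inter ((h 12).union (h 11))))))))

set_option maxHeartbeats 1000000 in
lemma mem_seg_of_frontier (hβ : β ∈ Set.Ioo (3 / 5 : ℝ) (2 / 3)) (hz : z ∈ tile β)
    (hz' : z ∉ tileO β) : ∃ i, z ∈ seg β i := by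
  obtain ⟨hb1, hb2⟩ := hβ
  have hb0 : 0 < β := by linarith
  obtain ⟨c1, c2, c3, c4, c5, c6⟩ := hz
  rw [mem_tileO] at hz'
  by_contra hn
  push Not at hn
  have n0 := fun h a b => hn 0 (mem_seg0 hb0 h a b)
  have n1 := fun h a b => hn 1 (mem_seg1 h a b)
  have n2 := fun h a b => hn 2 (mem_seg2 h a b)
  have n3 := fun h a b => hn 3 (mem_seg3 h a b)
  have n4 := fun h a b => hn 4 (mem_seg4 h a b)
  have n5 := fun h a b => hn 5 (mem_seg5 hb0 h a b)
  have n6 := fun h a b => hn 6 (mem_seg6 hb0 h a b)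
  have n7 := fun h a b => hn 7 (mem_seg7 h a b)
  have n8 := fun h a b => hn 8 (mem_seg8 h a b)
  have n9 := fun h a b => hn 9 (mem_seg9 hb0 h a b)
  have n10 := fun h a b => hn 10 (mem_seg10 hb0 h a b)
  have n11 := fun h a b => hn 11 (mem_seg11 h a b)
  have n12 := fun h a b => hn 12 (mem_seg12 h a b)
  have n13 := fun h a b => hn 13 (mem_seg13 hb0 h a b)
  clear hn
  simp only [ln0, ln1, ln2, ln3, ln4, ln5, ln6, ln7, ln8, ln9, ln10, ln11, ln12, ln13] at *
  generalize z.re = X at *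
  generalize yc z = Y at *
  have k1 : 0 < X + Y + 2 * β := by
    refine c1.lt_of_ne fun h => n1 h.symm ?_ ?_ <;> (clear hz' n0 n1 n2 n3 n4 n5 n6 n7 n8 n9 n10 n11 n12 n13; grind)
  have k2 : 0 < Y + (1 / 2 + 1 / 2 * β) := by
    refine c2.lt_of_ne fun h => ?_
    rcases le_total X (3 / 2 + -3 / 2 * β) with h' | h'
    · refine n2 h.symm ?_ h'; clear hz' n0 n1 n2 n3 n4 n5 n6 n7 n8 n9 n10 n11 n12 n13; grind
    · refine n3 h.symm h' ?_; clear hz' n0 n1 n2 n3 n4 n5 n6 n7 n8 n9 n10 n11 n12 n13; grind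
  have k4 : 0 < -X - Y + (3 + β) := by
    refine c4.lt_of_ne fun h => n7 h.symm ?_ ?_ <;> (clear hz' n0 n1 n2 n3 n4 n5 n6 n7 n8 n9 n10 n11 n12 n13; grind)
  have k3 : 0 < -X + Y + (3 - β) ∨ 0 < X + 3 * Y + (-3 + 3 * β) ∧ 0 < -X + 3 * Y + (3 + 3 * β) := by
    by_contra hk
    clear hz' c5 c6 n0 n1 n2 n3 n7 n8 n9 n10 n11 n12 n13
    grind (splits := 30)
  have k5 : 0 < -Y + (1 / 2 - 1 / 2 * β) ∨
      0 < -X + (3 / 2 + 3 / 2 * β) ∧ 0 < -X - 3 * Y + (3 + 3 * β) := by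
    by_contra hk
    clear hz' c3 n0 n1 n2 n3 n7 n4 n5 n6 n13 n12 n11
    grind (splits := 30)
  have k6 : 0 < X - 3 * Y ∨ 0 < X ∧ (0 < -Y + β ∨ 0 < X - Y + (-1 + β)) := by
    by_contra hk
    clear hz' c3 n1 n2 n3 n4 n5 n6 n7 n8 n9 n10
    grind (splits := 30)
  exact hz' ⟨k1, k2, k3, k4, k5, k6⟩

end

/-- `exp (iπ/6)`. -/
def ze : ℂ := ⟨r3 / 2, 1 / 2⟩

/-- The twelfth roots of unity. -/
def Z (j : Fin 12) : ℂ := ze ^ (j : ℕ)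

lemma ze_sq : ze ^ 2 = om := by
  have h := r3_sq
  rw [pow_two]
  apply Complex.ext
  · simp [ze, om]; linear_combination (1 / 4 : ℝ) * h
  · simp [ze, om]; ring

lemma om_cube : om ^ 3 = -1 := by
  have h := r3_sq
  have h2 : om ^ 2 = om - 1 := by
    rw [pow_two]
    apply Complex.ext
    · simp [om]; linear_combination (-1 / 4 : ℝ) * h
    · simp [om]; ring
  rw [pow_succ, h2, sub_mul, ← pow_two, h2]; ring

lemma ze_six : ze ^ 6 = -1 := by
  rw [show 6 = 2 * 3 from rfl, pow_mul, ze_sq, om_cube]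

lemma ze_twelve : ze ^ 12 = 1 := by
  rw [show 12 = 6 * 2 from rfl, pow_mul, ze_six]; norm_num

lemma norm_ze : ‖ze‖ = 1 :=
  (pow_eq_one_iff_of_nonneg (norm_nonneg _) (by norm_num)).1
    (by rw [← norm_pow, ze_twelve, norm_one] : ‖ze‖ ^ 12 = 1)

lemma norm_Z (j : Fin 12) : ‖Z j‖ = 1 := by simp [Z, norm_ze]

lemma Z_ne_zero (j : Fin 12) : Z j ≠ 0 := norm_ne_zero_iff.1 (by rw [norm_Z]; norm_num)

lemma conj_Z (j : Fin 12) : (starRingEnd ℂ) (Z j) = Z (-j) := by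
  have h : Z j * Z (-j) = 1 := by
    rw [Z, Z, ← pow_add]
    by_cases hj : j = 0
    · subst hj; simp
    · have : (j : ℕ) + ((-j : Fin 12) : ℕ) = 12 := by
        revert j; decide
      rw [this, ze_twelve]
  have h2 : Z j * (starRingEnd ℂ) (Z j) = 1 := by
    rw [Complex.mul_conj, Complex.normSq_eq_norm_sq, norm_Z]; norm_num
  exact mul_left_cancel₀ (Z_ne_zero j) (h2.trans h.symm)

lemma sd_ze (d : Fin 12) : ∃ c : ℝ, 0 < c ∧ ∀ y, sd (d + 1) (ze * y) = c * sd d y := by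
  have h := r3_sq
  have hp := r3_pos
  have e1 : ∀ y, (ze * y).re = r3 * ((y.re - yc y) / 2) := fun y => by
    simp [ze, im_eq_yc]; ring
  have e2 : ∀ y, yc (ze * y) = r3 * ((y.re + 3 * yc y) / 6) := fun y => by
    rw [yc, div_eq_iff hp.ne']
    rw [ze, mul_im, im_eq_yc y]; linear_combination (-y.re / 6) * h
  refine ⟨r3 * ![2, 1/3, 1/2, 2/3, 1, 1/6, 2, 1/3, 1/2, 2/3, 1, 1/6] d, mul_pos hp ?_, fun y => ?_⟩
  · fin_cases d <;> norm_num
  · simp only [sd, e1, e2]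
    generalize y.re = X
    generalize yc y = Y
    suffices cX (d + 1) * ((X - Y) / 2) + cY (d + 1) * ((X + 3 * Y) / 6) =
        ![2, 1/3, 1/2, 2/3, 1, 1/6, 2, 1/3, 1/2, 2/3, 1, 1/6] d * (cX d * X + cY d * Y) by linear_combination r3 * this
    fin_cases d <;> simp [cX, cY] <;> ring

open Fin.CommRing in
lemma sd_pow (n : ℕ) (d : Fin 12) (y : ℂ) :
    0 ≤ sd (d + (n : Fin 12)) (ze ^ n * y) ↔ 0 ≤ sd d y := by
  induction n generalizing d y with
  | zero => simp
  | succ n ih =>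
    obtain ⟨c, hc, h⟩ := sd_ze (d + (n : Fin 12))
    rw [pow_succ', mul_assoc, Nat.cast_succ, ← add_assoc, h, mul_nonneg_iff_of_pos_left hc, ih]

open Fin.CommRing in
lemma sd_Z (j d : Fin 12) (y : ℂ) : 0 ≤ sd d (Z j * y) ↔ 0 ≤ sd (d - j) y := by
  have := sd_pow j (d - j) y
  rw [Fin.cast_val_eq_self, sub_add_cancel] at this
  exact this

lemma sd_add_six (d : Fin 12) (y : ℂ) : sd (d + 6) y = -sd d y := by
  fin_cases d <;> simp [sd, cX, cY] <;> ring

lemma sd_between (d : Fin 12) : ∃ a b : ℝ, 0 < a ∧ 0 < b ∧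
    ∀ y, sd (d + 1) y = a * sd d y + b * sd (d + 2) y := by
  refine ⟨![2, 1/3, 1/2, 2/3, 1, 1/6, 2, 1/3, 1/2, 2/3, 1, 1/6] d, ![1, 2/3, 1/2, 1/3, 2, 1/6, 1, 2/3, 1/2, 1/3, 2, 1/6] d, ?_, ?_, fun y => ?_⟩
  · fin_cases d <;> norm_num
  · fin_cases d <;> norm_num
  · simp only [sd]
    fin_cases d <;> simp [cX, cY] <;> ring

lemma sd_between_two (d : Fin 12) : ∃ a b : ℝ, 0 < a ∧ 0 < b ∧
    ∀ y, sd (d + 2) y = a * sd d y + b * sd (d + 4) y := by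
  refine ⟨![2, 1/2, 1, 2, 1/2, 1, 2, 1/2, 1, 2, 1/2, 1] d, ![1, 1/2, 2, 1, 1/2, 2, 1, 1/2, 2, 1, 1/2, 2] d, ?_, ?_, fun y => ?_⟩
  · fin_cases d <;> norm_num
  · fin_cases d <;> norm_num
  · simp only [sd]
    fin_cases d <;> simp [cX, cY] <;> ring

lemma pattern_aux : ∀ s : Fin 6 → Bool,
    let S : Fin 12 → Bool := fun d => if h : d.val < 6 then s ⟨d.val, h⟩ else !s ⟨d.val - 6, by omega⟩
    (∀ d, S d = S (d + 2) → S (d + 1) = S d) → (∀ d, S d = S (d + 4) → S (d + 2) = S d) →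
     ∃ m : Fin 12, ∀ d, S d = decide ((d - m).val < 6) := by
  decide +kernel

/-- The pattern of signs of the twelve linear forms. -/
lemma sd_pattern {y : ℂ} (hy : ∀ d, sd d y ≠ 0) :
    ∃ m : Fin 12, ∀ d, 0 ≤ sd d y ↔ (d - m).val < 6 := by
  have hS : ∀ d : Fin 12, (if h : d.val < 6 then decide (0 ≤ sd ((⟨d.val, h⟩ : Fin 6).castLE (by norm_num)) y)
      else !decide (0 ≤ sd ((⟨d.val - 6, by omega⟩ : Fin 6).castLE (by norm_num)) y)) =
      decide (0 ≤ sd d y) := by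
    intro d
    split_ifs with h
    · rfl
    · obtain ⟨d', hd', e⟩ : ∃ d' : Fin 12, d' = (⟨d.val - 6, by omega⟩ : Fin 6).castLE (by norm_num) ∧
          d = d' + 6 := ⟨_, rfl, by revert d; decide⟩
      rw [← hd', e, sd_add_six]
      by_cases h0 : 0 ≤ sd d' y
      · have := lt_of_le_of_ne h0 (hy d').symm
        simp [h0, this]
      · simp [h0, (not_le.1 h0).le]
  obtain ⟨m, hm⟩ := pattern_aux
    (fun d => decide (0 ≤ sd (d.castLE (by norm_num : 6 ≤ 12)) y)) (by
    intro d
    simp only [hS]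
    obtain ⟨a, b, ha, hb, h⟩ := sd_between d
    intro he
    rw [decide_eq_decide] at he ⊢
    rw [h]
    by_cases h0 : 0 ≤ sd d y
    · simp only [h0, iff_true]
      have := he.1 h0
      positivity
    · simp only [h0, iff_false]
      have h1 := mt he.2 h0
      push Not at h0 h1 ⊢
      nlinarith) (by
    intro d
    simp only [hS]
    obtain ⟨a, b, ha, hb, h⟩ := sd_between_two d
    intro he
    rw [decide_eq_decide] at he ⊢
    rw [h]
    by_cases h0 : 0 ≤ sd d y
    · simp only [h0, iff_true]
      have := he.1 h0
      positivity
    · simp only [h0, iff_false]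
      have h1 := mt he.2 h0
      push Not at h0 h1 ⊢
      nlinarith)
  refine ⟨m, fun d => ?_⟩
  have := hm d
  simp only [hS] at this
  rwa [decide_eq_decide] at this

/-- The filter of generic points near `0`. -/
def gen : Filter ℂ := 𝓝 0 ⊓ residual ℂ

instance : gen.NeBot := by
  rw [gen, inf_neBot_iff]
  intro s hs t ht
  exact (dense_of_mem_residual ht).inter_nhds_nonempty hs |>.mono fun x hx => ⟨hx.2, hx.1⟩

lemma gen_le_nhds : gen ≤ 𝓝 0 := inf_le_left

lemma eventually_gen_sd : ∀ᶠ y in gen, ∀ d, sd d y ≠ 0 := by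
  rw [eventually_all]
  intro d
  refine Filter.mem_of_superset (mem_inf_of_right (residual_of_dense_open (s := {y | sd d y ≠ 0})
    (isOpen_ne_fun (continuous_sd d) continuous_const) ?_)) fun _ h => h
  obtain ⟨w, hw⟩ : ∃ w, sd d w ≠ 0 := by
    by_cases h : cX d = 0
    · refine ⟨⟨0, r3⟩, ?_⟩
      have : cY d ≠ 0 := by revert h; revert d; decide
      simpa [sd, yc, h] using this
    · exact ⟨1, by simpa [sd, yc] using h⟩
  intro x
  by_cases hx : sd d x = 0
  · have : Tendsto (fun t : ℝ => x + t * w) (𝓝[≠] 0) (𝓝 x) := by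
      have : Continuous fun t : ℝ => x + t * w := by fun_prop
      simpa using (this.tendsto 0).mono_left nhdsWithin_le_nhds
    refine mem_closure_of_tendsto this ?_
    filter_upwards [self_mem_nhdsWithin] with t ht
    simp only [sd_add, sd_smul, hx, zero_add]
    exact mul_ne_zero ht hw
  · exact subset_closure hx

open scoped Classical in
/-- The number of the twelve points `x + ζ^j y` in `P`. -/
def star (P : Set ℂ) (x y : ℂ) : ℕ := (Finset.univ.filter fun j : Fin 12 => x + Z j * y ∈ P).card

/-- The set `P` has angle `mπ/6` at `x`. -/
def HasAngle (P : Set ℂ) (x : ℂ) (m : ℕ) : Prop := ∀ᶠ y in gen, star P x y = m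

lemma HasAngle.unique {P : Set ℂ} {x : ℂ} {m n : ℕ} (h : HasAngle P x m) (h' : HasAngle P x n) :
    m = n := by
  obtain ⟨y, h1, h2⟩ := (h.and h').exists
  exact h1.symm.trans h2

lemma eventually_gen_forall {x : ℂ} {p : ℂ → Prop} (h : ∀ᶠ z in 𝓝 x, p z) :
    ∀ᶠ y in gen, ∀ j, p (x + Z j * y) := by
  rw [eventually_all]
  intro j
  have : Tendsto (fun y => x + Z j * y) (𝓝 0) (𝓝 x) := by
    have : Continuous fun y => x + Z j * y := by fun_prop
    simpa using this.tendsto 0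
  exact gen_le_nhds (this.eventually h)

lemma HasAngle.of_germ {P : Set ℂ} {x : ℂ} (op : Bool → Bool → Bool) (a b : Fin 12)
    (h : ∀ᶠ z in 𝓝 x, z ∈ P ↔ op (decide (0 ≤ sd a (z - x))) (decide (0 ≤ sd b (z - x))) = true)
    {m : ℕ} (H : ∀ k : Fin 12, (Finset.univ.filter fun j : Fin 12 =>
      op (decide ((a - j - k).val < 6)) (decide ((b - j - k).val < 6)) = true).card = m) :
    HasAngle P x m := by
  filter_upwards [eventually_gen_forall h, eventually_gen_sd] with y h1 h2
  obtain ⟨k, hk⟩ := sd_pattern h2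
  rw [← H k, star]
  congr 1
  ext j
  simp only [Finset.mem_filter, Finset.mem_univ, true_and]
  rw [h1 j]
  simp only [add_sub_cancel_left, sd_Z, hk]

lemma HasAngle.of_mem_interior {P : Set ℂ} {x : ℂ} (h : x ∈ interior P) : HasAngle P x 12 :=
  .of_germ (fun _ _ => true) 0 0 (by simpa using mem_interior_iff_mem_nhds.1 h) (by simp)

lemma HasAngle.of_notMem {P : Set ℂ} (hP : IsClosed P) {x : ℂ} (h : x ∉ P) : HasAngle P x 0 :=
  .of_germ (fun _ _ => false) 0 0 (by
    filter_upwards [hP.isOpen_compl.mem_nhds h] with z hz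
    simpa using hz) (by simp)

/-- The angles of the prototile, in multiples of `π/6`. -/
def ang : Fin 14 → ℕ := ![8, 3, 4, 6, 4, 9, 4, 3, 4, 9, 4, 3, 8, 3]

lemma hasAngle_edge {β : ℝ} (hβ : β ∈ Set.Ioo (3 / 5 : ℝ) (2 / 3)) (i : Fin 14) {t : ℝ}
    (ht : t ∈ Set.Ioo (0 : ℝ) 1) : HasAngle (tile β) (segpt β i (i + 1) t) 6 := by
  have h := germ_edge hβ i ht
  have e : ln β (rep i) (segpt β i (i + 1) t) = 0 := by
    have h0 : ∀ i, ln β (rep i) (zpt β (fv i)) = 0 ∧ ln β (rep i) (zpt β (fv (i + 1))) = 0 := by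
      simp only [ln_vert]
      intro i
      constructor
      · rw [(by revert i; decide +kernel : s0 (dir (rep i)) (fv i - fv (rep i)) = 0),
          (by revert i; decide +kernel : s1 (dir (rep i)) (fv i - fv (rep i)) = 0)]; simp
      · rw [(by revert i; decide +kernel : s0 (dir (rep i)) (fv (i + 1) - fv (rep i)) = 0),
          (by revert i; decide +kernel : s1 (dir (rep i)) (fv (i + 1) - fv (rep i)) = 0)]; simp
    rw [ln_segpt, (h0 i).1, (h0 i).2]; simp
  refine .of_germ (fun c _ => c) (dir (rep i)) (dir (rep i)) ?_ (by clear * -; revert i; decide +kernel)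
  filter_upwards [h] with z hz
  rw [hz, decide_eq_true_iff]
  rw [ln, sd_sub] at *
  rw [sd_sub]
  constructor <;> intro <;> linarith

lemma hasAngle_vert {β : ℝ} (hβ : β ∈ Set.Ioo (3 / 5 : ℝ) (2 / 3)) (i : Fin 14) :
    HasAngle (tile β) (zpt β (fv i)) (ang i) := by
  have h := germ_vert hβ i
  have e : ∀ k, (k = rep i ∨ k = rep (i - 1)) → ∀ z, ln β k z = sd (dir k) (z - zpt β (fv i)) := by
    intro k hk z
    have : sd (dir k) (zpt β (fv i - fv k)) = 0 := by
      rw [sd_zpt, (by clear h; revert i k; decide +kernel : s0 (dir k) (fv i - fv k) = 0),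
        (by clear h; revert i k; decide +kernel : s1 (dir k) (fv i - fv k) = 0)]
      simp
    rw [zpt_sub, sd_sub] at this
    rw [ln, sd_sub, sd_sub]
    linarith
  refine .of_germ (fun c d => if reflex i then c || d else c && d) (dir (rep (i - 1)))
    (dir (rep i)) ?_ (by clear * -; revert i; decide +kernel)
  filter_upwards [h] with z hz
  rw [hz, e _ (Or.inl rfl), e _ (Or.inr rfl)]
  split_ifs <;> simp

/-- The range of admissible parameters. -/
def Adm (β : ℝ) : Prop := β ∈ Set.Ioo (3 / 5 : ℝ) (2 / 3) ∧ Irrational β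

/-- The vertices of the prototile. -/
def vt (β : ℝ) (i : Fin 14) : ℂ := zpt β (fv i)

/-- The end of the `i`-th edge at which the angle is a multiple of `2π/3`. -/
def hx (i : Fin 14) : Fin 14 := if i.val % 2 = 0 then i else i + 1

/-- The end of the `i`-th edge at which the angle is a multiple of `π/2`. -/
def sq (i : Fin 14) : Fin 14 := if i.val % 2 = 0 then i + 1 else i

/-- The direction of the `i`-th edge, pointing to the vertex `hx i`. -/
def udir (i : Fin 14) : Fin 12 := if i.val % 2 = 0 then dir i + 6 else dir i

/-- The length of an edge of direction `d`. -/
def len (β : ℝ) (d : Fin 12) : ℝ := if d.val % 2 = 0 then 1 else r3 * β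

open scoped Classical in
/-- The angle of a set at a point, in multiples of `π/6`. -/
def cnt (P : Set ℂ) (x : ℂ) : ℕ := if h : ∃ m, HasAngle P x m then h.choose else 0

lemma HasAngle.cnt_eq {P : Set ℂ} {x : ℂ} {m : ℕ} (h : HasAngle P x m) : cnt P x = m := by
  have h' : ∃ m, HasAngle P x m := ⟨m, h⟩
  rw [cnt, dif_pos h']
  exact h'.choose_spec.unique h

lemma fv_injective : Function.Injective fv := by decide

lemma vt_injective {β : ℝ} (hβ : Adm β) : Function.Injective (vt β) :=
  (zpt_injective hβ.2).comp fv_injective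

lemma Z_succ (j : Fin 12) : Z (j + 1) = ze * Z j := by
  by_cases h : j = 11
  · subst h
    change ze ^ 0 = ze * ze ^ 11
    rw [← pow_succ', ze_twelve, pow_zero]
  · have : ((j + 1 : Fin 12) : ℕ) = j + 1 := by revert j; decide
    rw [Z, Z, this, pow_succ']

lemma Z_val (j : Fin 12) : Z j =
    ⟨![1, r3 / 2, 1 / 2, 0, -1 / 2, -r3 / 2, -1, -r3 / 2, -1 / 2, 0, 1 / 2, r3 / 2] j,
      ![0, 1 / 2, r3 / 2, 1, r3 / 2, 1 / 2, 0, -1 / 2, -r3 / 2, -1, -r3 / 2, -1 / 2] j⟩ := by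
  have h := r3_sq
  induction j using Fin.induction with
  | zero => simp [Z]; rfl
  | succ j ih =>
    have e : (j.succ : Fin 12) = j.castSucc + 1 := by simp
    rw [e, Z_succ, ih]
    fin_cases j <;> apply Complex.ext <;> simp [ze] <;> linarith

lemma Z_add_six (j : Fin 12) : Z (j + 6) = -Z j := by
  have : j + 6 = j + 1 + 1 + 1 + 1 + 1 + 1 := by revert j; decide
  rw [this]
  simp only [Z_succ]
  linear_combination (Z j) * ze_six

lemma ze_cube : ze ^ 3 = I := by
  have h := Z_val 3
  exact h.trans (by apply Complex.ext <;> simp)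

lemma Z_add_three (j : Fin 12) : Z (j + 3) = I * Z j := by
  have : j + 3 = j + 1 + 1 + 1 := by revert j; decide
  rw [this]
  simp only [Z_succ]
  linear_combination (Z j) * ze_cube

lemma len_pos {β : ℝ} (hβ : Adm β) (d : Fin 12) : 0 < len β d := by
  have := hβ.1.1
  rw [len]; split_ifs
  · norm_num
  · exact mul_pos r3_pos (by linarith)

lemma vt_succ_sub (β : ℝ) (i : Fin 14) : vt β (i + 1) - vt β i = len β (dir i) * Z (dir i) := by
  have h := r3_sq
  rw [vt, vt, ← zpt_sub]
  fin_cases i <;> simp only [dir] <;> apply Complex.ext <;>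
    simp [Z_val, len, zpt, fv] <;>
    first | linarith | linear_combination (β / 2) * h | linear_combination (-β / 2) * h

lemma hx_sub_sq (β : ℝ) (i : Fin 14) :
    vt β (hx i) - vt β (sq i) = len β (udir i) * Z (udir i) := by
  have h6 : len β (dir i + 6) = len β (dir i) := by
    have : (dir i + 6).val % 2 = (dir i).val % 2 := by revert i; decide
    rw [len, len, this]
  have h := vt_succ_sub β i
  unfold hx sq udir
  split_ifs
  · rw [Z_add_six, h6]; linear_combination -h
  · exact h

lemma isClosed_seg (β : ℝ) (i : Fin 14) : IsClosed (seg β i) := by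
  refine (isCompact_Icc.image ?_).isClosed
  unfold segpt
  fun_prop

lemma segpt_eq (β : ℝ) (i j : Fin 14) (t : ℝ) : segpt β i j t = vt β i + t * (vt β j - vt β i) := by
  rw [segpt, vt, vt]; push_cast; ring

lemma tile_cases {β : ℝ} (hβ : Adm β) (x : ℂ) : (x ∉ tile β ∧ cnt (tile β) x = 0) ∨
    (x ∈ interior (tile β) ∧ cnt (tile β) x = 12) ∨
    (∃ i, ∃ t ∈ Set.Ioo (0 : ℝ) 1, x = vt β i + t * (vt β (i + 1) - vt β i) ∧ cnt (tile β) x = 6) ∨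
    ∃ i, x = vt β i ∧ cnt (tile β) x = ang i := by
  by_cases hx : x ∈ tile β
  swap
  · exact Or.inl ⟨hx, (HasAngle.of_notMem (isClosed_tile β) hx).cnt_eq⟩
  right
  by_cases hx' : x ∈ tileO β
  · have : x ∈ interior (tile β) := interior_maximal tileO_subset_tile isOpen_tileO hx'
    exact Or.inl ⟨this, (HasAngle.of_mem_interior this).cnt_eq⟩
  right
  obtain ⟨i, t, ⟨h0, h1⟩, ht⟩ := mem_seg_of_frontier hβ.1 hx hx'
  rcases h0.eq_or_lt with h0 | h0
  · have : x = vt β i := by rw [← ht, segpt_eq, ← h0]; simp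
    exact Or.inr ⟨i, this, by rw [this]; exact (hasAngle_vert hβ.1 i).cnt_eq⟩
  rcases h1.eq_or_lt with h1 | h1
  · have : x = vt β (i + 1) := by rw [← ht, segpt_eq, h1]; simp
    exact Or.inr ⟨i + 1, this, by rw [this]; exact (hasAngle_vert hβ.1 _).cnt_eq⟩
  · exact Or.inl ⟨i, t, ⟨h0, h1⟩, by rw [← ht, segpt_eq],
      by rw [← ht]; exact (hasAngle_edge hβ.1 i ⟨h0, h1⟩).cnt_eq⟩

lemma cnt_vt {β : ℝ} (hβ : Adm β) (i : Fin 14) : cnt (tile β) (vt β i) = ang i :=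
  (hasAngle_vert hβ.1 i).cnt_eq

lemma exists_seg_of_cnt {β : ℝ} (hβ : Adm β) {x : ℂ} (h0 : cnt (tile β) x ≠ 0)
    (h1 : cnt (tile β) x ≠ 12) : ∃ i, x ∈ seg β i := by
  rcases tile_cases hβ x with h | h | ⟨i, t, ht, h, -⟩ | ⟨i, h, -⟩
  · exact absurd h.2 h0
  · exact absurd h.2 h1
  · exact ⟨i, t, ⟨ht.1.le, ht.2.le⟩, by rw [h, segpt_eq]⟩
  · exact ⟨i, 0, by simp, by rw [h, segpt_eq]; simp⟩

lemma cnt_mem {β : ℝ} (hβ : Adm β) (x : ℂ) :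
    cnt (tile β) x ∈ ({0, 3, 4, 6, 8, 9, 12} : Finset ℕ) := by
  rcases tile_cases hβ x with h | h | ⟨i, t, ht, -, h⟩ | ⟨i, -, h⟩
  · simp [h.2]
  · simp [h.2]
  · simp [h]
  · rw [h]; clear h; revert i; decide

lemma cnt_eq_zero {β : ℝ} (hβ : Adm β) {x : ℂ} : cnt (tile β) x = 0 ↔ x ∉ tile β := by
  constructor
  · intro h hx
    rcases tile_cases hβ x with h' | h' | ⟨i, t, ht, -, h'⟩ | ⟨i, -, h'⟩
    · exact h'.1 hx
    · omega
    · omega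
    · rw [h] at h'; clear h; revert i; decide
  · intro h
    exact (HasAngle.of_notMem (isClosed_tile β) h).cnt_eq

lemma hasAngle_cnt {β : ℝ} (hβ : Adm β) (x : ℂ) : HasAngle (tile β) x (cnt (tile β) x) := by
  suffices ∃ m, HasAngle (tile β) x m by
    rw [cnt, dif_pos this]; exact this.choose_spec
  by_cases hx : x ∈ tile β
  swap
  · exact ⟨_, HasAngle.of_notMem (isClosed_tile β) hx⟩
  rcases tile_cases hβ x with h | h | ⟨i, t, ht, h, -⟩ | ⟨i, h, -⟩
  · exact absurd hx h.1
  · exact ⟨_, HasAngle.of_mem_interior h.1⟩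
  · rw [h, ← segpt_eq]; exact ⟨_, hasAngle_edge hβ.1 i ht⟩
  · rw [h]; exact ⟨_, hasAngle_vert hβ.1 i⟩

/-- The pair `(q, p)` is an edge of the prototile, with `q` its end of type `hx`. -/
def Edge₀ (β : ℝ) (q p : ℂ) : Prop := ∃ i, q = vt β (hx i) ∧ p = vt β (sq i)

lemma edge₀_succ (β : ℝ) (i : Fin 14) :
    Edge₀ β (vt β i) (vt β (i + 1)) ∨ Edge₀ β (vt β (i + 1)) (vt β i) := by
  by_cases h : i.val % 2 = 0
  · exact Or.inl ⟨i, by simp [hx, h], by simp [sq, h]⟩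
  · exact Or.inr ⟨i, by simp [hx, h], by simp [sq, h]⟩

lemma Edge₀.exists_succ {β : ℝ} {q p : ℂ} (h : Edge₀ β q p) :
    ∃ i, (q = vt β i ∧ p = vt β (i + 1)) ∨ (p = vt β i ∧ q = vt β (i + 1)) := by
  obtain ⟨i, h1, h2⟩ := h
  refine ⟨i, ?_⟩
  unfold hx at h1
  unfold sq at h2
  split_ifs at h1 h2
  · exact Or.inl ⟨h1, h2⟩
  · exact Or.inr ⟨h2, h1⟩

/-- A continuous positively homogeneous function that is positive off the origin. -/
structure IsGauge (ρ : ℂ → ℝ) : Prop where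
  cont : Continuous ρ
  smul : ∀ t : ℝ, 0 ≤ t → ∀ y, ρ (t * y) = t * ρ y
  pos : ∀ y, y ≠ 0 → 0 < ρ y

namespace IsGauge

variable {ρ : ℂ → ℝ} (h : IsGauge ρ)

include h

lemma zero : ρ 0 = 0 := by simpa using h.smul 0 le_rfl 0

lemma exists_lower : ∃ c > 0, ∀ y, c * ‖y‖ ≤ ρ y := by
  obtain ⟨u, hu, hm⟩ := (isCompact_sphere (0 : ℂ) 1).exists_isMinOn ⟨1, by simp⟩
    h.cont.continuousOn
  have hu0 : u ≠ 0 := by rintro rfl; simp at hu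
  refine ⟨ρ u, h.pos u hu0, fun y => ?_⟩
  rcases eq_or_ne y 0 with rfl | hy
  · simp [h.zero]
  have hn : 0 < ‖y‖ := norm_pos_iff.2 hy
  have h1 : ρ u ≤ ρ ((‖y‖⁻¹ : ℝ) * y) := by
    refine hm ?_
    simp [hy]
  rw [h.smul _ (by positivity)] at h1
  calc ρ u * ‖y‖ ≤ (‖y‖⁻¹ * ρ y) * ‖y‖ := by gcongr
    _ = ρ y := by field_simp

lemma isCompact_le (k : ℂ) (r : ℝ) : IsCompact {z | ρ (z - k) ≤ r} := by
  obtain ⟨c, hc, hb⟩ := h.exists_lower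
  refine Metric.isCompact_of_isClosed_isBounded
    (isClosed_le (h.cont.comp (continuous_id.sub continuous_const)) continuous_const) ?_
  refine (Metric.isBounded_closedBall (x := k) (r := r / c)).subset fun z hz => ?_
  have := hb (z - k)
  rw [Metric.mem_closedBall, dist_eq_norm, le_div_iff₀ hc]
  have h2 : ρ (z - k) ≤ r := hz
  linarith

/-- The radial homeomorphism that takes a gauge to the norm. -/
def radial : ℂ ≃ₜ ℂ where
  toFun y := ((ρ y / ‖y‖ : ℝ) : ℂ) * y
  invFun y := ((‖y‖ / ρ y : ℝ) : ℂ) * y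
  left_inv y := by
    rcases eq_or_ne y 0 with rfl | hy
    · simp
    have hn : 0 < ‖y‖ := norm_pos_iff.2 hy
    have hp := h.pos y hy
    change ((‖_‖ / ρ _ : ℝ) : ℂ) * _ = y
    rw [h.smul _ (by positivity), norm_mul, norm_real, Real.norm_of_nonneg (by positivity),
      ← mul_assoc, ← ofReal_mul]
    have : ρ y / ‖y‖ * ‖y‖ / (ρ y / ‖y‖ * ρ y) * (ρ y / ‖y‖) = 1 := by field_simp
    rw [this]; simp
  right_inv y := by
    rcases eq_or_ne y 0 with rfl | hy
    · simp
    have hn : 0 < ‖y‖ := norm_pos_iff.2 hy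
    have hp := h.pos y hy
    change ((ρ _ / ‖_‖ : ℝ) : ℂ) * _ = y
    rw [h.smul _ (by positivity), norm_mul, norm_real, Real.norm_of_nonneg (by positivity),
      ← mul_assoc, ← ofReal_mul]
    have : ‖y‖ / ρ y * ρ y / (‖y‖ / ρ y * ‖y‖) * (‖y‖ / ρ y) = 1 := by field_simp
    rw [this]; simp
  continuous_toFun := by
    rw [continuous_iff_continuousAt]
    intro y
    rcases eq_or_ne y 0 with rfl | hy
    · refine tendsto_iff_norm_sub_tendsto_zero.2 ?_
      have h0 : Tendsto ρ (𝓝 0) (𝓝 0) := by simpa [h.zero] using h.cont.tendsto 0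
      refine h0.congr fun y => ?_
      rcases eq_or_ne y 0 with rfl | hy
      · simp [h.zero]
      have hn : 0 < ‖y‖ := norm_pos_iff.2 hy
      have hp := h.pos y hy
      simp only [mul_zero, sub_zero, norm_mul, norm_real]
      rw [Real.norm_of_nonneg (by positivity)]
      field_simp
    · have := h.cont
      have hn : ‖y‖ ≠ 0 := norm_ne_zero_iff.2 hy
      fun_prop (disch := assumption)
  continuous_invFun := by
    rw [continuous_iff_continuousAt]
    intro y
    rcases eq_or_ne y 0 with rfl | hy
    · refine tendsto_iff_norm_sub_tendsto_zero.2 ?_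
      obtain ⟨c, hc, hb⟩ := h.exists_lower
      have h0 : Tendsto (fun y : ℂ => c⁻¹ * ‖y‖) (𝓝 0) (𝓝 0) := by
        have : Continuous (fun y : ℂ => c⁻¹ * ‖y‖) := by fun_prop
        simpa using this.tendsto 0
      refine squeeze_zero (fun _ => norm_nonneg _) (fun y => ?_) h0
      rcases eq_or_ne y 0 with rfl | hy
      · simp
      have hn : 0 < ‖y‖ := norm_pos_iff.2 hy
      have hp := h.pos y hy
      simp only [mul_zero, sub_zero, norm_mul, norm_real]
      rw [Real.norm_of_nonneg (by positivity), div_mul_eq_mul_div, div_le_iff₀ hp]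
      calc ‖y‖ * ‖y‖ = c⁻¹ * ‖y‖ * (c * ‖y‖) := by field_simp
        _ ≤ _ := by gcongr; exact hb y
    · have := h.cont
      have hn : ρ y ≠ 0 := (h.pos y hy).ne'
      fun_prop (disch := assumption)

lemma norm_radial (y : ℂ) : ‖h.radial y‖ = ρ y := by
  change ‖((ρ y / ‖y‖ : ℝ) : ℂ) * y‖ = _
  rcases eq_or_ne y 0 with rfl | hy
  · simp [h.zero]
  have hn : 0 < ‖y‖ := norm_pos_iff.2 hy
  have hp := h.pos y hy
  rw [norm_mul, norm_real, Real.norm_of_nonneg (by positivity)]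
  field_simp

/-- The unit ball of a gauge is homeomorphic to the unit disk. -/
lemma nonempty_homeo (k : ℂ) :
    Nonempty ({z | ρ (z - k) ≤ 1} ≃ₜ Metric.closedBall (0 : ℂ) 1) := by
  refine ⟨((Homeomorph.subRight k).trans h.radial).subtype fun z => ?_⟩
  simp [norm_radial]

end IsGauge

/-- The centre of the prototile. -/
def ctr : ℂ := ⟨19 / 10, r3 * (-3 / 20)⟩

lemma yc_ctr : yc ctr = -3 / 20 := by
  have := r3_pos
  simp only [yc, ctr]; field_simp

lemma ln_ctr_add (β : ℝ) (i : Fin 14) (y : ℂ) :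
    ln β i (y + ctr) = ln β i ctr + sd (dir i) y := by
  simp only [ln, sd_sub, sd_add]; ring

lemma ln_ctr_pos {β : ℝ} (hβ : β ∈ Set.Ioo (3 / 5 : ℝ) (2 / 3)) (i : Fin 14) :
    0 < ln β i ctr := by
  obtain ⟨h1, h2⟩ := hβ
  fin_cases i <;> simp only [Fin.zero_eta, Fin.mk_one, Fin.reduceFinMk, ln0, ln1, ln2, ln3, ln4, ln5, ln6, ln7, ln8, ln9, ln10, ln11,
    ln12, ln13, yc_ctr, show ctr.re = 19 / 10 from rfl] <;> linarith

/-- The gauge of the `i`-th half plane. -/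
def gl (β : ℝ) (i : Fin 14) (y : ℂ) : ℝ := -sd (dir i) y / ln β i ctr

lemma gl_smul (β : ℝ) (i : Fin 14) (t : ℝ) (y : ℂ) : gl β i (t * y) = t * gl β i y := by
  rw [gl, gl, sd_smul]; ring

lemma continuous_gl (β : ℝ) (i : Fin 14) : Continuous (gl β i) :=
  ((continuous_sd _).neg).div_const _

/-- The gauge of the prototile. -/
def gauge (β : ℝ) (y : ℂ) : ℝ :=
  gl β 1 y ⊔ (gl β 2 y ⊔ ((gl β 4 y ⊓ (gl β 5 y ⊔ gl β 6 y)) ⊔ (gl β 7 y ⊔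
    ((gl β 8 y ⊓ (gl β 9 y ⊔ gl β 10 y)) ⊔
      (gl β 0 y ⊓ (gl β 13 y ⊔ (gl β 12 y ⊓ gl β 11 y)))))))

lemma gl_le_one {β : ℝ} (hβ : β ∈ Set.Ioo (3 / 5 : ℝ) (2 / 3)) (i : Fin 14) (z : ℂ) :
    gl β i (z - ctr) ≤ 1 ↔ 0 ≤ ln β i z := by
  have h := ln_ctr_add β i (z - ctr)
  rw [sub_add_cancel] at h
  rw [gl, div_le_one (ln_ctr_pos hβ i), h]
  constructor <;> intro _ <;> linarith

lemma gl_lt_one {β : ℝ} (hβ : β ∈ Set.Ioo (3 / 5 : ℝ) (2 / 3)) (i : Fin 14) (z : ℂ) :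
    gl β i (z - ctr) < 1 ↔ 0 < ln β i z := by
  have h := ln_ctr_add β i (z - ctr)
  rw [sub_add_cancel] at h
  rw [gl, div_lt_one (ln_ctr_pos hβ i), h]
  constructor <;> intro _ <;> linarith

lemma gauge_le_one {β : ℝ} (hβ : β ∈ Set.Ioo (3 / 5 : ℝ) (2 / 3)) (z : ℂ) :
    gauge β (z - ctr) ≤ 1 ↔ z ∈ tile β := by
  simp only [gauge, sup_le_iff, inf_le_iff, gl_le_one hβ, tile, Set.mem_ofPred_eq]

lemma gauge_lt_one {β : ℝ} (hβ : β ∈ Set.Ioo (3 / 5 : ℝ) (2 / 3)) (z : ℂ) :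
    gauge β (z - ctr) < 1 ↔ z ∈ tileO β := by
  simp only [gauge, sup_lt_iff, inf_lt_iff, gl_lt_one hβ, mem_tileO]

lemma isGauge_gauge {β : ℝ} (hβ : β ∈ Set.Ioo (3 / 5 : ℝ) (2 / 3)) : IsGauge (gauge β) where
  cont := by
    have := continuous_gl β
    unfold gauge
    fun_prop
  smul t ht y := by
    simp only [gauge, gl_smul, mul_max_of_nonneg _ _ ht, mul_min_of_nonneg _ _ ht]
  pos y hy := by
    by_contra! h
    have e : ∀ i, gl β i y ≤ 0 ↔ 0 ≤ sd (dir i) y := fun i => by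
      rw [gl, div_nonpos_iff]
      have := ln_ctr_pos hβ i
      constructor
      · rintro (h | h) <;> linarith
      · intro h; right; constructor <;> linarith
    simp only [gauge, sup_le_iff, inf_le_iff, e] at h
    simp [sd, dir, cX, cY] at h
    obtain ⟨h1, h2, h3, h4, h5, h6⟩ := h
    apply hy
    have hx : y.re = 0 ∧ yc y = 0 := by
      rcases h3 with h3 | ⟨h3, h3'⟩ <;> rcases h5 with h5 | ⟨h5, h5'⟩ <;>
        rcases h6 with h6 | ⟨h6, h6' | h6'⟩ <;> constructor <;> linarith
    apply Complex.ext hx.1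
    rw [im_eq_yc, hx.2]; simp

lemma tile_eq {β : ℝ} (hβ : β ∈ Set.Ioo (3 / 5 : ℝ) (2 / 3)) :
    tile β = {z | gauge β (z - ctr) ≤ 1} := Set.ext fun z => (gauge_le_one hβ z).symm

lemma isCompact_tile {β : ℝ} (hβ : β ∈ Set.Ioo (3 / 5 : ℝ) (2 / 3)) : IsCompact (tile β) := by
  rw [tile_eq hβ]; exact (isGauge_gauge hβ).isCompact_le _ _

lemma nonempty_homeo_tile {β : ℝ} (hβ : β ∈ Set.Ioo (3 / 5 : ℝ) (2 / 3)) :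
    Nonempty (tile β ≃ₜ Metric.closedBall (0 : ℂ) 1) := by
  rw [tile_eq hβ]; exact (isGauge_gauge hβ).nonempty_homeo _

lemma tile_eq_closure_tileO {β : ℝ} (hβ : β ∈ Set.Ioo (3 / 5 : ℝ) (2 / 3)) :
    tile β = closure (tileO β) := by
  refine subset_antisymm (fun z hz => ?_)
    (closure_minimal tileO_subset_tile (isClosed_tile β))
  have hg := isGauge_gauge hβ
  refine mem_closure_of_tendsto (b := 𝓝[<] (1 : ℝ)) (f := fun t : ℝ => t * (z - ctr) + ctr) ?_ ?_
  · have : Continuous fun t : ℝ => (t * (z - ctr) + ctr : ℂ) := by fun_prop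
    have h1 := (this.tendsto 1).mono_left (nhdsWithin_le_nhds (s := Set.Iio 1))
    simpa using h1
  · have : ∀ᶠ t in 𝓝[<] (1 : ℝ), t ∈ Set.Ioo (0 : ℝ) 1 := Ioo_mem_nhdsLT one_pos
    filter_upwards [this] with t ht
    rw [← gauge_lt_one hβ, add_sub_cancel_right, hg.smul t ht.1.le]
    have h1 := (gauge_le_one hβ z).2 hz
    nlinarith [ht.1, ht.2]

lemma tile_eq_closure {β : ℝ} (hβ : β ∈ Set.Ioo (3 / 5 : ℝ) (2 / 3)) :
    tile β = closure (interior (tile β)) := by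
  refine subset_antisymm ?_ (closure_minimal interior_subset (isClosed_tile β))
  conv_lhs => rw [tile_eq_closure_tileO hβ]
  exact closure_mono (interior_maximal tileO_subset_tile isOpen_tileO)

lemma ctr_mem_tileO {β : ℝ} (hβ : β ∈ Set.Ioo (3 / 5 : ℝ) (2 / 3)) : ctr ∈ tileO β := by
  rw [← gauge_lt_one hβ]; simp [(isGauge_gauge hβ).zero]

lemma Adm.one_lt {β : ℝ} (hβ : Adm β) : 1 < r3 * β := by
  have h := r3_sq
  have := hβ.1.1
  nlinarith [r3_pos, sq_nonneg (r3 - 5/3)]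

lemma Adm.lt_two {β : ℝ} (hβ : Adm β) : r3 * β < 2 := by
  have h := r3_sq
  have := hβ.1.2
  nlinarith [r3_pos, sq_nonneg (r3 - 5/3)]

lemma exists_eq_of_sd_eq_zero {d : Fin 12} {w : ℂ} (h : sd d w = 0) : ∃ r : ℝ, w = r * Z d := by
  have hp := r3_sq
  refine ⟨(w / Z d).re, ?_⟩
  suffices (w / Z d).im = 0 by
    have e : w / Z d = ((w / Z d).re : ℂ) := Complex.ext rfl (by simpa using this)
    rw [← e, div_mul_cancel₀ _ (Z_ne_zero d)]
  have hc : (starRingEnd ℂ) (Z d) = (Z d)⁻¹ := by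
    rw [eq_comm, inv_eq_iff_eq_inv, eq_comm, inv_eq_iff_eq_inv]
    rw [Complex.inv_def, normSq_eq_norm_sq, norm_Z]; simp
  rw [div_eq_mul_inv, ← hc]
  rw [sd] at h
  have hy := im_eq_yc w
  rw [mul_im, conj_re, conj_im, hy, Z_val]
  fin_cases d <;> simp [cX, cY] at h ⊢ <;>
    first
      | linarith
      | linear_combination (r3 / 2) * h
      | linear_combination (-r3 / 2) * h
      | linear_combination (1 / 2 : ℝ) * h + (yc w / 2) * hp
      | linear_combination (-1 / 2 : ℝ) * h + (yc w / 2) * hp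
      | linear_combination (1 / 2 : ℝ) * h - (yc w / 2) * hp

section Base

variable {β : ℝ} (hβ : Adm β)

include hβ

lemma Edge₀.cnt_left {q p : ℂ} (h : Edge₀ β q p) :
    cnt (tile β) q = 4 ∨ cnt (tile β) q = 8 := by
  obtain ⟨i, rfl, -⟩ := h
  rw [cnt_vt hβ]; revert i; decide

lemma Edge₀.cnt_right {q p : ℂ} (h : Edge₀ β q p) :
    cnt (tile β) p = 3 ∨ cnt (tile β) p = 6 ∨ cnt (tile β) p = 9 := by
  obtain ⟨i, -, rfl⟩ := h
  rw [cnt_vt hβ]; revert i; decide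

omit hβ in
lemma Edge₀.exists_segpt {q p : ℂ} (h : Edge₀ β q p) {t : ℝ} (ht : t ∈ Set.Ioo (0 : ℝ) 1) :
    ∃ i, ∃ s ∈ Set.Ioo (0 : ℝ) 1, q + t * (p - q) = segpt β i (i + 1) s ∧
      (p - q = vt β (i + 1) - vt β i ∨ p - q = -(vt β (i + 1) - vt β i)) := by
  obtain ⟨i, ⟨rfl, rfl⟩ | ⟨rfl, rfl⟩⟩ := h.exists_succ
  · exact ⟨i, t, ht, by rw [segpt_eq], .inl rfl⟩
  · exact ⟨i, 1 - t, ⟨by linarith [ht.2], by linarith [ht.1]⟩,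
      by rw [segpt_eq]; push_cast; ring, .inr (by ring)⟩

lemma Edge₀.cnt_open {q p : ℂ} (h : Edge₀ β q p) {t : ℝ} (ht : t ∈ Set.Ioo (0 : ℝ) 1) :
    cnt (tile β) (q + t * (p - q)) = 6 := by
  obtain ⟨i, s, hs, e, -⟩ := h.exists_segpt ht
  rw [e]; exact (hasAngle_edge hβ.1 i hs).cnt_eq

lemma norm_len (d : Fin 12) : ‖(len β d : ℂ) * Z d‖ = len β d := by
  rw [norm_mul, norm_Z, mul_one, norm_real, Real.norm_of_nonneg (len_pos hβ d).le]

lemma Edge₀.norm {q p : ℂ} (h : Edge₀ β q p) : ‖q - p‖ = 1 ∨ ‖q - p‖ = r3 * β := by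
  obtain ⟨i, rfl, rfl⟩ := h
  rw [hx_sub_sq, norm_len hβ, len]
  split_ifs <;> simp

lemma exists_edge₀_of_frequently {x w : ℂ} (hx : cnt (tile β) x ≠ 6) (hw : w ≠ 0)
    (hf : ∃ᶠ t : ℝ in 𝓝[>] 0, cnt (tile β) (x + t * w) ≠ 0 ∧ cnt (tile β) (x + t * w) ≠ 12) :
    ∃ r : ℝ, 0 < r ∧ (Edge₀ β x (x + r * w) ∨ Edge₀ β (x + r * w) x) := by
  have h1 : ∃ᶠ t : ℝ in 𝓝[>] 0, ∃ i, x + t * w ∈ seg β i :=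
    hf.mono fun t ht => exists_seg_of_cnt hβ ht.1 ht.2
  have h2 : ∃ i, ∃ᶠ t : ℝ in 𝓝[>] 0, x + t * w ∈ seg β i := by
    by_contra! h
    exact h1 ((eventually_all.2 h).mono fun t ht => by simpa using ht)
  obtain ⟨i, hi⟩ := h2
  have hxi : x ∈ seg β i := by
    by_contra hn
    have hc : Tendsto (fun t : ℝ => x + t * w) (𝓝[>] 0) (𝓝 x) := by
      have : Continuous fun t : ℝ => x + t * w := by fun_prop
      simpa using (this.tendsto 0).mono_left (nhdsWithin_le_nhds (s := Set.Ioi 0))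
    exact hi (hc.eventually ((isClosed_seg β i).isOpen_compl.mem_nhds hn))
  obtain ⟨t, ht, ht0⟩ := (hi.and_eventually self_mem_nhdsWithin).exists
  obtain ⟨s, hs, hxs⟩ := hxi
  obtain ⟨s', hs', hxs'⟩ := ht
  have ht0 : 0 < t := ht0
  have key : ∃ r : ℝ, 0 < r ∧ ((x = vt β i ∧ x + r * w = vt β (i + 1)) ∨
      (x = vt β (i + 1) ∧ x + r * w = vt β i)) := by
    rcases hs.1.eq_or_lt with h0 | h0
    · have e : x = vt β i := by rw [← hxs, segpt_eq, ← h0]; simp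
      rw [segpt_eq, ← e] at hxs'
      have e2 : (s' : ℂ) * (vt β (i + 1) - x) = t * w := by linear_combination hxs'
      have hs0 : s' ≠ 0 := by
        rintro rfl
        simp [hw, ht0.ne'] at e2
      have hs0' : 0 < s' := lt_of_le_of_ne hs'.1 (Ne.symm hs0)
      refine ⟨t / s', div_pos ht0 hs0', .inl ⟨e, ?_⟩⟩
      have : (s' : ℂ) ≠ 0 := by exact_mod_cast hs0
      push_cast; field_simp; linear_combination -e2
    rcases hs.2.eq_or_lt with h1 | h1
    · have e : x = vt β (i + 1) := by rw [← hxs, segpt_eq, h1]; simp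
      rw [segpt_eq, ← e] at hxs'
      have e2 : ((1 - s' : ℝ) : ℂ) * (vt β i - x) = t * w := by push_cast; linear_combination hxs'
      have hs0 : 1 - s' ≠ 0 := by
        intro h0
        simp [h0, hw, ht0.ne'] at e2
      have hs0' : 0 < 1 - s' := lt_of_le_of_ne (by linarith [hs'.2]) (Ne.symm hs0)
      refine ⟨t / (1 - s'), div_pos ht0 hs0', .inr ⟨e, ?_⟩⟩
      have : ((1 - s' : ℝ) : ℂ) ≠ 0 := by exact_mod_cast hs0
      rw [ofReal_div]; field_simp; linear_combination -e2
    · exact absurd (by rw [← hxs]; exact (hasAngle_edge hβ.1 i ⟨h0, h1⟩).cnt_eq) hx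
  obtain ⟨r, hr, ⟨e1, e2⟩ | ⟨e1, e2⟩⟩ := key
  · refine ⟨r, hr, ?_⟩
    rw [e2, e1]; exact edge₀_succ β i
  · refine ⟨r, hr, ?_⟩
    rw [e2, e1]; exact (edge₀_succ β i).symm

lemma Edge₀.parallel {q p w : ℂ} (h : Edge₀ β q p) {s : ℝ} (hs : s ∈ Set.Ioo (0 : ℝ) 1)
    (hf : ∃ᶠ t : ℝ in 𝓝[>] 0, cnt (tile β) (q + s * (p - q) + t * w) ≠ 0 ∧
      cnt (tile β) (q + s * (p - q) + t * w) ≠ 12) : ∃ r : ℝ, w = r * (p - q) := by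
  obtain ⟨i, s', hs', e, he⟩ := h.exists_segpt hs
  set x := q + s * (p - q)
  have hg : ∀ᶠ z in 𝓝 x, z ∈ tile β ↔ 0 ≤ ln β (rep i) z := e ▸ germ_edge hβ.1 i hs'
  have h0 : ln β (rep i) x = 0 := by
    have h0 : ∀ i, ln β (rep i) (zpt β (fv i)) = 0 ∧ ln β (rep i) (zpt β (fv (i + 1))) = 0 := by
      simp only [ln_vert]
      intro i
      have : ∀ i, s0 (dir (rep i)) (fv i - fv (rep i)) = 0 ∧ s1 (dir (rep i)) (fv i - fv (rep i)) = 0 ∧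
        s0 (dir (rep i)) (fv (i + 1) - fv (rep i)) = 0 ∧
        s1 (dir (rep i)) (fv (i + 1) - fv (rep i)) = 0 := by decide
      obtain ⟨a1, a2, a3, a4⟩ := this i
      simp [a1, a2, a3, a4]
    rw [e, ln_segpt, (h0 i).1, (h0 i).2]; simp
  have hd : dir (rep i) = dir i := by clear * -; revert i; decide
  have hln : ∀ y, ln β (rep i) (x + y) = sd (dir i) y := fun y => by
    have : ln β (rep i) (x + y) = ln β (rep i) x + sd (dir (rep i)) y := by
      simp only [ln, sd_sub, sd_add]; ring
    rw [this, h0, zero_add, hd]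
  have hc : Tendsto (fun t : ℝ => x + t * w) (𝓝[>] 0) (𝓝 x) := by
    have : Continuous fun t : ℝ => x + t * w := by fun_prop
    simpa using (this.tendsto 0).mono_left (nhdsWithin_le_nhds (s := Set.Ioi 0))
  obtain ⟨t, ⟨hf1, hf2⟩, hz, ht0⟩ := (hf.and_eventually
    ((hc.eventually hg.eventually_nhds).and self_mem_nhdsWithin)).exists
  have ht0 : 0 < t := ht0
  have hz1 := hz.self_of_nhds
  rw [hln, sd_smul] at hz1
  have hsd : sd (dir i) w = 0 := by
    rcases lt_trichotomy (sd (dir i) w) 0 with h | h | h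
    · exact absurd ((cnt_eq_zero hβ).2 fun hm => absurd (hz1.1 hm) (by nlinarith)) hf1
    · exact h
    · refine absurd (HasAngle.of_mem_interior (mem_interior_iff_mem_nhds.2 ?_)).cnt_eq hf2
      have : ∀ᶠ z in 𝓝 (x + t * w), 0 < ln β (rep i) z :=
        (continuous_ln _ _).continuousAt.eventually (lt_mem_nhds (by
          rw [hln, sd_smul]; positivity))
      filter_upwards [this, hz] with z h1 h2
      exact h2.2 h1.le
  obtain ⟨r, hr⟩ := exists_eq_of_sd_eq_zero hsd
  have hl := len_pos hβ (dir i)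
  have hl' : (len β (dir i) : ℂ) ≠ 0 := by exact_mod_cast hl.ne'
  rw [vt_succ_sub] at he
  rcases he with he | he
  · exact ⟨r / len β (dir i), by rw [he, hr]; push_cast; field_simp⟩
  · exact ⟨-r / len β (dir i), by rw [he, hr]; push_cast; field_simp⟩

lemma Edge₀.opposite {q p : ℂ} (h : Edge₀ β q p) (hp : cnt (tile β) p = 6) :
    Edge₀ β (p + (p - q)) p := by
  obtain ⟨i, rfl, rfl⟩ := h
  rw [cnt_vt hβ] at hp
  have : ∀ i, ang (sq i) = 6 → ∃ j, sq j = sq i ∧ fv (hx j) = fv (sq i) + (fv (sq i) - fv (hx i)) := by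
    decide
  obtain ⟨j, h1, h2⟩ := this i hp
  refine ⟨j, ?_, by rw [h1]⟩
  rw [vt, vt, vt, h2, zpt_add, zpt_sub]

lemma Edge₀.norm_ne {q q' p : ℂ} (h : Edge₀ β q p) (h' : Edge₀ β q' p)
    (hp : cnt (tile β) p ≠ 6) (hq : q ≠ q') : ‖q - p‖ ≠ ‖q' - p‖ := by
  obtain ⟨i, rfl, rfl⟩ := h
  obtain ⟨j, rfl, e⟩ := h'
  have e := vt_injective hβ e
  rw [cnt_vt hβ] at hp
  have hij : hx i ≠ hx j := fun h => hq (by rw [h])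
  have : ∀ i j, sq i = sq j → hx i ≠ hx j → ang (sq i) ≠ 6 →
      (udir i).val % 2 ≠ (udir j).val % 2 := by decide +kernel
  have := this i j e hij hp
  rw [hx_sub_sq, e, hx_sub_sq, norm_len hβ, norm_len hβ, len, len]
  have := hβ.one_lt
  split_ifs <;> first | omega | linarith

lemma Edge₀.perp {q p : ℂ} (h : Edge₀ β q p) (hp : cnt (tile β) p = 3) :
    ∃ r : ℝ, r ≠ 0 ∧ Edge₀ β (p + r * (I * (q - p))) p := by
  obtain ⟨i, rfl, rfl⟩ := h
  rw [cnt_vt hβ] at hp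
  have : ∀ i, ang (sq i) = 3 → ∃ j, sq j = sq i ∧ (udir j = udir i + 3 ∨ udir i = udir j + 3) := by
    decide
  obtain ⟨j, h1, h2⟩ := this i hp
  have e1 := hx_sub_sq β i
  have e2 := hx_sub_sq β j
  have l1 := (len_pos hβ (udir i)).ne'
  have l2 := (len_pos hβ (udir j)).ne'
  have l1' : (len β (udir i) : ℂ) ≠ 0 := by exact_mod_cast l1
  rw [h1] at e2
  have hI := I_mul_I
  rcases h2 with h2 | h2
  · refine ⟨len β (udir j) / len β (udir i), by positivity, j, ?_, by rw [h1]⟩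
    rw [h2, Z_add_three, ← h2] at e2
    rw [e1]
    push_cast; field_simp
    linear_combination -e2
  · refine ⟨-(len β (udir j) / len β (udir i)), neg_ne_zero.2 (by positivity), j, ?_, by rw [h1]⟩
    rw [e1]
    rw [h2, Z_add_three, ← h2]
    push_cast; field_simp
    linear_combination -e2 - len β (udir j) * Z (udir j) * hI

end Base

/-- The linear part of an isometry of the plane. -/
def lp (g : ℂ ≃ᵢ ℂ) : ℂ ≃ₗᵢ[ℝ] ℂ := g.toRealLinearIsometryEquiv

lemma iso_add (g : ℂ ≃ᵢ ℂ) (x w : ℂ) : g (x + w) = g x + lp g w := by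
  have h : ∀ z, g z = lp g z + g 0 := fun z => by simp [lp]
  rw [h (x + w), h x, map_add]; ring

lemma iso_symm_add (g : ℂ ≃ᵢ ℂ) (x w : ℂ) : g.symm (x + w) = g.symm x + (lp g).symm w := by
  apply g.injective
  rw [iso_add g (g.symm x), g.apply_symm_apply, g.apply_symm_apply, LinearIsometryEquiv.apply_symm_apply]

lemma lp_mul (L : ℂ ≃ₗᵢ[ℝ] ℂ) (t : ℝ) (w : ℂ) : L (t * w) = t * L w := by
  rw [← real_smul, map_smul, real_smul]

lemma lp_cases (L : ℂ ≃ₗᵢ[ℝ] ℂ) : ∃ a : ℂ, ‖a‖ = 1 ∧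
    ((∀ w, L w = a * w) ∨ ∀ w, L w = a * (starRingEnd ℂ) w) := by
  obtain ⟨a, rfl | rfl⟩ := linear_isometry_complex L
  · exact ⟨a, Circle.norm_coe a, .inl fun w => rfl⟩
  · exact ⟨a, Circle.norm_coe a, .inr fun w => rfl⟩

lemma tendsto_gen (L : ℂ ≃ₗᵢ[ℝ] ℂ) : Tendsto L gen gen := by
  refine Tendsto.inf ?_ ?_
  · simpa using L.continuous.tendsto 0
  · exact tendsto_residual_of_isOpenMap L.continuous L.toHomeomorph.isOpenMap

open scoped Classical in
lemma star_image (P : Set ℂ) (g : ℂ ≃ᵢ ℂ) (x y : ℂ) :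
    star (g '' P) x y = star P (g.symm x) ((lp g).symm y) := by
  have hm : ∀ j, x + Z j * y ∈ g '' P ↔ g.symm x + (lp g).symm (Z j * y) ∈ P := fun j => by
    rw [← iso_symm_add, ← Set.mem_preimage]
    have := Equiv.image_eq_preimage_symm g.toEquiv P
    exact Set.ext_iff.1 this _
  unfold star
  obtain ⟨a, -, h | h⟩ := lp_cases (lp g).symm
  · congr 1; ext j
    rw [Finset.mem_filter, Finset.mem_filter, hm, h, h, mul_left_comm]
  · simp only [h, map_mul, conj_Z] at hm ⊢
    refine Finset.card_bij (fun j _ => -j) (fun j hj => ?_) (fun j _ k _ h => neg_injective h)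
      fun j hj => ⟨-j, ?_, neg_neg j⟩
    · rw [Finset.mem_filter] at hj ⊢
      refine ⟨Finset.mem_univ _, ?_⟩
      rw [mul_left_comm]; exact (hm j).1 hj.2
    · rw [Finset.mem_filter] at hj ⊢
      refine ⟨Finset.mem_univ _, ?_⟩
      rw [hm, neg_neg, mul_left_comm]; exact hj.2

/-- The angle of a placed prototile at a point. -/
def ct (β : ℝ) (g : ℂ ≃ᵢ ℂ) (x : ℂ) : ℕ := cnt (tile β) (g.symm x)

lemma hasAngle_image {β : ℝ} (hβ : Adm β) (g : ℂ ≃ᵢ ℂ) (x : ℂ) :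
    HasAngle (g '' tile β) x (ct β g x) := by
  have := (tendsto_gen (lp g).symm).eventually (hasAngle_cnt hβ (g.symm x))
  filter_upwards [this] with y hy
  rw [star_image, hy, ct]

lemma mem_image_iff (g : ℂ ≃ᵢ ℂ) (P : Set ℂ) (x : ℂ) : x ∈ g '' P ↔ g.symm x ∈ P :=
  Set.ext_iff.1 (Equiv.image_eq_preimage_symm g.toEquiv P) x

lemma ct_ne_zero {β : ℝ} (hβ : Adm β) {g : ℂ ≃ᵢ ℂ} {x : ℂ} : ct β g x ≠ 0 ↔ x ∈ g '' tile β := by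
  rw [ct, ne_eq, cnt_eq_zero hβ, not_not, mem_image_iff]

lemma isClosed_image (β : ℝ) (g : ℂ ≃ᵢ ℂ) : IsClosed (g '' tile β) :=
  g.toHomeomorph.isClosed_image.2 (isClosed_tile β)

/-- `S` is a tiling of the complex plane by the prototile. -/
structure Til (β : ℝ) (S : Set (ℂ ≃ᵢ ℂ)) : Prop where
  cover : ∀ x, ∃ g ∈ S, x ∈ g '' tile β
  disj : S.Pairwise fun g h => Disjoint (interior (g '' tile β)) (interior (h '' tile β))

lemma exists_radius {β : ℝ} (hβ : Adm β) : ∃ D > 0, ∀ g : ℂ ≃ᵢ ℂ, ∀ x ∈ g '' tile β,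
    dist x (g ctr) ≤ D := by
  obtain ⟨D, hD⟩ := (isCompact_tile hβ.1).isBounded.subset_closedBall ctr
  refine ⟨max D 1, by simp, ?_⟩
  rintro g x ⟨y, hy, rfl⟩
  rw [g.isometry.dist_eq]
  exact (Metric.mem_closedBall.1 (hD hy)).trans (le_max_left _ _)

lemma image_ctr_mem {β : ℝ} (hβ : Adm β) (g : ℂ ≃ᵢ ℂ) : g ctr ∈ interior (g '' tile β) := by
  have h : ctr ∈ interior (tile β) :=
    interior_maximal tileO_subset_tile isOpen_tileO (ctr_mem_tileO hβ.1)
  have e : g '' interior (tile β) = interior (g '' tile β) :=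
    g.toHomeomorph.image_interior _
  exact e ▸ Set.mem_image_of_mem _ h

lemma exists_sep {β : ℝ} (hβ : Adm β) : ∃ ε > 0, ∀ S, Til β S → ∀ g ∈ S, ∀ h ∈ S, g ≠ h →
    ε ≤ dist (g ctr) (h ctr) := by
  obtain ⟨ε, hε, hb⟩ := Metric.isOpen_iff.1 isOpen_tileO ctr (ctr_mem_tileO hβ.1)
  refine ⟨ε, hε, fun S hS g hg h hh hgh => ?_⟩
  by_contra! hlt
  have h1 : h ctr ∈ interior (g '' tile β) := by
    have : g '' tileO β ⊆ interior (g '' tile β) :=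
      interior_maximal (Set.image_mono tileO_subset_tile)
        (g.toHomeomorph.isOpenMap _ isOpen_tileO)
    refine this ⟨g.symm (h ctr), hb ?_, by simp⟩
    rw [Metric.mem_ball, ← g.isometry.dist_eq]
    simpa [dist_comm] using hlt
  exact Set.disjoint_left.1 (hS.disj hg hh hgh) h1 (image_ctr_mem hβ h)

lemma exists_card_le {β : ℝ} (hβ : Adm β) (r : ℝ) : ∃ N : ℕ, ∀ S, Til β S → ∀ x : ℂ,
    {g ∈ S | dist (g ctr) x ≤ r}.Finite ∧ {g ∈ S | dist (g ctr) x ≤ r}.ncard ≤ N := by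
  obtain ⟨ε, hε, hs⟩ := exists_sep hβ
  set M : ℤ := ⌈2 * r / ε⌉
  set B : Finset (ℤ × ℤ) := Finset.Icc (-M - 1) M ×ˢ Finset.Icc (-M - 1) M
  refine ⟨B.card, fun S hS x => ?_⟩
  set f : (ℂ ≃ᵢ ℂ) → ℤ × ℤ := fun g =>
    (⌊2 * (g ctr - x).re / ε⌋, ⌊2 * (g ctr - x).im / ε⌋)
  have hfl : ∀ u : ℝ, |u| ≤ r → ⌊2 * u / ε⌋ ∈ Finset.Icc (-M - 1) M := fun u hu => by
    have hM : 2 * r / ε ≤ M := Int.le_ceil _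
    rw [abs_le] at hu
    rw [Finset.mem_Icc]
    constructor
    · rw [Int.le_floor]
      push_cast
      have : -(2 * r / ε) ≤ 2 * u / ε := by
        rw [← neg_div]; gcongr; linarith
      linarith
    · have : ⌊2 * u / ε⌋ ≤ ⌊(M : ℝ)⌋ := by
        apply Int.floor_mono
        refine le_trans ?_ hM
        gcongr; linarith
      simpa using this
  have hmap : Set.MapsTo f {g ∈ S | dist (g ctr) x ≤ r} (B : Set (ℤ × ℤ)) := by
    rintro g ⟨-, hg⟩
    rw [dist_eq_norm] at hg
    simp only [f, B, Finset.coe_product, Set.mem_prod, Finset.mem_coe]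
    exact ⟨hfl _ ((abs_re_le_norm _).trans hg), hfl _ ((abs_im_le_norm _).trans hg)⟩
  have hinj : Set.InjOn f {g ∈ S | dist (g ctr) x ≤ r} := by
    rintro g ⟨hg, -⟩ h ⟨hh, -⟩ e
    by_contra hne
    have h1 := hs S hS g hg h hh hne
    simp only [f, Prod.mk.injEq] at e
    have e1 := Int.abs_sub_lt_one_of_floor_eq_floor e.1
    have e2 := Int.abs_sub_lt_one_of_floor_eq_floor e.2
    rw [← sub_div, abs_div, abs_of_pos hε, div_lt_one hε, ← mul_sub, abs_mul, ← sub_re,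
      abs_of_pos two_pos] at e1
    rw [← sub_div, abs_div, abs_of_pos hε, div_lt_one hε, ← mul_sub, abs_mul, ← sub_im,
      abs_of_pos two_pos] at e2
    have e3 := norm_le_abs_re_add_abs_im (g ctr - h ctr)
    rw [dist_eq_norm] at h1
    have : g ctr - x - (h ctr - x) = g ctr - h ctr := by ring
    rw [this] at e1 e2
    linarith
  have hfin : {g ∈ S | dist (g ctr) x ≤ r}.Finite :=
    Set.Finite.of_injOn hmap hinj B.finite_toSet
  refine ⟨hfin, ?_⟩
  have := Set.ncard_le_ncard_of_injOn f hmap hinj B.finite_toSet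
  rwa [Set.ncard_coe_finset] at this

section Tiling

variable {β : ℝ} (hβ : Adm β) {S : Set (ℂ ≃ᵢ ℂ)} (hS : Til β S)

include hβ hS

lemma finite_meeting (x : ℂ) : {g ∈ S | (g '' tile β ∩ Metric.ball x 1).Nonempty}.Finite := by
  obtain ⟨D, hD, hb⟩ := exists_radius hβ
  obtain ⟨N, hN⟩ := exists_card_le hβ (D + 1)
  refine (hN S hS x).1.subset ?_
  rintro g ⟨hg, y, hy, hyx⟩
  refine ⟨hg, ?_⟩
  have h1 := hb g y hy
  have h2 := Metric.mem_ball.1 hyx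
  have := dist_triangle_left (g ctr) x y
  linarith

lemma eventually_subset (x : ℂ) : ∀ᶠ y in 𝓝 x, ∀ g ∈ S, y ∈ g '' tile β → x ∈ g '' tile β := by
  have hf := (finite_meeting hβ hS x).subset
    (t := {g ∈ {g ∈ S | (g '' tile β ∩ Metric.ball x 1).Nonempty} | x ∉ g '' tile β}) fun _ h => h.1
  have h1 : ∀ᶠ y in 𝓝 x, ∀ g ∈ {g ∈ {g ∈ S | (g '' tile β ∩ Metric.ball x 1).Nonempty} |
      x ∉ g '' tile β}, y ∉ g '' tile β := by
    rw [eventually_all_finite hf]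
    rintro g ⟨-, hg⟩
    exact (isClosed_image β g).isOpen_compl.mem_nhds hg
  filter_upwards [h1, Metric.ball_mem_nhds x one_pos] with y hy hyb g hg hyg
  by_contra hx
  exact hy g ⟨⟨hg, y, hyg, hyb⟩, hx⟩ hyg

lemma exists_sum (x : ℂ) : ∃ F : Finset (ℂ ≃ᵢ ℂ), (∀ g, g ∈ F ↔ g ∈ S ∧ x ∈ g '' tile β) ∧
    ∑ g ∈ F, ct β g x = 12 := by
  have hf : {g ∈ S | x ∈ g '' tile β}.Finite :=
    (finite_meeting hβ hS x).subset fun g hg => ⟨hg.1, x, hg.2, Metric.mem_ball_self one_pos⟩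
  refine ⟨hf.toFinset, by simp, ?_⟩
  set F := hf.toFinset
  have h1 : ∀ᶠ y in gen, ∀ g ∈ F, star (g '' tile β) x y = ct β g x :=
    (Finset.eventually_all F).2 fun g _ => hasAngle_image hβ g x
  have h2 := eventually_gen_forall (eventually_subset hβ hS x)
  have h3 : ∀ᶠ y in gen, ∀ g ∈ F, ∀ j, x + Z j * y ∉ frontier (g '' tile β) := by
    rw [Finset.eventually_all]
    intro g _
    rw [eventually_all]
    intro j
    have ho : IsOpenMap fun y => x + Z j * y :=
      (Homeomorph.addLeft x).isOpenMap.comp (Homeomorph.mulLeft₀ (Z j) (Z_ne_zero j)).isOpenMap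
    have hc : Continuous fun y => x + Z j * y := by fun_prop
    refine mem_inf_of_right (residual_of_dense_open
      (s := (fun y => x + Z j * y) ⁻¹' (frontier (g '' tile β))ᶜ) ?_ ?_)
    · exact isClosed_frontier.isOpen_compl.preimage hc
    · refine Dense.preimage ?_ ho
      rw [← interior_eq_empty_iff_dense_compl, interior_frontier (isClosed_image β g)]
  obtain ⟨y, h1, h2, h3⟩ := (h1.and (h2.and h3)).exists
  have hinter : ∀ g ∈ F, ∀ j, x + Z j * y ∈ g '' tile β → x + Z j * y ∈ interior (g '' tile β) := by
    intro g hg j hj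
    by_contra hn
    exact h3 g hg j ⟨subset_closure hj, hn⟩
  classical
  rw [← Finset.sum_congr rfl h1]
  simp only [star, Finset.card_filter]
  rw [Finset.sum_comm]
  have : ∀ j : Fin 12, ∑ g ∈ F, (if x + Z j * y ∈ g '' tile β then 1 else 0) = 1 := by
    intro j
    obtain ⟨g, hg, hj⟩ := hS.cover (x + Z j * y)
    have hgF : g ∈ F := hf.mem_toFinset.2 ⟨hg, h2 j g hg hj⟩
    rw [Finset.sum_eq_single_of_mem g hgF, if_pos hj]
    intro h hh hne
    rw [if_neg]
    intro hj'
    have hh' : h ∈ S := (hf.mem_toFinset.1 hh).1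
    exact Set.disjoint_left.1 (hS.disj hh' hg hne) (hinter h hh j hj') (hinter g hgF j hj)
  rw [Finset.sum_congr rfl fun j _ => this j]; simp

end Tiling

/-- The pair `(q, p)` is an edge of a placed prototile. -/
def Edge (β : ℝ) (g : ℂ ≃ᵢ ℂ) (q p : ℂ) : Prop := Edge₀ β (g.symm q) (g.symm p)

lemma symm_sub (g : ℂ ≃ᵢ ℂ) (x y : ℂ) : g.symm x - g.symm y = (lp g).symm (x - y) := by
  have := iso_symm_add g y (x - y)
  rw [add_sub_cancel] at this
  rw [this]; ring

lemma norm_symm_sub (g : ℂ ≃ᵢ ℂ) (x y : ℂ) : ‖g.symm x - g.symm y‖ = ‖x - y‖ := by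
  rw [symm_sub, LinearIsometryEquiv.norm_map]

lemma symm_line (g : ℂ ≃ᵢ ℂ) (x w : ℂ) (t : ℝ) :
    g.symm (x + t * w) = g.symm x + t * (lp g).symm w := by
  rw [iso_symm_add, lp_mul]

section

variable {β : ℝ} (hβ : Adm β) {g : ℂ ≃ᵢ ℂ} {q p : ℂ}

include hβ

lemma Edge.ct_left (h : Edge β g q p) : ct β g q = 4 ∨ ct β g q = 8 := Edge₀.cnt_left hβ h

lemma Edge.ct_right (h : Edge β g q p) : ct β g p = 3 ∨ ct β g p = 6 ∨ ct β g p = 9 :=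
  Edge₀.cnt_right hβ h

lemma Edge.ct_open (h : Edge β g q p) {t : ℝ} (ht : t ∈ Set.Ioo (0 : ℝ) 1) :
    ct β g (q + t * (p - q)) = 6 := by
  rw [ct, symm_line, ← symm_sub]; exact Edge₀.cnt_open hβ h ht

lemma Edge.norm (h : Edge β g q p) : ‖q - p‖ = 1 ∨ ‖q - p‖ = r3 * β := by
  rw [← norm_symm_sub g]; exact Edge₀.norm hβ h

lemma exists_edge_of_frequently {x w : ℂ} (hx : ct β g x ≠ 6) (hw : w ≠ 0)
    (hf : ∃ᶠ t : ℝ in 𝓝[>] 0, ct β g (x + t * w) ≠ 0 ∧ ct β g (x + t * w) ≠ 12) :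
    ∃ r : ℝ, 0 < r ∧ (Edge β g x (x + r * w) ∨ Edge β g (x + r * w) x) := by
  simp only [ct, symm_line] at hf
  have hw' : (lp g).symm w ≠ 0 := by simpa using hw
  obtain ⟨r, hr, h⟩ := exists_edge₀_of_frequently hβ hx hw' hf
  refine ⟨r, hr, ?_⟩
  simpa only [Edge, symm_line] using h

lemma Edge.parallel {w : ℂ} (h : Edge β g q p) {s : ℝ} (hs : s ∈ Set.Ioo (0 : ℝ) 1)
    (hf : ∃ᶠ t : ℝ in 𝓝[>] 0, ct β g (q + s * (p - q) + t * w) ≠ 0 ∧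
      ct β g (q + s * (p - q) + t * w) ≠ 12) : ∃ r : ℝ, w = r * (p - q) := by
  simp only [ct, symm_line, ← symm_sub g p q] at hf
  obtain ⟨r, hr⟩ := Edge₀.parallel hβ h hs hf
  refine ⟨r, (lp g).symm.injective ?_⟩
  rw [hr, symm_sub, lp_mul]

lemma Edge.opposite (h : Edge β g q p) (hp : ct β g p = 6) : Edge β g (p + (p - q)) p := by
  rw [Edge, iso_symm_add, ← symm_sub]; exact Edge₀.opposite hβ h hp

lemma Edge.norm_ne {q' : ℂ} (h : Edge β g q p) (h' : Edge β g q' p)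
    (hp : ct β g p ≠ 6) (hq : q ≠ q') : ‖q - p‖ ≠ ‖q' - p‖ := by
  rw [← norm_symm_sub g, ← norm_symm_sub g q']
  exact Edge₀.norm_ne hβ h h' hp fun e => hq (g.symm.injective e)

lemma Edge.perp (h : Edge β g q p) (hp : ct β g p = 3) :
    ∃ r : ℝ, r ≠ 0 ∧ Edge β g (p + r * (I * (q - p))) p := by
  obtain ⟨r, hr, h1⟩ := Edge₀.perp hβ h hp
  rw [symm_sub] at h1
  obtain ⟨a, -, ha | ha⟩ := lp_cases (lp g).symm
  · refine ⟨r, hr, ?_⟩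
    rw [Edge, symm_line, ha]
    rw [ha] at h1
    convert h1 using 3
    ring
  · refine ⟨-r, neg_ne_zero.2 hr, ?_⟩
    rw [Edge, symm_line, ha]
    rw [ha] at h1
    have e : ((-r : ℝ) : ℂ) * (a * (starRingEnd ℂ) (I * (q - p))) =
        r * (I * (a * (starRingEnd ℂ) (q - p))) := by
      rw [map_mul, conj_I]; push_cast; ring
    rwa [e]

lemma Edge.ne (h : Edge β g q p) : p - q ≠ 0 := by
  intro h0
  have h1 : ‖q - p‖ = 0 := by rw [norm_sub_rev, h0, norm_zero]
  have := hβ.one_lt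
  rcases h.norm hβ with h | h <;> linarith

lemma Edge.eventually_left (h : Edge β g q p) :
    ∀ᶠ t : ℝ in 𝓝[>] 0, ct β g (q + t * (p - q)) = 6 := by
  filter_upwards [Ioo_mem_nhdsGT one_pos] with t ht
  exact h.ct_open hβ ht

lemma Edge.eventually_right (h : Edge β g q p) :
    ∀ᶠ t : ℝ in 𝓝[>] 0, ct β g (p + t * (q - p)) = 6 := by
  filter_upwards [Ioo_mem_nhdsGT one_pos] with t ht
  have := h.ct_open hβ (t := 1 - t) ⟨by linarith [ht.2], by linarith [ht.1]⟩
  convert this using 2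
  push_cast; ring

lemma Edge.eventually_open (h : Edge β g q p) {s : ℝ} (hs : s ∈ Set.Ioo (0 : ℝ) 1) (r : ℝ) :
    ∀ᶠ t : ℝ in 𝓝[>] 0, ct β g (q + s * (p - q) + t * (r * (p - q))) = 6 := by
  have hc : Tendsto (fun t : ℝ => s + t * r) (𝓝[>] 0) (𝓝 s) := by
    have : Continuous fun t : ℝ => s + t * r := by fun_prop
    simpa using (this.tendsto 0).mono_left (nhdsWithin_le_nhds (s := Set.Ioi 0))
  filter_upwards [hc.eventually (Ioo_mem_nhds hs.1 hs.2)] with t ht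
  have := h.ct_open hβ ht
  convert this using 2
  push_cast; ring

lemma ct_mem (g : ℂ ≃ᵢ ℂ) (x : ℂ) : ct β g x ∈ ({0, 3, 4, 6, 8, 9, 12} : Finset ℕ) :=
  cnt_mem hβ _

lemma ct_ge (g : ℂ ≃ᵢ ℂ) (x : ℂ) (h : ct β g x ≠ 0) : 3 ≤ ct β g x := by
  have := ct_mem hβ g x
  simp only [Finset.mem_insert, Finset.mem_singleton] at this
  omega

lemma sum_pattern (F : Finset (ℂ ≃ᵢ ℂ)) (x : ℂ) : (∑ g ∈ F, ct β g x = 0) ∨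
    (∑ g ∈ F, ct β g x = 3) ∨ (∑ g ∈ F, ct β g x = 4) ∨ 6 ≤ ∑ g ∈ F, ct β g x := by
  classical
  induction F using Finset.induction_on with
  | empty => simp
  | insert g F hg ih =>
    rw [Finset.sum_insert hg]
    have := ct_mem hβ g x
    simp only [Finset.mem_insert, Finset.mem_singleton] at this
    omega

end

lemma real_comb {a b : ℝ} {w : ℂ} (hw : w ≠ 0) (h : (a : ℂ) * w = b * (I * w)) :
    a = 0 ∧ b = 0 := by
  have h1 : (a : ℂ) = b * I := mul_right_cancel₀ hw (by rw [h]; ring)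
  have h2 := congrArg re h1
  have h3 := congrArg im h1
  simp at h2 h3
  exact ⟨h2, h3.symm⟩

section Tiling

variable {β : ℝ} (hβ : Adm β) {S : Set (ℂ ≃ᵢ ℂ)} (hS : Til β S) {g h : ℂ ≃ᵢ ℂ} {x : ℂ}

include hβ hS

lemma sum_le (T : Finset (ℂ ≃ᵢ ℂ)) (hT : ∀ g ∈ T, g ∈ S) (x : ℂ) : ∑ g ∈ T, ct β g x ≤ 12 := by
  classical
  obtain ⟨F, hF, hs⟩ := exists_sum hβ hS x
  rw [← hs]
  have : ∑ g ∈ T, ct β g x = ∑ g ∈ T.filter (· ∈ F), ct β g x := by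
    symm
    apply Finset.sum_subset (Finset.filter_subset _ _)
    intro g hg hg'
    by_contra h0
    exact hg' (Finset.mem_filter.2 ⟨hg, (hF g).2 ⟨hT g hg, (ct_ne_zero hβ).1 h0⟩⟩)
  rw [this]
  exact Finset.sum_le_sum_of_subset fun g hg => (Finset.mem_filter.1 hg).2

lemma sum_two_le (hg : g ∈ S) (hh : h ∈ S) (hne : g ≠ h) (x : ℂ) :
    ct β g x + ct β h x ≤ 12 := by
  classical
  have := sum_le hβ hS {g, h} (by simp [hg, hh]) x
  rwa [Finset.sum_pair hne] at this

lemma sum_three_le {k : ℂ ≃ᵢ ℂ} (hg : g ∈ S) (hh : h ∈ S) (hk : k ∈ S) (h1 : g ≠ h) (h2 : g ≠ k)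
    (h3 : h ≠ k) (x : ℂ) : ct β g x + ct β h x + ct β k x ≤ 12 := by
  classical
  have := sum_le hβ hS {g, h, k} (by simp [hg, hh, hk]) x
  rw [Finset.sum_insert (by simp [h1, h2]), Finset.sum_pair h3] at this
  omega

lemma sum_four_le {k l : ℂ ≃ᵢ ℂ} (hg : g ∈ S) (hh : h ∈ S) (hk : k ∈ S) (hl : l ∈ S) (h1 : g ≠ h)
    (h2 : g ≠ k) (h3 : h ≠ k) (h4 : g ≠ l) (h5 : h ≠ l) (h6 : k ≠ l) (x : ℂ) :
    ct β g x + ct β h x + ct β k x + ct β l x ≤ 12 := by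
  classical
  have := sum_le hβ hS {g, h, k, l} (by simp [hg, hh, hk, hl]) x
  rw [Finset.sum_insert (by simp [h1, h2, h4]), Finset.sum_insert (by simp [h3, h5]),
    Finset.sum_pair h6] at this
  omega

lemma hex_ct (hg : g ∈ S) (hh : h ∈ S) (hgx : ct β g x = 4 ∨ ct β g x = 8) (hx : ct β h x ≠ 0) :
    ct β h x = 4 ∨ ct β h x = 8 := by
  classical
  rcases eq_or_ne g h with rfl | hne
  · exact hgx
  obtain ⟨F, hF, hs⟩ := exists_sum hβ hS x
  have hgF : g ∈ F := (hF g).2 ⟨hg, (ct_ne_zero hβ).1 (by omega)⟩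
  have hhF : h ∈ F.erase g := Finset.mem_erase.2 ⟨hne.symm, (hF h).2 ⟨hh, (ct_ne_zero hβ).1 hx⟩⟩
  rw [← Finset.add_sum_erase F _ hgF, ← Finset.add_sum_erase _ _ hhF] at hs
  have := sum_pattern hβ ((F.erase g).erase h) x
  have h2 := ct_mem hβ h x
  simp only [Finset.mem_insert, Finset.mem_singleton] at h2
  omega

lemma exists_along {w : ℂ} (hg : g ∈ S) (hw : ∀ᶠ t : ℝ in 𝓝[>] 0, ct β g (x + t * w) = 6) :
    ∃ h ∈ S, h ≠ g ∧ ct β h x ≠ 0 ∧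
      ∃ᶠ t : ℝ in 𝓝[>] 0, ct β h (x + t * w) ≠ 0 ∧ ct β h (x + t * w) ≠ 12 := by
  classical
  obtain ⟨F, hF, -⟩ := exists_sum hβ hS x
  have hc : Tendsto (fun t : ℝ => x + t * w) (𝓝[>] 0) (𝓝 x) := by
    have : Continuous fun t : ℝ => x + t * w := by fun_prop
    simpa using (this.tendsto 0).mono_left (nhdsWithin_le_nhds (s := Set.Ioi 0))
  have h1 : ∀ᶠ t : ℝ in 𝓝[>] 0, ∃ h ∈ F.erase g,
      ct β h (x + t * w) ≠ 0 ∧ ct β h (x + t * w) ≠ 12 := by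
    filter_upwards [hw, hc.eventually (eventually_subset hβ hS x)] with t h6 hsub
    obtain ⟨F', hF', hs⟩ := exists_sum hβ hS (x + t * w)
    have hgF : g ∈ F' := (hF' g).2 ⟨hg, (ct_ne_zero hβ).1 (by omega)⟩
    rw [← Finset.add_sum_erase F' _ hgF, h6] at hs
    obtain ⟨h, hh, h0⟩ := Finset.exists_ne_zero_of_sum_ne_zero
      (show ∑ h ∈ F'.erase g, ct β h (x + t * w) ≠ 0 by omega)
    have hle := Finset.single_le_sum (f := fun h => ct β h (x + t * w))
      (fun _ _ => Nat.zero_le _) hh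
    rw [Finset.mem_erase, hF'] at hh
    exact ⟨h, Finset.mem_erase.2 ⟨hh.1, (hF h).2 ⟨hh.2.1, hsub h hh.2.1 hh.2.2⟩⟩, h0, by omega⟩
  by_contra! hn
  have h2 : ∀ h ∈ F.erase g, ∀ᶠ t : ℝ in 𝓝[>] 0,
      ¬(ct β h (x + t * w) ≠ 0 ∧ ct β h (x + t * w) ≠ 12) := by
    intro h hh
    rw [Finset.mem_erase, hF] at hh
    have := hn h hh.2.1 hh.1 ((ct_ne_zero hβ).2 hh.2.2)
    filter_upwards [this] with t ht
    tauto
  obtain ⟨t, ⟨k, hk, hk'⟩, ht⟩ := (h1.and ((Finset.eventually_all _).2 h2)).exists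
  exact ht k hk hk'

variable {q p q' p' : ℂ}

lemma hex_notMem_open (hg : g ∈ S) (hh : h ∈ S) (hgq : Edge β g q p) (hhq : Edge β h q' p') {s : ℝ}
    (hs : s ∈ Set.Ioo (0 : ℝ) 1) (e : q = q' + s * (p' - q')) : False := by
  have h1 := hhq.ct_open hβ hs
  rw [← e] at h1
  have := hex_ct hβ hS hg hh (hgq.ct_left hβ) (by omega)
  omega

lemma ray_eq (hg : g ∈ S) (hh : h ∈ S) (hgq : Edge β g q p) {r : ℝ} (hr : 0 < r)
    (hhq : Edge β h (p + r * (q - p)) p) : r = 1 := by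
  have hr' : (r : ℂ) ≠ 0 := by exact_mod_cast hr.ne'
  rcases lt_trichotomy r 1 with h1 | h1 | h1
  · refine (hex_notMem_open hβ hS hh hg hhq hgq (s := 1 - r) ⟨by linarith, by linarith⟩ ?_).elim
    push_cast; ring
  · exact h1
  · have := inv_lt_one_of_one_lt₀ h1
    have h0 := inv_pos.2 hr
    refine (hex_notMem_open hβ hS hg hh hgq hhq (s := 1 - r⁻¹) ⟨by linarith, by linarith⟩ ?_).elim
    push_cast; field_simp; ring

lemma extend_edge (hg : g ∈ S) (hh : h ∈ S) (hgq : Edge β g q p) (hhq : Edge β h q' p') {s r : ℝ}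
    (hs : s ∈ Set.Ioo (0 : ℝ) 1) (e : p = q' + s * (p' - q')) (er : p - q = r * (p' - q')) :
    ∃ k ∈ S, Edge β k (p + (p - q)) p := by
  have hc6 := hhq.ct_open hβ hs
  rw [← e] at hc6
  rcases hgq.ct_right hβ with h3 | h3 | h3
  swap
  · exact ⟨g, hg, hgq.opposite hβ h3⟩
  all_goals have hne : g ≠ h := by rintro rfl; omega
  all_goals have hle := sum_two_le hβ hS hg hh hne p
  swap
  · omega
  obtain ⟨r₁, hr₁, hq₁⟩ := hgq.perp hβ h3
  set q₁ := p + r₁ * (I * (q - p)) with hq₁e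
  have hqp : q - p ≠ 0 := sub_ne_zero.2 (sub_ne_zero.1 (hgq.ne hβ)).symm
  have hq₁p : q₁ - p ≠ 0 := sub_ne_zero.2 (sub_ne_zero.1 (hq₁.ne hβ)).symm
  obtain ⟨k, hk, hkg, hkp, hkf⟩ := exists_along hβ hS hg (hq₁.eventually_right hβ)
  have hkh : k ≠ h := by
    rintro rfl
    rw [e] at hkf
    obtain ⟨r', hr'⟩ := hhq.parallel hβ hs hkf
    rw [← e] at hr'
    have h1 : (r' : ℂ) * (q - p) = ((-(r * r₁) : ℝ) : ℂ) * (I * (q - p)) := by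
      have h2 : q₁ - p = r₁ * (I * (q - p)) := by rw [hq₁e]; ring
      rw [h2] at hr'
      have h4 : q - p = -(r * (p' - q')) := by rw [← er]; ring
      calc (r' : ℂ) * (q - p) = -r * (r' * (p' - q')) := by rw [h4]; ring
        _ = _ := by rw [← hr']; push_cast; ring
    have h2 := (real_comb hqp h1).2
    have hr0 : r ≠ 0 := by rintro rfl; apply hgq.ne hβ; simpa using er
    have := mul_ne_zero hr0 hr₁
    exact this (by linarith)
  have hk3 : ct β k p = 3 := by
    have h1 := sum_three_le hβ hS hg hh hk hne hkg.symm hkh.symm p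
    have h2 := ct_ge hβ k p hkp
    omega
  obtain ⟨r₂, hr₂, hE⟩ := exists_edge_of_frequently hβ (by omega) hq₁p hkf
  have hE : Edge β k (p + r₂ * (q₁ - p)) p := by
    rcases hE with hE | hE
    · have := hE.ct_left hβ; omega
    · exact hE
  obtain rfl := ray_eq hβ hS hg hk hq₁ hr₂ hE
  have hE : Edge β k q₁ p := by
    convert hE using 1
    push_cast; ring
  obtain ⟨l, hl, hlh, hlp, hlf⟩ := exists_along hβ hS hh (hhq.eventually_open hβ hs r)
  rw [← e] at hlp hlf
  rw [← er] at hlf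
  have hl3 : ct β l p = 3 := by
    by_cases hlg : l = g
    · rw [hlg, h3]
    by_cases hlk : l = k
    · rw [hlk, hk3]
    have h1 := sum_four_le hβ hS hg hh hk hl hne hkg.symm hkh.symm (Ne.symm hlg) hlh.symm
      (Ne.symm hlk) p
    have h2 := ct_ge hβ l p hlp
    omega
  have hlgk : l = g ∨ l = k := by
    by_contra! h0
    have h1 := sum_four_le hβ hS hg hh hk hl hne hkg.symm hkh.symm h0.1.symm hlh.symm
      h0.2.symm p
    omega
  obtain ⟨r₃, hr₃, hE'⟩ := exists_edge_of_frequently hβ (by omega) (hgq.ne hβ) hlf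
  have hE' : Edge β l (p + r₃ * (p - q)) p := by
    rcases hE' with hE' | hE'
    · have := hE'.ct_left hβ; omega
    · exact hE'
  have n1 : q ≠ q₁ := by
    intro h0
    have : ((1 : ℝ) : ℂ) * (q - p) = r₁ * (I * (q - p)) := by
      calc _ = q₁ - p := by rw [← h0]; simp
        _ = _ := by rw [hq₁e]; ring
    exact one_ne_zero (real_comb hqp this).1
  have n2 : q₁ ≠ p + r₃ * (p - q) := by
    intro h0
    have : ((-r₃ : ℝ) : ℂ) * (q - p) = r₁ * (I * (q - p)) := by
      calc _ = p + r₃ * (p - q) - p := by push_cast; ring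
        _ = q₁ - p := by rw [← h0]
        _ = _ := by rw [hq₁e]; ring
    exact hr₁ (real_comb hqp this).2
  have n3 : q ≠ p + r₃ * (p - q) := by
    intro h0
    have h1 : (1 + r₃ : ℂ) * (q - p) = 0 := by
      linear_combination h0
    rcases mul_eq_zero.1 h1 with h1 | h1
    · have h2 := congrArg re h1
      simp at h2
      linarith
    · exact hqp h1
  have m1 := hgq.norm_ne hβ hq₁ (by omega) n1
  have a1 := hgq.norm hβ
  have a2 := hq₁.norm hβ
  have a3 := hE'.norm hβ
  rcases hlgk with rfl | rfl
  · have m2 := hgq.norm_ne hβ hE' (by omega) n3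
    have m3 := hq₁.norm_ne hβ hE' (by omega) n2
    grind
  · have m3 := hE.norm_ne hβ hE' (by omega) n2
    have hnorm : ‖p + r₃ * (p - q) - p‖ = ‖q - p‖ := by grind
    rw [add_sub_cancel_left, norm_mul, norm_sub_rev p q, norm_real, Real.norm_eq_abs,
      abs_of_pos hr₃] at hnorm
    have h0 : ‖q - p‖ ≠ 0 := norm_ne_zero_iff.2 hqp
    have : r₃ = 1 := by
      apply mul_right_cancel₀ h0; linarith
    subst this
    refine ⟨l, hl, ?_⟩
    simpa using hE'

lemma mismatch (hg : g ∈ S) (hh : h ∈ S) (hgq : Edge β g q p) (hhq : Edge β h q p')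
    (e : p' = q + ((r3 * β : ℝ) : ℂ) * (p - q)) : False := by
  have h1 := hβ.one_lt
  have h2 := hβ.lt_two
  set l := r3 * β with hl
  have hl0 : (l : ℂ) ≠ 0 := by exact_mod_cast (by linarith : l ≠ 0)
  have hi := inv_lt_one_of_one_lt₀ h1
  have hi0 : 0 < l⁻¹ := by positivity
  have ed : p' - q = l * (p - q) := by rw [e]; ring
  obtain ⟨g₂, hg₂, hE⟩ := extend_edge hβ hS hg hh hgq hhq (s := l⁻¹) (r := l⁻¹) ⟨hi0, hi⟩
    (by rw [ed]; push_cast; field_simp; ring) (by rw [ed]; push_cast; field_simp)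
  obtain ⟨g₃, hg₃, hE₃⟩ := extend_edge hβ hS hh hg₂ hhq hE (s := 2 - l) (r := -l)
    ⟨by linarith, by linarith⟩ (by rw [e]; push_cast; ring) (by rw [e]; push_cast; ring)
  refine hex_notMem_open hβ hS hg₂ hg₃ hE hE₃ (s := (2 * l - 2) / l)
    ⟨by apply div_pos <;> linarith, by rw [div_lt_one (by linarith)]; linarith⟩ ?_
  rw [ed, e]; push_cast; field_simp; ring

/-- Every edge of a tile is an edge of another tile. -/
lemma exists_mate (hg : g ∈ S) (hgq : Edge β g q p) : ∃ h ∈ S, h ≠ g ∧ Edge β h q p := by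
  obtain ⟨h, hh, hhg, hq, hf⟩ := exists_along hβ hS hg (hgq.eventually_left hβ)
  have hc := hex_ct hβ hS hg hh (hgq.ct_left hβ) hq
  obtain ⟨r, hr, hE⟩ := exists_edge_of_frequently hβ (by omega) (hgq.ne hβ) hf
  have hE : Edge β h q (q + r * (p - q)) := by
    rcases hE with hE | hE
    · exact hE
    · have := hE.ct_right hβ; omega
  have a1 := hgq.norm hβ
  have a2 := hE.norm hβ
  have hn : ‖q - (q + r * (p - q))‖ = r * ‖q - p‖ := by
    rw [sub_add_cancel_left, norm_neg, norm_mul, norm_real, Real.norm_eq_abs, abs_of_pos hr,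
      norm_sub_rev]
  have h1 := hβ.one_lt
  refine ⟨h, hh, hhg, ?_⟩
  by_cases hr1 : r = 1
  · subst hr1; simpa using hE
  exfalso
  rw [hn] at a2
  rcases a1 with a1 | a1 <;> rw [a1] at a2 <;> rcases a2 with a2 | a2
  · exact hr1 (by linarith)
  · rw [mul_one] at a2
    exact mismatch hβ hS hg hh hgq hE (by rw [a2])
  · refine mismatch hβ hS hh hg hE hgq ?_
    have hb : ((r3 * β : ℝ) : ℂ) * r = 1 := by rw [mul_comm]; exact_mod_cast a2
    linear_combination (q - p) * hb
  · exact hr1 (mul_right_cancel₀ (by linarith : r3 * β ≠ 0) (by linarith))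

/-- At most two tiles meet along an edge. -/
lemma eq_or_eq_of_mate (hg : g ∈ S) (hh : h ∈ S) (hne : g ≠ h) (hgq : Edge β g q p)
    (hhq : Edge β h q p) {k : ℂ ≃ᵢ ℂ} (hk : k ∈ S) {s : ℝ} (hs : s ∈ Set.Ioo (0 : ℝ) 1)
    (hkx : ct β k (q + s * (p - q)) ≠ 0) : k = g ∨ k = h := by
  by_contra! h0
  have := sum_three_le hβ hS hg hh hk hne h0.1.symm h0.2.symm (q + s * (p - q))
  rw [hgq.ct_open hβ hs, hhq.ct_open hβ hs] at this
  omega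

end Tiling

lemma Z_add (i j : Fin 12) : Z (i + j) = Z i * Z j := by
  rw [Z, Z, Z, ← pow_add, Fin.val_add, ← pow_eq_pow_mod _ ze_twelve]

lemma Z_even {j : Fin 12} (h : j.val % 2 = 0) : ∃ m, Z j = om ^ m := by
  refine ⟨j.val / 2, ?_⟩
  rw [Z, ← ze_sq, ← pow_mul, Nat.mul_div_cancel' (Nat.dvd_of_mod_eq_zero h)]

lemma om_six : om ^ 6 = 1 := by
  rw [show 6 = 3 * 2 from rfl, pow_mul, om_cube]; norm_num

/-- A placement is standard if it is the action of a formal placement. -/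
def Std (β : ℝ) (g : ℂ ≃ᵢ ℂ) : Prop := ∃ t : Pl, t.k < 6 ∧ ⇑g = t.iso β

lemma std_of_eq {β : ℝ} {g : ℂ ≃ᵢ ℂ} (t : Pl) (h : ∀ z, g z = t.iso β z) : Std β g := by
  refine ⟨⟨t.s, t.k % 6, t.x⟩, Nat.mod_lt _ (by norm_num), funext fun z => ?_⟩
  rw [h, Pl.iso, Pl.iso, ← pow_eq_pow_mod _ om_six]

lemma lp_apply (g : ℂ ≃ᵢ ℂ) (x y : ℂ) : lp g (x - y) = g x - g y := by
  have := iso_add g y (x - y)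
  rw [add_sub_cancel] at this
  rw [this]; ring

lemma mem_range_mul {β : ℝ} (m : ℕ) {z : ℂ} (h : z ∈ Set.range (zpt β)) :
    om ^ m * z ∈ Set.range (zpt β) := by
  obtain ⟨x, rfl⟩ := h
  exact ⟨_, zpt_rot_iter β m x⟩

lemma mem_range_conj {β : ℝ} {z : ℂ} (h : z ∈ Set.range (zpt β)) :
    om * (starRingEnd ℂ) z ∈ Set.range (zpt β) := by
  obtain ⟨x, rfl⟩ := h
  exact ⟨_, zpt_ref β x⟩

lemma mem_range_sub {β : ℝ} {z w : ℂ} (h : z ∈ Set.range (zpt β)) (h' : w ∈ Set.range (zpt β)) :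
    z - w ∈ Set.range (zpt β) := by
  obtain ⟨x, rfl⟩ := h
  obtain ⟨y, rfl⟩ := h'
  exact ⟨_, zpt_sub β x y⟩

lemma len_eq {β : ℝ} (hβ : Adm β) {d e : Fin 12} (h : len β d = len β e) :
    d.val % 2 = e.val % 2 := by
  have := hβ.one_lt
  unfold len at h
  split_ifs at h with h1 h2 h2
  · omega
  · linarith
  · linarith
  · omega

lemma Z_quot {d e : Fin 12} (h : d.val % 2 = e.val % 2) : ∃ m, Z d = om ^ m * Z e := by
  have h0 : (d - e).val % 2 = 0 := by revert h; revert d e; decide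
  obtain ⟨m, hm⟩ := Z_even h0
  exact ⟨m, by rw [← hm, ← Z_add, sub_add_cancel]⟩

lemma Std.of_edge {β : ℝ} (hβ : Adm β) {g h : ℂ ≃ᵢ ℂ} (hg : Std β g) {q p : ℂ}
    (h1 : Edge β g q p) (h2 : Edge β h q p) : Std β h := by
  obtain ⟨t, -, ht⟩ := hg
  obtain ⟨i, hi, hi'⟩ := h1
  obtain ⟨j, hj, hj'⟩ := h2
  have eq1 : q = g (vt β (hx i)) := by rw [← hi, g.apply_symm_apply]
  have eq2 : q = h (vt β (hx j)) := by rw [← hj, h.apply_symm_apply]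
  have ep1 : p = g (vt β (sq i)) := by rw [← hi', g.apply_symm_apply]
  have ep2 : p = h (vt β (sq j)) := by rw [← hj', h.apply_symm_apply]
  have hq : q ∈ Set.range (zpt β) := ⟨t.act (fv (hx i)), by rw [zpt_act, eq1, ht, vt]⟩
  have key : h (vt β (hx j)) - h (vt β (sq j)) = g (vt β (hx i)) - g (vt β (sq i)) := by
    rw [← eq1, ← eq2, ← ep1, ← ep2]
  have hlen : len β (udir j) = len β (udir i) := by
    have := congrArg norm key
    rw [← lp_apply, ← lp_apply, LinearIsometryEquiv.norm_map, LinearIsometryEquiv.norm_map,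
      hx_sub_sq, hx_sub_sq, norm_mul, norm_mul, norm_Z, norm_Z, norm_real, norm_real,
      Real.norm_of_nonneg (len_pos hβ _).le, Real.norm_of_nonneg (len_pos hβ _).le] at this
    simpa using this
  have hpar := len_eq hβ hlen
  have hl0 : (len β (udir i) : ℂ) ≠ 0 := by exact_mod_cast (len_pos hβ _).ne'
  obtain ⟨m, hm⟩ : ∃ m, g (vt β (hx i)) - g (vt β (sq i)) =
      len β (udir i) * (om ^ m * Z (udir i)) := by
    have e : g (vt β (hx i)) - g (vt β (sq i)) = om ^ t.k *
        (if t.s then om * (starRingEnd ℂ) (vt β (hx i) - vt β (sq i))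
          else vt β (hx i) - vt β (sq i)) := by
      rw [ht, Pl.iso, Pl.iso, map_sub]
      split_ifs <;> ring
    rw [e, hx_sub_sq]
    split_ifs
    · obtain ⟨m, hm⟩ := Z_quot (d := -udir i) (e := udir i) (by
        generalize udir i = d; revert d; decide)
      refine ⟨t.k + 1 + m, ?_⟩
      rw [map_mul, conj_ofReal, conj_Z, hm, pow_add, pow_add]; ring
    · exact ⟨t.k, by ring⟩
  rw [hm] at key
  have hb : ∀ a : ℂ, ∀ z, lp h (z - vt β (hx j)) = h z - q := fun a z => by
    rw [lp_apply, eq2]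
  obtain ⟨a, -, ha | ha⟩ := lp_cases (lp h)
  · rw [← lp_apply, hx_sub_sq, ha, hlen] at key
    obtain ⟨n, hn⟩ := Z_quot hpar.symm
    have ham : a = om ^ (m + n) := by
      have h3 : len β (udir i) * Z (udir j) ≠ 0 := mul_ne_zero hl0 (Z_ne_zero _)
      apply mul_right_cancel₀ h3
      rw [key, hn, pow_add]; ring
    obtain ⟨x, hx'⟩ := mem_range_sub hq (mem_range_mul (β := β) (m + n) ⟨fv (hx j), rfl⟩)
    refine std_of_eq ⟨false, m + n, x⟩ fun z => ?_
    have h4 := hb a z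
    rw [ha, ham] at h4
    simp only [Pl.iso, hx', vt] at h4 ⊢
    simp only [Bool.false_eq_true, if_false]
    linear_combination -h4
  · rw [← lp_apply, hx_sub_sq, ha, hlen, map_mul, conj_ofReal, conj_Z] at key
    obtain ⟨n, hn⟩ := Z_quot (d := udir i) (e := -udir j) (by
      rw [← hpar]; generalize udir j = d; revert d; decide)
    have ham : a = om ^ (m + n + 5) * om := by
      have h3 : len β (udir i) * Z (-udir j) ≠ 0 := mul_ne_zero hl0 (Z_ne_zero _)
      apply mul_right_cancel₀ h3
      have h6 := om_six
      rw [key, hn, pow_add, pow_add]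
      linear_combination (-om ^ m * om ^ n * (len β (udir i) * Z (-udir j))) * h6
    obtain ⟨x, hx'⟩ := mem_range_sub hq (mem_range_mul (β := β) (m + n + 5)
      (mem_range_conj (β := β) ⟨fv (hx j), rfl⟩))
    refine std_of_eq ⟨true, m + n + 5, x⟩ fun z => ?_
    have h4 := hb a z
    rw [ha, ham, map_sub] at h4
    simp only [Pl.iso, hx', vt] at h4 ⊢
    simp only [if_true]
    linear_combination -h4

lemma isClosed_biUnion {β : ℝ} (hβ : Adm β) {S : Set (ℂ ≃ᵢ ℂ)} (hS : Til β S)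
    {T : Set (ℂ ≃ᵢ ℂ)} (hT : T ⊆ S) : IsClosed (⋃ g ∈ T, g '' tile β) := by
  rw [← isOpen_compl_iff, isOpen_iff_mem_nhds]
  intro x hx
  filter_upwards [eventually_subset hβ hS x] with y hy
  simp only [Set.mem_compl_iff, Set.mem_iUnion, not_exists] at hx ⊢
  exact fun g hg hyg => hx g hg (hy g (hT hg) hyg)

lemma countable_ne_tile {β : ℝ} (hβ : Adm β) (g : ℂ ≃ᵢ ℂ) {C : Set ℂ} (hC : C.Countable) :
    ∃ x ∈ g '' tile β, x ∉ C := by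
  have hd : Dense Cᶜ := hC.dense_compl ℝ
  obtain ⟨x, hx, hx'⟩ := hd.inter_open_nonempty _ isOpen_interior ⟨_, image_ctr_mem hβ g⟩
  exact ⟨x, interior_subset hx, hx'⟩

lemma Std.mem_edge {β : ℝ} (hβ : Adm β) {g : ℂ ≃ᵢ ℂ} {x : ℂ} (h0 : ct β g x ≠ 0)
    (h12 : ct β g x ≠ 12) :
    (∃ i, x = g (vt β i)) ∨ ∃ q p, Edge β g q p ∧ ∃ s ∈ Set.Ioo (0 : ℝ) 1, x = q + s * (p - q) := by
  have hgx : x = g (g.symm x) := (g.apply_symm_apply x).symm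
  rcases tile_cases hβ (g.symm x) with h | h | ⟨i, t, ht, h, -⟩ | ⟨i, h, -⟩
  · exact absurd h.2 h0
  · exact absurd h.2 h12
  · right
    have hline : x = g (vt β i) + t * (g (vt β (i + 1)) - g (vt β i)) := by
      conv_lhs => rw [hgx, h, iso_add, lp_mul, lp_apply]
    rcases edge₀_succ β i with he | he
    · refine ⟨g (vt β i), g (vt β (i + 1)), ?_, t, ht, hline⟩
      simpa only [Edge, g.symm_apply_apply] using he
    · refine ⟨g (vt β (i + 1)), g (vt β i), ?_, 1 - t, ⟨by linarith [ht.2], by linarith [ht.1]⟩, ?_⟩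
      · simpa only [Edge, g.symm_apply_apply] using he
      · rw [hline]; push_cast; ring
  · left
    exact ⟨i, by rw [← h, ← hgx]⟩

lemma Std.vt_mem {β : ℝ} {g : ℂ ≃ᵢ ℂ} (h : Std β g) (i : Fin 14) :
    g (vt β i) ∈ Set.range (zpt β) := by
  obtain ⟨t, -, ht⟩ := h
  exact ⟨t.vert i, by rw [Pl.vert, zpt_act, ht, vt]⟩

/-- If one tile of a tiling is standard then all are. -/
lemma all_std {β : ℝ} (hβ : Adm β) {S : Set (ℂ ≃ᵢ ℂ)} (hS : Til β S) {g₀ : ℂ ≃ᵢ ℂ}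
    (hg₀ : g₀ ∈ S) (h₀ : Std β g₀) : ∀ g ∈ S, Std β g := by
  by_contra! hcon
  obtain ⟨g₁, hg₁, h₁⟩ := hcon
  set U := ⋃ g ∈ {g ∈ S | Std β g}, g '' tile β
  set W := ⋃ g ∈ {g ∈ S | ¬Std β g}, g '' tile β
  have hU : IsClosed U := isClosed_biUnion hβ hS fun _ h => h.1
  have hW : IsClosed W := isClosed_biUnion hβ hS fun _ h => h.1
  have hC : (Set.range (zpt β)).Countable := Set.countable_range _
  have hrank : 1 < Module.rank ℝ ℂ := by rw [Complex.rank_real_complex]; norm_num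
  have hconn := (hC.isConnected_compl_of_one_lt_rank hrank).isPreconnected
  obtain ⟨x₀, hx₀, hx₀'⟩ := countable_ne_tile hβ g₀ hC
  obtain ⟨x₁, hx₁, hx₁'⟩ := countable_ne_tile hβ g₁ hC
  have hcov : (Set.range (zpt β))ᶜ ⊆ U ∪ W := by
    intro x _
    obtain ⟨g, hg, hx⟩ := hS.cover x
    by_cases h : Std β g
    · exact Or.inl (Set.mem_biUnion ⟨hg, h⟩ hx)
    · exact Or.inr (Set.mem_biUnion ⟨hg, h⟩ hx)
  obtain ⟨x, hxC, hxU, hxW⟩ := isPreconnected_closed_iff.1 hconn U W hU hW hcov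
    ⟨x₀, hx₀', Set.mem_biUnion (show g₀ ∈ {g ∈ S | Std β g} from ⟨hg₀, h₀⟩) hx₀⟩
    ⟨x₁, hx₁', Set.mem_biUnion (show g₁ ∈ {g ∈ S | ¬Std β g} from ⟨hg₁, h₁⟩) hx₁⟩
  obtain ⟨g, ⟨hg, hgs⟩, hxg⟩ := Set.mem_iUnion₂.1 hxU
  obtain ⟨h, ⟨hh, hhs⟩, hxh⟩ := Set.mem_iUnion₂.1 hxW
  rw [← ct_ne_zero hβ] at hxg hxh
  have hne : g ≠ h := by rintro rfl; exact hhs hgs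
  have := sum_two_le hβ hS hg hh hne x
  rcases Std.mem_edge hβ hxg (by omega) with ⟨i, hi⟩ | ⟨q, p, hE, s, hs, rfl⟩
  · exact hxC (hi ▸ hgs.vt_mem i)
  · obtain ⟨k, hk, hkg, hE'⟩ := exists_mate hβ hS hg hE
    rcases eq_or_eq_of_mate hβ hS hg hk hkg.symm hE hE' hh hs hxh with rfl | rfl
    · exact hhs hgs
    · exact hhs (hgs.of_edge hβ hE hE')

lemma tendsto_gen_mul {c : ℝ} (hc : c ≠ 0) : Tendsto (fun z : ℂ => (c : ℂ) * z) gen gen := by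
  have hc' : (c : ℂ) ≠ 0 := by exact_mod_cast hc
  refine Tendsto.inf ?_ ?_
  · have : Continuous fun z : ℂ => (c : ℂ) * z := by fun_prop
    simpa using this.tendsto 0
  · have h := (Homeomorph.mulLeft₀ (c : ℂ) hc')
    exact tendsto_residual_of_isOpenMap (Homeomorph.mulLeft₀ (c : ℂ) hc').continuous
      (Homeomorph.mulLeft₀ (c : ℂ) hc').isOpenMap

lemma HasAngle.of_mul_image {c : ℝ} (hc : c ≠ 0) {P : Set ℂ} {x : ℂ} {m : ℕ}
    (h : HasAngle ((fun z : ℂ => c * z) '' P) (c * x) m) : HasAngle P x m := by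
  have hc' : (c : ℂ) ≠ 0 := by exact_mod_cast hc
  filter_upwards [(tendsto_gen_mul hc).eventually h] with y hy
  rw [← hy, star, star]
  congr 1
  ext j
  simp only [Finset.mem_filter, Finset.mem_univ, true_and, Set.mem_image]
  constructor
  · exact fun hj => ⟨_, hj, by ring⟩
  · rintro ⟨z, hz, e⟩
    have : z = x + Z j * y := mul_left_cancel₀ hc' (by rw [e]; ring)
    rwa [← this]

lemma cnt_similar {β β' : ℝ} (hβ : Adm β) (hβ' : Adm β') {c : ℝ} (hc : c ≠ 0) {g : ℂ ≃ᵢ ℂ}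
    (h : (fun z : ℂ => (c : ℂ) * g z) '' tile β = tile β') (z : ℂ) :
    cnt (tile β') (c * g z) = cnt (tile β) z := by
  have h1 := hasAngle_cnt hβ' (c * g z)
  have e : (fun z : ℂ => (c : ℂ) * g z) '' tile β = (fun z : ℂ => (c : ℂ) * z) '' (g '' tile β) := by
    rw [Set.image_image]
  rw [← h, e] at h1
  have h2 := (h1.of_mul_image hc).unique (hasAngle_image hβ g (g z))
  rw [← e, h] at h2
  rw [h2, ct, g.symm_apply_apply]

lemma cnt_eq_eight {β : ℝ} (hβ : Adm β) {x : ℂ} :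
    cnt (tile β) x = 8 ↔ x = vt β 0 ∨ x = vt β 12 := by
  constructor
  · intro h
    rcases tile_cases hβ x with h' | h' | ⟨i, t, ht, -, h'⟩ | ⟨i, hx, h'⟩
    · omega
    · omega
    · omega
    · rw [h] at h'
      have : i = 0 ∨ i = 12 := by clear h hx; revert i; decide
      rcases this with rfl | rfl <;> simp [hx]
  · rintro (rfl | rfl) <;> rw [cnt_vt hβ] <;> rfl

lemma cnt_eq_nine {β : ℝ} (hβ : Adm β) {x : ℂ} :
    cnt (tile β) x = 9 ↔ x = vt β 5 ∨ x = vt β 9 := by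
  constructor
  · intro h
    rcases tile_cases hβ x with h' | h' | ⟨i, t, ht, -, h'⟩ | ⟨i, hx, h'⟩
    · omega
    · omega
    · omega
    · rw [h] at h'
      have : i = 5 ∨ i = 9 := by clear h hx; revert i; decide
      rcases this with rfl | rfl <;> simp [hx]
  · rintro (rfl | rfl) <;> rw [cnt_vt hβ] <;> rfl

lemma vt_zero (β : ℝ) : vt β 0 = 0 := by
  simp [vt, fv, zpt]
  rfl

lemma vt_five (β : ℝ) : vt β 5 = ⟨3 - 3 / 2 * β, -(r3 * β / 2)⟩ := by
  apply Complex.ext <;> simp [vt, fv, zpt] <;> ring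

lemma vt_nine (β : ℝ) : vt β 9 = ⟨3 / 2 + 3 / 2 * β, r3 * (1 / 2 - β / 2)⟩ := by
  apply Complex.ext <;> simp [vt, fv, zpt] <;> ring

lemma vt_twelve (β : ℝ) : vt β 12 = ⟨1, r3 * β⟩ := by
  apply Complex.ext <;> simp [vt, fv, zpt]

lemma normSq_vt (β : ℝ) : normSq (vt β 0 - vt β 12) = 1 + 3 * β ^ 2 ∧
    normSq (vt β 5 - vt β 9) = 3 - 9 * β + 9 * β ^ 2 ∧
    normSq (vt β 0 - vt β 5) = 9 - 9 * β + 3 * β ^ 2 ∧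
    normSq (vt β 0 - vt β 9) = 3 + 3 * β + 3 * β ^ 2 ∧
    normSq (vt β 12 - vt β 5) = 4 - 6 * β + 9 * β ^ 2 ∧
    normSq (vt β 12 - vt β 9) = 1 - 3 * β + 9 * β ^ 2 := by
  have h := r3_sq
  rw [vt_zero, vt_five, vt_nine, vt_twelve]
  refine ⟨?_, ?_, ?_, ?_, ?_, ?_⟩ <;> simp only [normSq_apply, sub_re, sub_im, zero_re, zero_im]
  · linear_combination β ^ 2 * h
  · linear_combination 1 / 4 * h
  · linear_combination β ^ 2 / 4 * h
  · linear_combination (1 / 2 - β / 2) ^ 2 * h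
  · linear_combination (3 / 2 * β) ^ 2 * h
  · linear_combination (3 / 2 * β - 1 / 2) ^ 2 * h

lemma normSq_similar (c : ℝ) (g : ℂ ≃ᵢ ℂ) (x y : ℂ) :
    normSq (c * g x - c * g y) = c ^ 2 * normSq (x - y) := by
  rw [← mul_sub, normSq_mul, ← lp_apply, normSq_ofReal, normSq_eq_norm_sq, normSq_eq_norm_sq,
    LinearIsometryEquiv.norm_map]
  ring

/-- Similar prototiles are equal. -/
lemma eq_of_similar {β β' : ℝ} (hβ : Adm β) (hβ' : Adm β') {c : ℝ} (hc : c ≠ 0) {g : ℂ ≃ᵢ ℂ}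
    (h : (fun z : ℂ => (c : ℂ) * g z) '' tile β = tile β') : β = β' := by
  have hcnt := cnt_similar hβ hβ' hc h
  have hc' : (c : ℂ) ≠ 0 := by exact_mod_cast hc
  have hinj : ∀ i j, i ≠ j → (c : ℂ) * g (vt β i) ≠ c * g (vt β j) := fun i j hij e =>
    hij (vt_injective hβ (g.injective (mul_left_cancel₀ hc' e)))
  have a0 := (cnt_eq_eight hβ').1 ((hcnt _).trans ((cnt_eq_eight hβ).2 (.inl rfl)))
  have a12 := (cnt_eq_eight hβ').1 ((hcnt _).trans ((cnt_eq_eight hβ).2 (.inr rfl)))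
  have a5 := (cnt_eq_nine hβ').1 ((hcnt _).trans ((cnt_eq_nine hβ).2 (.inl rfl)))
  have a9 := (cnt_eq_nine hβ').1 ((hcnt _).trans ((cnt_eq_nine hβ).2 (.inr rfl)))
  have n1 := hinj 0 12 (by decide)
  have n2 := hinj 5 9 (by decide)
  have s1 := normSq_similar c g (vt β 0) (vt β 12)
  have s2 := normSq_similar c g (vt β 5) (vt β 9)
  have t1 : normSq (c * g (vt β 0) - c * g (vt β 12)) = normSq (vt β' 0 - vt β' 12) := by
    rcases a0 with a0 | a0 <;> rcases a12 with a12 | a12 <;> rw [a0, a12] at n1 ⊢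
    · exact absurd rfl n1
    · rw [← normSq_neg, neg_sub]
    · exact absurd rfl n1
  have t2 : normSq (c * g (vt β 5) - c * g (vt β 9)) = normSq (vt β' 5 - vt β' 9) := by
    rcases a5 with a5 | a5 <;> rcases a9 with a9 | a9 <;> rw [a5, a9] at n2 ⊢
    · exact absurd rfl n2
    · rw [← normSq_neg, neg_sub]
    · exact absurd rfl n2
  obtain ⟨m1, m2, -⟩ := normSq_vt β
  obtain ⟨m1', m2', -⟩ := normSq_vt β'
  rw [t1, m1, m1'] at s1
  rw [t2, m2, m2'] at s2
  have hc2 : 0 < c ^ 2 := by positivity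
  have h3 : c ^ 2 * ((1 + 3 * β ^ 2) * (3 - 9 * β' + 9 * β' ^ 2) -
      (3 - 9 * β + 9 * β ^ 2) * (1 + 3 * β' ^ 2)) = 0 := by
    linear_combination -(3 - 9 * β' + 9 * β' ^ 2) * s1 + (1 + 3 * β' ^ 2) * s2
  have h4 : (1 + 3 * β ^ 2) * (3 - 9 * β' + 9 * β' ^ 2) -
      (3 - 9 * β + 9 * β ^ 2) * (1 + 3 * β' ^ 2) = 9 * ((β - β') * (1 - 3 * (β * β'))) := by ring
  rw [h4] at h3
  have h5 : 3 / 5 * (3 / 5) < β * β' :=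
    mul_lt_mul'' hβ.1.1 hβ'.1.1 (by norm_num) (by norm_num)
  have h6 : 1 - 3 * (β * β') ≠ 0 := by intro h0; linarith
  have h7 : β - β' = 0 := by
    simpa [hc, h6] using h3
  linarith

/-- The prototile has no symmetry. -/
lemma eq_refl_of_image_eq {β : ℝ} (hβ : Adm β) {g : ℂ ≃ᵢ ℂ} (h : g '' tile β = tile β) :
    g = IsometryEquiv.refl ℂ := by
  have hcnt := cnt_similar hβ hβ (c := 1) one_ne_zero (g := g) (by simpa using h)
  simp only [ofReal_one, one_mul] at hcnt
  have hinj : ∀ i j, i ≠ j → g (vt β i) ≠ g (vt β j) := fun i j hij e =>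
    hij (vt_injective hβ (g.injective e))
  have a0 := (cnt_eq_eight hβ).1 ((hcnt _).trans ((cnt_eq_eight hβ).2 (.inl rfl)))
  have a5 := (cnt_eq_nine hβ).1 ((hcnt _).trans ((cnt_eq_nine hβ).2 (.inl rfl)))
  have a9 := (cnt_eq_nine hβ).1 ((hcnt _).trans ((cnt_eq_nine hβ).2 (.inr rfl)))
  have n2 := hinj 5 9 (by decide)
  have s1 := normSq_similar 1 g (vt β 0) (vt β 5)
  simp only [ofReal_one, one_mul, one_pow] at s1
  obtain ⟨-, -, m1, m2, m3, m4⟩ := normSq_vt β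
  obtain ⟨⟨b1, b2⟩, -⟩ := hβ
  rw [m1] at s1
  rcases a0 with a0 | a0 <;> rcases a5 with a5 | a5 <;> rw [a0, a5] at s1
  · have h9 : g (vt β 9) = vt β 9 := by
      rcases a9 with a9 | a9
      · exact absurd (a5.trans a9.symm) n2
      · exact a9
    have e5 : lp g (vt β 5) = vt β 5 := by
      have := lp_apply g (vt β 5) (vt β 0)
      rwa [a0, a5, vt_zero, sub_zero] at this
    have e9 : lp g (vt β 9) = vt β 9 := by
      have := lp_apply g (vt β 9) (vt β 0)
      rwa [a0, h9, vt_zero, sub_zero] at this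
    have key : ∀ z, lp g z = z := by
      have h50 : vt β 5 ≠ 0 := by
        intro h0
        have := congrArg re h0
        rw [vt_five] at this
        simp at this
        linarith
      obtain ⟨a, -, ha | ha⟩ := lp_cases (lp g)
      · rw [ha] at e5
        have : a = 1 := mul_right_cancel₀ h50 (by rw [e5, one_mul])
        simp [ha, this]
      · exfalso
        rw [ha] at e5 e9
        have h1 : vt β 9 * (starRingEnd ℂ) (vt β 5) = vt β 5 * (starRingEnd ℂ) (vt β 9) := by
          linear_combination -(starRingEnd ℂ) (vt β 5) * e9 + (starRingEnd ℂ) (vt β 9) * e5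
        rw [vt_five, vt_nine] at h1
        have h2 := congrArg im h1
        simp only [mul_im, conj_re, conj_im] at h2
        have h3 : r3 * (1 - β + β ^ 2) = 0 := by linarith
        have := r3_pos
        have : 0 < r3 * (1 - β + β ^ 2) := mul_pos this (by nlinarith)
        linarith
    ext z
    have := iso_add g 0 z
    have h0 := vt_zero β ▸ a0
    rw [zero_add, h0, zero_add, key] at this
    rw [this]; rfl
  · rw [m2] at s1; linarith
  · rw [m3] at s1; nlinarith
  · rw [m4] at s1; nlinarith

/-- The start of the `i`-th edge of a placed tile, oriented counterclockwise. -/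
def Pl.src (t : Pl) (i : Fin 14) : V := t.vert (if t.s then i + 1 else i)

/-- The end of the `i`-th edge of a placed tile, oriented counterclockwise. -/
def Pl.tgt (t : Pl) (i : Fin 14) : V := t.vert (if t.s then i else i + 1)

/-- The Eisenstein integer `m + n ω` as a complex number. -/
def eis (a : ℤ × ℤ) : ℂ := a.1 + a.2 * om

/-- The product of Eisenstein integers. -/
def emul (a b : ℤ × ℤ) : ℤ × ℤ := (a.1 * b.1 - a.2 * b.2, a.1 * b.2 + a.2 * b.1 + a.2 * b.2)

/-- The conjugate of an Eisenstein integer. -/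
def econj (a : ℤ × ℤ) : ℤ × ℤ := (a.1 + a.2, -a.2)

lemma om_mul_self : om * om = om - 1 := by
  have h := r3_sq
  apply Complex.ext <;> simp [om]
  · linarith
  · ring

lemma conj_om : (starRingEnd ℂ) om = 1 - om := by
  apply Complex.ext <;> simp [om]
  norm_num

lemma eis_add (a b : ℤ × ℤ) : eis (a + b) = eis a + eis b := by
  simp [eis]; ring

lemma eis_mul (a b : ℤ × ℤ) : eis (emul a b) = eis a * eis b := by
  simp only [eis, emul]
  push_cast
  linear_combination (-(a.2 : ℂ) * b.2) * om_mul_self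

lemma eis_conj (a : ℤ × ℤ) : eis (econj a) = (starRingEnd ℂ) (eis a) := by
  simp only [eis, econj, map_add, map_mul, conj_om, map_intCast]
  push_cast
  ring

lemma eis_sum {ι : Type*} (s : Finset ι) (f : ι → ℤ × ℤ) : eis (∑ i ∈ s, f i) = ∑ i ∈ s, eis (f i) := by
  let F : ℤ × ℤ →+ ℂ := ⟨⟨eis, by simp [eis]⟩, eis_add⟩
  exact map_sum F f s

/-- The first coordinate functional. -/
def eA (x : V) : ℤ × ℤ := (x.1, x.2.1)

/-- The second coordinate functional. -/
def eB (x : V) : ℤ × ℤ := (x.2.2.1, x.2.2.2)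

/-- The form that is `(-1)^k` on a step `ω^k` of the first coordinate. -/
def eC (x : V) : ℤ × ℤ := (x.1 ^ 3 + 3 * x.1 ^ 2 * x.2.1 - x.2.1 ^ 3, 0)

/-- Twice the cup product of the form `φ` and the function `g` over the boundary of a tile. -/
def cup (φ g : V → ℂ) (t : Pl) : ℂ :=
  ∑ i, φ (t.tgt i - t.src i) * (g (t.src i) + g (t.tgt i))

/-- The form `φ` is closed over every tile. -/
def IsForm (φ : V → ℂ) : Prop := ∀ t : Pl, t.k < 6 → ∑ i, φ (t.tgt i - t.src i) = 0

lemma Pl.src_eq (t : Pl) (i : Fin 14) : t.src i = Pl.src ⟨t.s, t.k, 0⟩ i + t.x := by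
  simp [Pl.src, Pl.vert, Pl.act]

lemma Pl.tgt_eq (t : Pl) (i : Fin 14) : t.tgt i = Pl.tgt ⟨t.s, t.k, 0⟩ i + t.x := by
  simp [Pl.tgt, Pl.vert, Pl.act]

lemma cup_eq {φ g : V → ℂ} (hφ : IsForm φ) (hg : ∀ x y, g (x + y) = g x + g y) (t : Pl)
    (ht : t.k < 6) : cup φ g t = cup φ g ⟨t.s, t.k, 0⟩ := by
  have h := hφ ⟨t.s, t.k, 0⟩ ht
  rw [cup, cup, ← sub_eq_zero, ← Finset.sum_sub_distrib]
  trans ∑ i, φ (Pl.tgt ⟨t.s, t.k, 0⟩ i - Pl.src ⟨t.s, t.k, 0⟩ i) * (2 * g t.x)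
  · refine Finset.sum_congr rfl fun i _ => ?_
    rw [t.src_eq, t.tgt_eq, add_sub_add_right_eq_sub, hg, hg]
    ring
  · rw [← Finset.sum_mul, h, zero_mul]

lemma isForm_eis {φ : V → ℤ × ℤ} (h : ∀ s, ∀ k < 6,
    ∑ i, φ (Pl.tgt ⟨s, k, 0⟩ i - Pl.src ⟨s, k, 0⟩ i) = 0) : IsForm fun x => eis (φ x) := by
  intro t ht
  have := congrArg eis (h t.s t.k ht)
  rw [eis_sum] at this
  simp only [t.src_eq, t.tgt_eq, add_sub_add_right_eq_sub]
  rw [this]; simp [eis]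

lemma isForm_A : IsForm fun x => eis (eA x) := isForm_eis (by decide +kernel)
lemma isForm_B : IsForm fun x => eis (eB x) := isForm_eis (by decide +kernel)
lemma isForm_C : IsForm fun x => eis (eC x) := isForm_eis (by decide +kernel)

/-- Cup products in the Eisenstein integers. -/
def ecup (φ g : V → ℤ × ℤ) (s : Bool) (k : ℕ) : ℤ × ℤ :=
  ∑ i, emul (φ (Pl.tgt ⟨s, k, 0⟩ i - Pl.src ⟨s, k, 0⟩ i))
    (g (Pl.src ⟨s, k, 0⟩ i) + g (Pl.tgt ⟨s, k, 0⟩ i))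

lemma cup_eis {φ g : V → ℤ × ℤ} (hφ : IsForm fun x => eis (φ x))
    (hg : ∀ x y, g (x + y) = g x + g y) (t : Pl) (ht : t.k < 6) :
    cup (fun x => eis (φ x)) (fun x => eis (g x)) t = eis (ecup φ g t.s t.k) := by
  rw [cup_eq hφ (fun x y => by rw [hg, eis_add]) t ht, cup, ecup, eis_sum]
  simp only [eis_mul, eis_add]

lemma eA_add (x y : V) : eA (x + y) = eA x + eA y := rfl
lemma eB_add (x y : V) : eB (x + y) = eB x + eB y := rfl
lemma econj_add (x y : ℤ × ℤ) : econj (x + y) = econj x + econj y := by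
  ext <;> simp [econj] <;> ring

lemma eis_eisenstein : eis (-1, 2) = r3 * I := by
  apply Complex.ext <;> simp [eis, om] <;> ring

lemma ecup_values : ∀ s, ∀ k < 6,
    ecup eA eA s k = 0 ∧ ecup eB eB s k = 0 ∧ ecup eC eB s k = 0 ∧
    ecup eA (fun x => econj (eA x)) s k = emul (8, 0) (-1, 2) ∧
    ecup eB (fun x => econj (eB x)) s k = emul (4, 0) (-1, 2) ∧
    ecup eA eB s k = emul (-1, 2) (econj (ecup eC eA s k)) ∧
    ecup eA (fun x => econj (eB x)) s k = -econj (ecup eB (fun x => econj (eA x)) s k) := by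
  decide +kernel

/-- The translate of a formal placement. -/
def Pl.shift (t : Pl) (x : V) : Pl := ⟨t.s, t.k, t.x + x⟩

@[simp] lemma Pl.shift_src (t : Pl) (x : V) (i : Fin 14) : (t.shift x).src i = t.src i + x := by
  simp only [Pl.src, Pl.vert, Pl.act, Pl.shift, add_assoc]; rfl

@[simp] lemma Pl.shift_tgt (t : Pl) (x : V) (i : Fin 14) : (t.shift x).tgt i = t.tgt i + x := by
  simp only [Pl.tgt, Pl.vert, Pl.act, Pl.shift, add_assoc]; rfl

lemma Pl.shift_shift (t : Pl) (x y : V) : (t.shift x).shift y = t.shift (x + y) := by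
  simp [Pl.shift, add_assoc]

lemma Pl.shift_zero (t : Pl) : t.shift 0 = t := by simp [Pl.shift]

/-- The two edges agree, traversed in opposite directions. -/
def Opp (e e' : Pl × Fin 14) : Prop := e'.1.src e'.2 = e.1.tgt e.2 ∧ e'.1.tgt e'.2 = e.1.src e.2

/-- Formal data of a tiling with period `v`, cut into strips `lay` parallel to `v` and into
fundamental domains `col`. -/
structure Strip (T : Set Pl) (v : V) (col lay : Pl → ℤ) : Prop where
  k_lt : ∀ t ∈ T, t.k < 6
  shift : ∀ t ∈ T, ∀ j : ℤ, t.shift (j • v) ∈ T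
  mate : ∀ t ∈ T, ∀ i, ∃! e : Pl × Fin 14, e.1 ∈ T ∧ Opp (t, i) e
  col_shift : ∀ t, ∀ j : ℤ, col (t.shift (j • v)) = col t + j
  lay_shift : ∀ t, ∀ j : ℤ, lay (t.shift (j • v)) = lay t
  adj : ∀ e e' : Pl × Fin 14, e.1 ∈ T → e'.1 ∈ T → Opp e e' → |lay e.1 - lay e'.1| ≤ 1
  finite : ∀ j, {t ∈ T | col t = 0 ∧ lay t = j}.Finite
  nonempty : ∀ j, {t ∈ T | col t = 0 ∧ lay t = j}.Nonempty
  card_le : ∃ K, ∀ j, {t ∈ T | col t = 0 ∧ lay t = j}.ncard ≤ K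
  lip : ∃ C, ∀ t ∈ T, ∀ t' ∈ T, col t = 0 → col t' = 0 → lay t = lay t' →
    ‖eis (eA (t.x - t'.x))‖ ≤ C ∧ ‖eis (eB (t.x - t'.x))‖ ≤ C

lemma exists_bound (ψ : V → ℂ) : ∃ C, 0 ≤ C ∧ ∀ t : Pl, t.k < 6 → ∀ i,
    ‖ψ (t.tgt i - t.src i)‖ ≤ C ∧ ‖ψ (t.src i - t.x)‖ ≤ C ∧ ‖ψ (t.tgt i - t.x)‖ ≤ C := by
  let f : Bool × Fin 6 × Fin 14 → ℝ := fun a =>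
    ‖ψ (Pl.tgt ⟨a.1, a.2.1, 0⟩ a.2.2 - Pl.src ⟨a.1, a.2.1, 0⟩ a.2.2)‖ +
    ‖ψ (Pl.src ⟨a.1, a.2.1, 0⟩ a.2.2)‖ + ‖ψ (Pl.tgt ⟨a.1, a.2.1, 0⟩ a.2.2)‖
  obtain ⟨C, hC⟩ := (Set.finite_range f).bddAbove
  refine ⟨C, ?_, fun t ht i => ?_⟩
  · exact le_trans (by positivity) (hC ⟨(true, 0, 0), rfl⟩)
  · have h := hC ⟨(t.s, ⟨t.k, ht⟩, i), rfl⟩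
    simp only [f] at h
    rw [t.src_eq, t.tgt_eq, add_sub_add_right_eq_sub, add_sub_cancel_right, add_sub_cancel_right]
    refine ⟨?_, ?_, ?_⟩ <;> refine le_trans ?_ h
    · rw [add_assoc]; exact le_add_of_nonneg_right (by positivity)
    · linarith [norm_nonneg (ψ (Pl.tgt ⟨t.s, t.k, 0⟩ i - Pl.src ⟨t.s, t.k, 0⟩ i)),
        norm_nonneg (ψ (Pl.tgt ⟨t.s, t.k, 0⟩ i))]
    · exact le_add_of_nonneg_left (by positivity)

/-- Bounded sequences. -/
def Bdd (u : ℕ → ℂ) : Prop := ∃ C, ∀ n, ‖u n‖ ≤ C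

lemma Bdd.add {u w : ℕ → ℂ} (hu : Bdd u) (hw : Bdd w) : Bdd fun n => u n + w n := by
  obtain ⟨C, hC⟩ := hu
  obtain ⟨D, hD⟩ := hw
  exact ⟨C + D, fun n => (norm_add_le _ _).trans (add_le_add (hC n) (hD n))⟩

lemma Bdd.congr {u w : ℕ → ℂ} (hu : Bdd u) (h : ∀ n, u n = w n) : Bdd w :=
  funext h ▸ hu

lemma Bdd.mul {u : ℕ → ℂ} (a : ℂ) (hu : Bdd u) : Bdd fun n => a * u n := by
  obtain ⟨C, hC⟩ := hu
  exact ⟨‖a‖ * C, fun n => by rw [norm_mul]; exact mul_le_mul_of_nonneg_left (hC n) (norm_nonneg _)⟩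

lemma Bdd.conj {u : ℕ → ℂ} (hu : Bdd u) : Bdd fun n => (starRingEnd ℂ) (u n) := by
  obtain ⟨C, hC⟩ := hu
  exact ⟨C, fun n => by rw [RCLike.norm_conj]; exact hC n⟩

lemma Bdd.eq_zero {u : ℕ → ℂ} {a : ℂ} (hu : ¬Bdd u) (h : Bdd fun n => a * u n) : a = 0 := by
  by_contra ha
  apply hu
  have := h.mul a⁻¹
  simpa [← mul_assoc, inv_mul_cancel₀ ha] using this

namespace Strip

variable {T : Set Pl} {v : V} {col lay : Pl → ℤ} (h : Strip T v col lay)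

include h

lemma finite_region (J : ℕ) : {t ∈ T | col t = 0 ∧ 0 ≤ lay t ∧ lay t ≤ J}.Finite := by
  have hf : (Set.Icc (0 : ℤ) J).Finite := Set.finite_Icc _ _
  refine (hf.biUnion fun j _ => h.finite j).subset ?_
  rintro t ⟨h1, h2, h3, h4⟩
  exact Set.mem_biUnion (show lay t ∈ Set.Icc (0 : ℤ) J from ⟨h3, h4⟩) ⟨h1, h2, rfl⟩

/-- The tiles of the first `J + 1` strips. -/
def region (J : ℕ) : Finset Pl := (h.finite_region J).toFinset

lemma mem_region {J : ℕ} {t : Pl} :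
    t ∈ h.region J ↔ t ∈ T ∧ col t = 0 ∧ 0 ≤ lay t ∧ lay t ≤ J := by
  rw [region, Set.Finite.mem_toFinset]; rfl

lemma le_card_region (J : ℕ) : J + 1 ≤ (h.region J).card := by
  choose f hf using h.nonempty
  have : (Finset.range (J + 1)).card ≤ (h.region J).card := by
    refine Finset.card_le_card_of_injOn (fun j : ℕ => f j) (fun j hj => ?_) fun j _ k _ e => ?_
    · obtain ⟨h1, h2, h3⟩ := hf j
      have hj' := Finset.mem_range.1 hj
      exact h.mem_region.2 ⟨h1, h2, h3.symm ▸ by omega, h3.symm ▸ by omega⟩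
    · have e1 := (hf j).2.2
      have e2 := (hf k).2.2
      simp only at e
      rw [e, e2] at e1
      exact_mod_cast e1.symm
  simpa using this

/-- A tile of the `J`-th strip. -/
def pick (J : ℕ) : Pl := (h.nonempty J).choose

lemma pick_spec (J : ℕ) : h.pick J ∈ T ∧ col (h.pick J) = 0 ∧ lay (h.pick J) = J :=
  (h.nonempty J).choose_spec

open scoped Classical in
/-- The opposite edge. -/
def opp (e : Pl × Fin 14) : Pl × Fin 14 :=
  if he : e.1 ∈ T then (h.mate e.1 he e.2).choose else e

lemma opp_spec {e : Pl × Fin 14} (he : e.1 ∈ T) : (h.opp e).1 ∈ T ∧ Opp e (h.opp e) := by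
  rw [opp, dif_pos he]
  exact (h.mate e.1 he e.2).choose_spec.1

lemma eq_opp {e e' : Pl × Fin 14} (he : e.1 ∈ T) (he' : e'.1 ∈ T) (ho : Opp e e') :
    h.opp e = e' :=
  (h.mate e.1 he e.2).unique (h.opp_spec he) ⟨he', ho⟩

/-- The opposite edge, moved back to the fundamental domain. -/
def turn (e : Pl × Fin 14) : Pl × Fin 14 :=
  ((h.opp e).1.shift (-col (h.opp e).1 • v), (h.opp e).2)

lemma turn_spec {e : Pl × Fin 14} (he : e.1 ∈ T) : (h.turn e).1 ∈ T ∧ col (h.turn e).1 = 0 ∧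
    lay (h.turn e).1 = lay (h.opp e).1 ∧
    (h.turn e).1.src (h.turn e).2 = e.1.tgt e.2 + -col (h.opp e).1 • v ∧
    (h.turn e).1.tgt (h.turn e).2 = e.1.src e.2 + -col (h.opp e).1 • v := by
  obtain ⟨h1, h2, h3⟩ := h.opp_spec he
  refine ⟨h.shift _ h1 _, ?_, ?_, ?_, ?_⟩
  · simp only [turn]; rw [h.col_shift]; ring
  · simp only [turn]; rw [h.lay_shift]
  · simp only [turn]; rw [Pl.shift_src, h2]
  · simp only [turn]; rw [Pl.shift_tgt, h3]

lemma opp_turn {e : Pl × Fin 14} (he : e.1 ∈ T) :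
    h.opp (h.turn e) = (e.1.shift (-col (h.opp e).1 • v), e.2) := by
  obtain ⟨h1, h2, h3, h4, h5⟩ := h.turn_spec he
  refine h.eq_opp h1 (h.shift _ he _) ⟨?_, ?_⟩
  · rw [Pl.shift_src, h5]
  · rw [Pl.shift_tgt, h4]

lemma turn_turn {e : Pl × Fin 14} (he : e.1 ∈ T) (h0 : col e.1 = 0) : h.turn (h.turn e) = e := by
  rw [turn, h.opp_turn he]
  ext1
  · simp only
    rw [h.col_shift, h0, Pl.shift_shift, ← add_smul]
    simp [Pl.shift_zero]
  · rfl

/-- The edges of the first `J + 1` strips. -/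
def edges (J : ℕ) : Finset (Pl × Fin 14) := h.region J ×ˢ Finset.univ

/-- The edges between tiles of the first `J + 1` strips. -/
def inner (J : ℕ) : Finset (Pl × Fin 14) :=
  (h.edges J).filter fun e => 0 ≤ lay (h.opp e).1 ∧ lay (h.opp e).1 ≤ J

/-- The edges on top of the first `J + 1` strips. -/
def top (J : ℕ) : Finset (Pl × Fin 14) := (h.edges J).filter fun e => J < lay (h.opp e).1

/-- The edges at the bottom of the first `J + 1` strips. -/
def bot (J : ℕ) : Finset (Pl × Fin 14) := (h.edges J).filter fun e => lay (h.opp e).1 < 0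

lemma mem_edges {J : ℕ} {e : Pl × Fin 14} :
    e ∈ h.edges J ↔ e.1 ∈ T ∧ col e.1 = 0 ∧ 0 ≤ lay e.1 ∧ lay e.1 ≤ J := by
  simp [edges, h.mem_region]

lemma adj_opp {e : Pl × Fin 14} (he : e.1 ∈ T) : |lay e.1 - lay (h.opp e).1| ≤ 1 :=
  h.adj e _ he (h.opp_spec he).1 (h.opp_spec he).2

lemma bot_eq (J : ℕ) : h.bot J = h.bot 0 := by
  ext e
  simp only [bot, Finset.mem_filter, h.mem_edges]
  constructor
  · rintro ⟨⟨h1, h2, h3, h4⟩, h5⟩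
    have := abs_le.1 (h.adj_opp h1)
    exact ⟨⟨h1, h2, h3, by push_cast; omega⟩, h5⟩
  · rintro ⟨⟨h1, h2, h3, h4⟩, h5⟩
    exact ⟨⟨h1, h2, h3, by push_cast at h4; omega⟩, h5⟩

lemma sum_edges (J : ℕ) (F : Pl × Fin 14 → ℂ) : ∑ e ∈ h.edges J, F e =
    ∑ e ∈ h.inner J, F e + ∑ e ∈ h.top J, F e + ∑ e ∈ h.bot J, F e := by
  rw [inner, top, bot, Finset.sum_filter, Finset.sum_filter, Finset.sum_filter,
    ← Finset.sum_add_distrib, ← Finset.sum_add_distrib]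
  refine Finset.sum_congr rfl fun e _ => ?_
  rcases lt_or_ge (lay (h.opp e).1) 0 with h1 | h1
  · rw [if_neg (by omega), if_neg (by omega), if_pos h1]; ring
  · rcases le_or_gt (lay (h.opp e).1) J with h2 | h2
    · rw [if_pos ⟨h1, h2⟩, if_neg (by omega), if_neg (by omega)]; ring
    · rw [if_neg (by omega), if_pos h2, if_neg (by omega)]; ring

lemma sum_inner (J : ℕ) (F : Pl × Fin 14 → ℂ) :
    ∑ e ∈ h.inner J, F e = ∑ e ∈ h.inner J, F (h.turn e) := by
  have hmem : ∀ e ∈ h.inner J, h.turn e ∈ h.inner J := by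
    intro e he
    simp only [inner, Finset.mem_filter, h.mem_edges] at he ⊢
    obtain ⟨⟨h1, h2, h3, h4⟩, h5, h6⟩ := he
    obtain ⟨a1, a2, a3, -⟩ := h.turn_spec h1
    rw [h.opp_turn h1, a3, h.lay_shift]
    exact ⟨⟨a1, a2, h5, h6⟩, h3, h4⟩
  have hinv : ∀ e ∈ h.inner J, h.turn (h.turn e) = e := by
    intro e he
    simp only [inner, Finset.mem_filter, h.mem_edges] at he
    exact h.turn_turn he.1.1 he.1.2.1
  refine Finset.sum_bij' (fun e _ => h.turn e) (fun e _ => h.turn e) hmem hmem hinv hinv ?_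
  intro e he
  rw [hinv e he]

lemma exists_expansion (φ : V → ℂ) (hφ : IsForm φ) (hodd : ∀ w, φ (-w) = -φ w) :
    ∃ (b : ℕ → ℂ) (a : ℂ), ((∀ w, (φ w).im = 0) → a.im = 0 ∧ ∀ J, (b J).im = 0) ∧
      ∀ g : V →+ ℂ, (∃ C, ∀ t ∈ T, ∀ t' ∈ T, col t = 0 → col t' = 0 → lay t = lay t' →
        ‖g (t.x - t'.x)‖ ≤ C) →
      Bdd fun J => ∑ t ∈ h.region J, cup φ g t - (g v * b J + a * g (h.pick J).x) := by
  set D : Pl × Fin 14 → ℂ := fun e => φ (e.1.tgt e.2 - e.1.src e.2) with hD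
  have hDt : ∀ e, e.1 ∈ T → D (h.turn e) = -D e := by
    intro e he
    obtain ⟨-, -, -, h4, h5⟩ := h.turn_spec he
    simp only [hD]
    rw [h4, h5, add_sub_add_right_eq_sub, ← hodd, neg_sub]
  have hinner : ∀ J, ∀ e ∈ h.inner J, e.1 ∈ T := fun J e he =>
    (h.mem_edges.1 (Finset.mem_filter.1 he).1).1
  have hD0 : ∀ J, ∑ e ∈ h.inner J, D e = 0 := by
    intro J
    have h1 := h.sum_inner J D
    rw [Finset.sum_congr rfl fun e he => hDt e (hinner J e he), Finset.sum_neg_distrib] at h1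
    exact self_eq_neg.1 h1
  have htop : ∀ J, ∑ e ∈ h.top J, D e = -∑ e ∈ h.bot 0, D e := by
    intro J
    have h1 := h.sum_edges J D
    rw [hD0, h.bot_eq, edges, Finset.sum_product, Finset.sum_eq_zero] at h1
    · linear_combination -h1
    · exact fun t ht => hφ t (h.k_lt t (h.mem_region.1 ht).1)
  refine ⟨fun J => ∑ e ∈ h.inner J, (col (h.opp e).1 : ℂ) * D e,
    -2 * ∑ e ∈ h.bot 0, D e, fun hre => ?_, fun g ⟨C, hC⟩ => ?_⟩
  · have h1 : ∀ s : Finset (Pl × Fin 14), (∑ e ∈ s, D e).im = 0 := fun s => by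
      rw [im_sum]; exact Finset.sum_eq_zero fun e _ => hre _
    refine ⟨by simp [h1], fun J => ?_⟩
    rw [im_sum]
    refine Finset.sum_eq_zero fun e _ => ?_
    rw [mul_im, intCast_im, hre]
    ring
  obtain ⟨K, hK⟩ := h.card_le
  obtain ⟨Cφ, hCφ0, hCφ⟩ := exists_bound φ
  obtain ⟨Cg, hCg0, hCg⟩ := exists_bound g
  set F : Pl × Fin 14 → ℂ := fun e => D e * (g (e.1.src e.2) + g (e.1.tgt e.2)) with hF
  have hFin : ∀ J, ∑ e ∈ h.inner J, F e = g v * ∑ e ∈ h.inner J, (col (h.opp e).1 : ℂ) * D e := by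
    intro J
    have h1 := h.sum_inner J F
    have h2 : ∀ e ∈ h.inner J, F (h.turn e) = -F e + 2 * (g v * ((col (h.opp e).1 : ℂ) * D e)) := by
      intro e he
      have he' := hinner J e he
      obtain ⟨-, -, -, h4, h5⟩ := h.turn_spec he'
      simp only [hF]
      rw [hDt e he', h4, h5, map_add, map_add, map_zsmul, zsmul_eq_mul]
      push_cast
      ring
    rw [Finset.sum_congr rfl h2, Finset.sum_add_distrib, Finset.sum_neg_distrib, ← Finset.mul_sum,
      ← Finset.mul_sum] at h1
    linear_combination h1 / 2
  refine ⟨14 * K * (Cφ * (2 * C + 2 * Cg)) + ‖∑ e ∈ h.bot 0, F e‖, fun J => ?_⟩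
  have e1 : ∑ t ∈ h.region J, cup φ g t = ∑ e ∈ h.edges J, F e := by
    rw [edges, Finset.sum_product]; rfl
  have e2 : ∑ e ∈ h.edges J, F e - (g v * (∑ e ∈ h.inner J, (col (h.opp e).1 : ℂ) * D e) +
      (-2 * ∑ e ∈ h.bot 0, D e) * g (h.pick J).x) =
      ∑ e ∈ h.top J, D e * (g (e.1.src e.2 - (h.pick J).x) + g (e.1.tgt e.2 - (h.pick J).x)) +
        ∑ e ∈ h.bot 0, F e := by
    have h3 : ∀ e ∈ h.top J,
        D e * (g (e.1.src e.2 - (h.pick J).x) + g (e.1.tgt e.2 - (h.pick J).x)) =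
          F e - 2 * g (h.pick J).x * D e := fun e _ => by
      simp only [hF]; rw [map_sub, map_sub]; ring
    rw [h.sum_edges, hFin, h.bot_eq, Finset.sum_congr rfl h3, Finset.sum_sub_distrib,
      ← Finset.mul_sum, htop]
    ring
  simp only
  rw [e1, e2]
  refine (norm_add_le _ _).trans (add_le_add ?_ le_rfl)
  have hlay : ∀ e ∈ h.top J, e.1 ∈ T ∧ col e.1 = 0 ∧ lay e.1 = J := by
    intro e he
    rw [top, Finset.mem_filter, h.mem_edges] at he
    have := abs_le.1 (h.adj_opp he.1.1)
    exact ⟨he.1.1, he.1.2.1, by omega⟩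
  have hcard : (h.top J).card ≤ 14 * K := by
    have : h.top J ⊆ (h.finite J).toFinset ×ˢ (Finset.univ : Finset (Fin 14)) := by
      intro e he
      have := hlay e he
      simp only [Finset.mem_product, Set.Finite.mem_toFinset, Finset.mem_univ, and_true]
      exact this
    have h4 := Finset.card_le_card this
    rw [Finset.card_product, ← Set.ncard_eq_toFinset_card _ (h.finite J), Finset.card_univ,
      Fintype.card_fin] at h4
    have := hK J
    nlinarith
  obtain ⟨p1, p2, p3⟩ := h.pick_spec J
  have hC0 : 0 ≤ C := (norm_nonneg _).trans (hC _ p1 _ p1 p2 p2 rfl)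
  calc _ ≤ ∑ e ∈ h.top J, Cφ * (2 * C + 2 * Cg) := by
        refine norm_sum_le_of_le _ fun e he => ?_
        obtain ⟨h1, h2, h3⟩ := hlay e he
        obtain ⟨c1, -, -⟩ := hCφ e.1 (h.k_lt _ h1) e.2
        obtain ⟨-, c2, c3⟩ := hCg e.1 (h.k_lt _ h1) e.2
        have c4 := hC _ h1 _ p1 h2 p2 (h3.trans p3.symm)
        rw [norm_mul]
        refine mul_le_mul c1 ?_ (norm_nonneg _) hCφ0
        have a1 : g (e.1.src e.2 - (h.pick J).x) =
          g (e.1.src e.2 - e.1.x) + g (e.1.x - (h.pick J).x) := by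
          rw [← map_add]; congr 1; abel
        have a2 : g (e.1.tgt e.2 - (h.pick J).x) =
          g (e.1.tgt e.2 - e.1.x) + g (e.1.x - (h.pick J).x) := by
          rw [← map_add]; congr 1; abel
        rw [a1, a2]
        refine (norm_add_le _ _).trans ?_
        linarith [norm_add_le (g (e.1.src e.2 - e.1.x)) (g (e.1.x - (h.pick J).x)),
          norm_add_le (g (e.1.tgt e.2 - e.1.x)) (g (e.1.x - (h.pick J).x))]
    _ ≤ _ := by
        rw [Finset.sum_const, nsmul_eq_mul]
        refine mul_le_mul_of_nonneg_right ?_ (by positivity)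
        exact_mod_cast hcard

omit h in
lemma eq_zero_of_norm_form (N : ℕ) : ∀ m n p q : ℤ, m.natAbs + n.natAbs ≤ N →
    m ^ 2 + m * n + n ^ 2 = 2 * (p ^ 2 + p * q + q ^ 2) → m = 0 ∧ n = 0 := by
  have key : ∀ m n p : ℤ, m ^ 2 + m * n + n ^ 2 = 2 * p → ∃ a b, m = 2 * a ∧ n = 2 * b := by
    intro m n p h
    rcases Int.even_or_odd' m with ⟨a, rfl | rfl⟩ <;> rcases Int.even_or_odd' n with ⟨b, rfl | rfl⟩
    · exact ⟨a, b, rfl, rfl⟩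
    all_goals (ring_nf at h; omega)
  induction N using Nat.strong_induction_on with
  | _ N ih =>
    intro m n p q hN h
    obtain ⟨a, b, rfl, rfl⟩ := key _ _ _ h
    obtain ⟨c, d, rfl, rfl⟩ := key p q (a ^ 2 + a * b + b ^ 2) (by linarith)
    by_cases h0 : a = 0 ∧ b = 0
    · simp [h0]
    · have := ih (a.natAbs + b.natAbs) (by omega) a b c d le_rfl (by linarith)
      exact absurd this h0

omit h in
/-- The two components of the positions, as homomorphisms. -/
lemma exists_homs : ∃ gA gB gA' gB' : V →+ ℂ, (∀ x, gA x = eis (eA x)) ∧ (∀ x, gB x = eis (eB x)) ∧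
    (∀ x, gA' x = eis (econj (eA x))) ∧ ∀ x, gB' x = eis (econj (eB x)) :=
  ⟨AddMonoidHom.mk' (fun x => eis (eA x)) fun x y => by rw [eA_add, eis_add],
   AddMonoidHom.mk' (fun x => eis (eB x)) fun x y => by rw [eB_add, eis_add],
   AddMonoidHom.mk' (fun x => eis (econj (eA x))) fun x y => by rw [eA_add, econj_add, eis_add],
   AddMonoidHom.mk' (fun x => eis (econj (eB x))) fun x y => by rw [eB_add, econj_add, eis_add],
   fun _ => rfl, fun _ => rfl, fun _ => rfl, fun _ => rfl⟩

lemma not_bdd_card : ¬Bdd fun J => ((h.region J).card : ℂ) := by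
  rintro ⟨C, hC⟩
  obtain ⟨J, hJ⟩ := exists_nat_gt C
  have h1 := hC J
  have h2 : ((J + 1 : ℕ) : ℝ) ≤ (h.region J).card := by exact_mod_cast h.le_card_region J
  rw [norm_natCast] at h1
  push_cast at h2
  linarith

omit h in
lemma normSq_eq_of_bdd {A B a₁ a₂ a₃ : ℂ} {x y b₁ b₂ b₃ n P Q : ℕ → ℂ} (ha₃ : a₃.im = 0)
    (hb₃ : ∀ J, (b₃ J).im = 0) (hn : ¬Bdd n) (hnr : ∀ J, (n J).im = 0)
    (hAA : Bdd fun J => A * b₁ J + a₁ * x J)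
    (hAA' : Bdd fun J => 8 * (r3 * I) * n J - (conj A * b₁ J + a₁ * conj (x J)))
    (hBB : Bdd fun J => B * b₂ J + a₂ * y J)
    (hBB' : Bdd fun J => 4 * (r3 * I) * n J - (conj B * b₂ J + a₂ * conj (y J)))
    (hCB : Bdd fun J => B * b₃ J + a₃ * y J)
    (hCA : Bdd fun J => P J - (A * b₃ J + a₃ * x J))
    (hAB : Bdd fun J => r3 * I * conj (P J) - (B * b₁ J + a₁ * y J))
    (hAB' : Bdd fun J => -conj (Q J) - (conj B * b₁ J + a₁ * conj (y J)))
    (hBA' : Bdd fun J => Q J - (conj A * b₂ J + a₂ * conj (x J))) :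
    A ≠ 0 ∧ normSq A = 2 * normSq B := by
  have hr : (r3 : ℂ) * I ≠ 0 := mul_ne_zero (by exact_mod_cast r3_pos.ne') I_ne_zero
  have hnc : ∀ J, conj (n J) = n J := fun J => conj_eq_iff_im.2 (hnr J)
  have hbc : ∀ J, conj (b₃ J) = b₃ J := fun J => conj_eq_iff_im.2 (hb₃ J)
  have hac : conj a₃ = a₃ := conj_eq_iff_im.2 ha₃
  have ne_zero : ∀ {A a : ℂ} {b x : ℕ → ℂ} {c : ℂ}, c ≠ 0 → (Bdd fun J => A * b J + a * x J) →
      (Bdd fun J => c * n J - (conj A * b J + a * conj (x J))) → A ≠ 0 := by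
    rintro A a b x c hc h1 h2 rfl
    refine hn.elim ?_
    by_cases ha : a = 0
    · refine (h2.mul c⁻¹).congr fun J => ?_
      rw [ha, map_zero]; field_simp; ring
    · have ha' : conj a ≠ 0 := by simpa using ha
      refine ((h2.mul c⁻¹).add (h1.conj.mul (c⁻¹ * a / conj a))).congr fun J => ?_
      simp only [map_add, map_mul, map_zero]
      field_simp; ring
  have hA := ne_zero (mul_ne_zero (by norm_num) hr) hAA hAA'
  have hB := ne_zero (mul_ne_zero (by norm_num) hr) hBB hBB'
  have hA' : conj A ≠ 0 := by simpa using hA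
  have hB' : conj B ≠ 0 := by simpa using hB
  set σ : ℕ → ℂ := fun J => x J / A - conj (x J / A) with hσ
  set τ : ℕ → ℂ := fun J => y J / B - conj (y J / B) with hτ
  have hσn : Bdd fun J => 8 * (r3 * I) * n J + a₁ * conj A * σ J := by
    refine (hAA'.add (hAA.mul (conj A / A))).congr fun J => ?_
    simp only [hσ, map_div₀]; field_simp; ring
  have hτn : Bdd fun J => 4 * (r3 * I) * n J + a₂ * conj B * τ J := by
    refine (hBB'.add (hBB.mul (conj B / B))).congr fun J => ?_
    simp only [hτ, map_div₀]; field_simp; ring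
  have unb : ∀ {σ : ℕ → ℂ} {c ρ : ℂ}, c ≠ 0 → (Bdd fun J => c * n J + ρ * σ J) → ¬Bdd σ := by
    intro σ c ρ hc h1 h2
    refine hn (((h1.add (h2.mul (-ρ))).mul c⁻¹).congr fun J => ?_)
    field_simp; ring
  have hσu := unb (mul_ne_zero (by norm_num) hr) hσn
  have hτu := unb (mul_ne_zero (by norm_num) hr) hτn
  have ha₁ : a₁ ≠ 0 := by
    rintro rfl
    refine hn ((hσn.mul (8 * (r3 * I))⁻¹).congr fun J => ?_)
    field_simp; ring
  have h3 : a₃ = 0 := by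
    refine Bdd.eq_zero hτu (((hCB.mul B⁻¹).add ((hCB.mul B⁻¹).conj.mul (-1))).congr fun J => ?_)
    simp only [hτ, map_add, map_mul, map_inv₀, map_div₀, hbc, hac]
    field_simp; ring
  subst h3
  have hP : Bdd P := (hCA.add (hCB.mul (A / B))).congr fun J => by field_simp; ring
  have hXY : Bdd fun J => x J / A - y J / B := by
    refine (((hAB.add (hP.conj.mul (-(r3 * I)))).add (hAA.mul (B / A))).mul
      (a₁ * B)⁻¹).congr fun J => ?_
    field_simp; ring
  have hστ : Bdd fun J => σ J - τ J := (hXY.add (hXY.conj.mul (-1))).congr fun J => by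
    simp only [hσ, hτ, map_sub]; ring
  have hρ : a₁ * conj A - 2 * (a₂ * conj B) = 0 := by
    refine Bdd.eq_zero hσu (((hσn.add (hτn.mul (-2))).add (hστ.mul (-2 * (a₂ * conj B)))).congr
      fun J => ?_)
    ring
  have hreal : conj a₂ * B - a₂ * conj B = 0 := by
    refine Bdd.eq_zero hτu (((hτn.add hτn.conj).mul (-1)).congr fun J => ?_)
    simp only [hτ, map_add, map_sub, map_mul, conj_conj, conj_I, conj_ofReal, map_ofNat, hnc]
    ring
  have hQ : a₁ * conj B - conj a₂ * A = 0 := by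
    have h1 : Bdd fun J => -conj (Q J) + a₁ * conj B * σ J := by
      refine ((hAB'.add (hAA.mul (conj B / A))).add (hXY.conj.mul (-a₁ * conj B))).congr
        fun J => ?_
      simp only [hσ, map_sub, map_div₀]; field_simp; ring
    have h2 : Bdd fun J => Q J + a₂ * conj A * σ J := by
      refine ((hBA'.add (hBB.mul (conj A / B))).add (hXY.mul (a₂ * conj A))).congr fun J => ?_
      simp only [hσ, map_div₀]; field_simp; ring
    refine Bdd.eq_zero hσu ((h1.add h2.conj).congr fun J => ?_)
    simp only [hσ, map_add, map_sub, map_mul, conj_conj]; ring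
  refine ⟨hA, ?_⟩
  have ha₂ : a₂ ≠ 0 := by
    rintro rfl
    simp [ha₁, hA] at hρ
  have : (A * conj A : ℂ) = 2 * (B * conj B) := by
    refine mul_left_cancel₀ (mul_ne_zero ha₂ hB') ?_
    linear_combination B * conj B * hρ - conj A * B * hQ - A * conj A * hreal
  rw [mul_conj, mul_conj] at this
  exact_mod_cast this

lemma false : False := by
  obtain ⟨gA, gB, gA', gB', hgA, hgB, hgA', hgB'⟩ := exists_homs
  obtain ⟨b1, a1, -, E1⟩ := h.exists_expansion _ isForm_A fun w => by
    simp [eis, eA]; ring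
  obtain ⟨b2, a2, -, E2⟩ := h.exists_expansion _ isForm_B fun w => by
    simp [eis, eB]; ring
  obtain ⟨b3, a3, hre, E3⟩ := h.exists_expansion _ isForm_C fun w => by
    simp [eis, eC]; ring
  obtain ⟨ha3, hb3⟩ := hre fun w => by
    rw [eC, eis, Int.cast_zero, zero_mul, add_zero, intCast_im]
  obtain ⟨C, hC⟩ := h.lip
  have lA : ∃ C, ∀ t ∈ T, ∀ t' ∈ T, col t = 0 → col t' = 0 → lay t = lay t' →
      ‖gA (t.x - t'.x)‖ ≤ C := ⟨C, fun t ht t' ht' h1 h2 h3 => by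
    rw [hgA]; exact (hC t ht t' ht' h1 h2 h3).1⟩
  have lB : ∃ C, ∀ t ∈ T, ∀ t' ∈ T, col t = 0 → col t' = 0 → lay t = lay t' →
      ‖gB (t.x - t'.x)‖ ≤ C := ⟨C, fun t ht t' ht' h1 h2 h3 => by
    rw [hgB]; exact (hC t ht t' ht' h1 h2 h3).2⟩
  have lA' : ∃ C, ∀ t ∈ T, ∀ t' ∈ T, col t = 0 → col t' = 0 → lay t = lay t' →
      ‖gA' (t.x - t'.x)‖ ≤ C := ⟨C, fun t ht t' ht' h1 h2 h3 => by
    rw [hgA', eis_conj, RCLike.norm_conj]; exact (hC t ht t' ht' h1 h2 h3).1⟩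
  have lB' : ∃ C, ∀ t ∈ T, ∀ t' ∈ T, col t = 0 → col t' = 0 → lay t = lay t' →
      ‖gB' (t.x - t'.x)‖ ≤ C := ⟨C, fun t ht t' ht' h1 h2 h3 => by
    rw [hgB', eis_conj, RCLike.norm_conj]; exact (hC t ht t' ht' h1 h2 h3).2⟩
  have aA' : ∀ x y, econj (eA (x + y)) = econj (eA x) + econj (eA y) := fun x y => by
    rw [eA_add, econj_add]
  have aB' : ∀ x y, econj (eB (x + y)) = econj (eB x) + econj (eB y) := fun x y => by
    rw [eB_add, econj_add]
  have key : ∀ {φ g : V → ℤ × ℤ}, (IsForm fun x => eis (φ x)) → (∀ x y, g (x + y) = g x + g y) →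
      ∀ J, ∑ t ∈ h.region J, cup (fun x => eis (φ x)) (fun x => eis (g x)) t =
        ∑ t ∈ h.region J, eis (ecup φ g t.s t.k) := fun hφ hg J =>
    Finset.sum_congr rfl fun t ht => cup_eis hφ hg t (h.k_lt t (h.mem_region.1 ht).1)
  have val := fun J => fun t ht => ecup_values t.s t.k (h.k_lt t (h.mem_region (J := J).1 ht).1)
  have fA : ⇑gA = fun x => eis (eA x) := funext hgA
  have fB : ⇑gB = fun x => eis (eB x) := funext hgB
  have fA' : ⇑gA' = fun x => eis (econj (eA x)) := funext hgA'
  have fB' : ⇑gB' = fun x => eis (econj (eB x)) := funext hgB'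
  have cA : ∀ x, gA' x = conj (gA x) := fun x => by rw [hgA, hgA', eis_conj]
  have cB : ∀ x, gB' x = conj (gB x) := fun x => by rw [hgB, hgB', eis_conj]
  have e0 : eis 0 = 0 := by simp [eis]
  have en : ∀ a, eis (-a) = -eis a := fun a => by simp [eis]; ring
  have e8 : eis (8, 0) = 8 := by simp [eis]
  have e4 : eis (4, 0) = 4 := by simp [eis]
  have AA := E1 gA lA
  have AB := E1 gB lB
  have AA' := E1 gA' lA'
  have AB' := E1 gB' lB'
  have BB := E2 gB lB
  have BB' := E2 gB' lB'
  have BA' := E2 gA' lA'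
  have CB := E3 gB lB
  have CA := E3 gA lA
  simp only [cA, cB] at AA AB AA' AB' BB BB' BA' CB CA
  rw [fA] at AA CA
  rw [fB] at AB BB CB
  rw [fA'] at AA' BA'
  rw [fB'] at AB' BB'
  simp only [key isForm_A eA_add] at AA
  simp only [key isForm_A eB_add] at AB
  simp only [key (g := fun x => econj (eA x)) isForm_A aA'] at AA'
  simp only [key (g := fun x => econj (eB x)) isForm_A aB'] at AB'
  simp only [key isForm_B eB_add] at BB
  simp only [key (g := fun x => econj (eB x)) isForm_B aB'] at BB'
  simp only [key (g := fun x => econj (eA x)) isForm_B aA'] at BA'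
  simp only [key isForm_C eB_add] at CB
  simp only [key isForm_C eA_add] at CA
  obtain ⟨hA, hN⟩ := normSq_eq_of_bdd (A := gA v) (B := gB v) (a₁ := a1) (a₂ := a2) (b₁ := b1)
    (b₂ := b2) (x := fun J => gA (h.pick J).x) (y := fun J => gB (h.pick J).x)
    (n := fun J => (h.region J).card) (P := fun J => ∑ t ∈ h.region J, eis (ecup eC eA t.s t.k))
    (Q := fun J => ∑ t ∈ h.region J, eis (ecup eB (fun x => econj (eA x)) t.s t.k))
    ha3 hb3 h.not_bdd_card (fun J => natCast_im _) ((AA.mul (-1)).congr fun J => by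
      rw [Finset.sum_congr rfl fun t ht => by rw [(val J t ht).1]]; simp [e0, fA])
    (AA'.congr fun J => by
      rw [Finset.sum_congr rfl fun t ht => by rw [(val J t ht).2.2.2.1, eis_mul, e8,
        eis_eisenstein], Finset.sum_const, nsmul_eq_mul]
      simp only [fA]; ring)
    ((BB.mul (-1)).congr fun J => by
      rw [Finset.sum_congr rfl fun t ht => by rw [(val J t ht).2.1]]; simp [e0, fB])
    (BB'.congr fun J => by
      rw [Finset.sum_congr rfl fun t ht => by rw [(val J t ht).2.2.2.2.1, eis_mul, e4,
        eis_eisenstein], Finset.sum_const, nsmul_eq_mul]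
      simp only [fB]; ring)
    ((CB.mul (-1)).congr fun J => by
      rw [Finset.sum_congr rfl fun t ht => by rw [(val J t ht).2.2.1]]; simp [e0, fB])
    (CA.congr fun J => by simp only [fA])
    (AB.congr fun J => by
      rw [Finset.sum_congr rfl fun t ht => by rw [(val J t ht).2.2.2.2.2.1, eis_mul, eis_conj,
        eis_eisenstein], ← Finset.mul_sum, map_sum]
      simp only [fB])
    (AB'.congr fun J => by
      rw [Finset.sum_congr rfl fun t ht => by rw [(val J t ht).2.2.2.2.2.2, en, eis_conj],
        Finset.sum_neg_distrib, map_sum])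
    (BA'.congr fun J => by simp only [fA])
  have e : ∀ a : ℤ × ℤ, normSq (eis a) = ((a.1 ^ 2 + a.1 * a.2 + a.2 ^ 2 : ℤ) : ℝ) := by
    intro a
    simp only [eis, om, normSq_apply]
    simp
    linear_combination a.2 ^ 2 / 4 * r3_sq
  rw [hgA, hgB, e, e] at hN
  obtain ⟨h1, h2⟩ := eq_zero_of_norm_form _ _ _ _ _ le_rfl (by exact_mod_cast hN)
  apply hA
  rw [hgA, eis, h1, h2]
  simp

end Strip

lemma om_inv_pow (k : ℕ) (z : ℂ) : om ^ k * (om⁻¹ ^ k * z) = z := by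
  rw [← mul_assoc, ← mul_pow, mul_inv_cancel₀ om_ne_zero, one_pow, one_mul]

/-- The placement as an isometry. -/
def Pl.toIso (β : ℝ) (t : Pl) : ℂ ≃ᵢ ℂ :=
  IsometryEquiv.mk' (t.iso β)
    (fun z => if t.s then conj (om⁻¹ * (om⁻¹ ^ t.k * (z - zpt β t.x)))
      else om⁻¹ ^ t.k * (z - zpt β t.x))
    (fun z => by
      rw [Pl.iso]
      split_ifs
      · rw [conj_conj, mul_inv_cancel_left₀ om_ne_zero, om_inv_pow]; ring
      · rw [om_inv_pow]; ring)
    (Isometry.of_dist_eq fun z w => by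
      rw [Pl.iso, Pl.iso, dist_add_right, dist_eq, ← mul_sub, norm_mul, norm_pow, norm_om, one_pow,
        one_mul]
      split_ifs
      · rw [← mul_sub, norm_mul, norm_om, one_mul, ← map_sub, RCLike.norm_conj, dist_eq]
      · rw [dist_eq])

@[simp] lemma Pl.toIso_apply (β : ℝ) (t : Pl) (z : ℂ) : t.toIso β z = t.iso β z := rfl

lemma Pl.toIso_vt (β : ℝ) (t : Pl) (i : Fin 14) : t.toIso β (vt β i) = zpt β (t.vert i) := by
  rw [toIso_apply, vt, Pl.vert, zpt_act]

lemma std_iff {β : ℝ} {g : ℂ ≃ᵢ ℂ} : Std β g ↔ ∃ t : Pl, t.k < 6 ∧ t.toIso β = g :=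
  ⟨fun ⟨t, h1, h2⟩ => ⟨t, h1, DFunLike.ext' h2.symm⟩, fun ⟨t, h1, h2⟩ => ⟨t, h1, by rw [← h2]; rfl⟩⟩

lemma lin_determined : ∀ s s' : Bool, ∀ k k' : Fin 6,
    lin s k (1, 0, 0, 0) = lin s' k' (1, 0, 0, 0) →
    lin s k (0, 1, 0, 0) = lin s' k' (0, 1, 0, 0) → s = s' ∧ k = k' := by
  decide +kernel

lemma Pl.toIso_inj {β : ℝ} (hβ : Irrational β) {t t' : Pl} (ht : t.k < 6) (ht' : t'.k < 6)
    (h : t.toIso β = t'.toIso β) : t = t' := by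
  have hact : ∀ y, t.act y = t'.act y := fun y => zpt_injective hβ (by
    rw [zpt_act, zpt_act]; exact congrArg (fun g : ℂ ≃ᵢ ℂ => g (zpt β y)) h)
  have l0 : ∀ s k, lin s k 0 = 0 := fun s k => by simpa using lin_add s k 0 0
  have hx : t.x = t'.x := by simpa [Pl.act, l0] using hact 0
  have hl : ∀ y, lin t.s t.k y = lin t'.s t'.k y := fun y => by
    simpa [Pl.act, hx] using hact y
  obtain ⟨h1, h2⟩ := lin_determined _ _ ⟨_, ht⟩ ⟨_, ht'⟩ (hl _) (hl _)
  exact Pl.ext h1 (congrArg Fin.val h2) hx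

/-- Positive to the left of the line from `a` to `b`. -/
def lft (a b z : ℂ) : ℝ := ((z - a) * conj (b - a)).im

lemma lft_swap (a b z : ℂ) : lft b a z = -lft a b z := by
  simp only [lft, mul_im, sub_re, sub_im, conj_re, conj_im, map_sub]; ring

lemma lft_iso (β : ℝ) (t : Pl) (a b z : ℂ) :
    lft (t.iso β a) (t.iso β b) (t.iso β z) = if t.s then -lft a b z else lft a b z := by
  have hk : om ^ t.k * conj (om ^ t.k) = 1 := by
    rw [mul_conj, map_pow, om_normSq, one_pow, ofReal_one]
  have h1 : om * conj om = 1 := by rw [mul_conj, om_normSq, ofReal_one]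
  simp only [lft, Pl.iso, add_sub_add_right_eq_sub]
  split_ifs
  · have : (om ^ t.k * (om * conj z) - om ^ t.k * (om * conj a)) *
        conj (om ^ t.k * (om * conj b) - om ^ t.k * (om * conj a)) = conj ((z - a) * conj (b - a)) := by
      simp only [map_sub, map_mul, conj_conj] at hk ⊢
      linear_combination (conj z - conj a) * (b - a) * (om * conj om * hk + h1)
    rw [this, conj_im]
  · congr 1
    simp only [map_sub, map_mul] at hk ⊢
    linear_combination (z - a) * (conj b - conj a) * hk

lemma sd_eq_lft (d : Fin 12) : ∃ c > 0, ∀ w, sd d w = c * (w * conj (Z d)).im := by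
  have h := r3_sq
  have h0 := r3_pos
  refine ⟨![1 / r3, 2, 2 / r3, 1, 2 / r3, 2, 1 / r3, 2, 2 / r3, 1, 2 / r3, 2] d, ?_, fun w => ?_⟩
  · fin_cases d <;> simp
  · have h2 : w.im / r3 = r3 * w.im / 3 := by
      rw [div_eq_iff h0.ne']; linear_combination (-w.im / 3) * h
    have h3 : r3⁻¹ = r3 / 3 := by field_simp; linarith
    fin_cases d <;> simp [sd, cX, cY, Z_val, yc, h2, h3, div_eq_mul_inv] <;>
      first
      | ring1
      | linear_combination (w.re / 3) * h
      | linear_combination (-w.re / 3) * h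

lemma ln_rep (β : ℝ) (i : Fin 14) (z : ℂ) : ln β (rep i) z = ln β i z := by
  rw [rep]; split_ifs with h
  · rw [h, ln2, ln3]
  · rfl

/-- The prototile lies to the left of its edges. -/
lemma tile_near_edge {β : ℝ} (hβ : Adm β) (i : Fin 14) {s : ℝ} (hs : s ∈ Set.Ioo (0 : ℝ) 1) :
    ∀ᶠ z in 𝓝 (vt β i + s * (vt β (i + 1) - vt β i)),
      z ∈ tile β ↔ 0 ≤ lft (vt β i) (vt β (i + 1)) z := by
  have h := germ_edge hβ.1 i hs
  rw [segpt_eq] at h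
  filter_upwards [h] with z hz
  obtain ⟨c, hc, hcs⟩ := sd_eq_lft (dir i)
  have hl := len_pos hβ (dir i)
  rw [hz, ln_rep, ln, hcs, lft, vt_succ_sub, map_mul, conj_ofReal, mul_left_comm, im_ofReal_mul,
    mul_nonneg_iff_of_pos_left hc, mul_nonneg_iff_of_pos_left hl, vt]

/-- Tiles lie to the left of their edges. -/
lemma near_edge {β : ℝ} (hβ : Adm β) (t : Pl) (i : Fin 14) {s : ℝ} (hs : s ∈ Set.Ioo (0 : ℝ) 1) :
    ∀ᶠ z in 𝓝 (zpt β (t.src i) + s * (zpt β (t.tgt i) - zpt β (t.src i))),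
      z ∈ t.toIso β '' tile β ↔ 0 ≤ lft (zpt β (t.src i)) (zpt β (t.tgt i)) z := by
  have key : ∀ {r : ℝ}, r ∈ Set.Ioo (0 : ℝ) 1 →
      ∀ᶠ z in 𝓝 (t.toIso β (vt β i + r * (vt β (i + 1) - vt β i))),
        z ∈ t.toIso β '' tile β ↔ 0 ≤ lft (vt β i) (vt β (i + 1)) ((t.toIso β).symm z) := by
    intro r hr
    have := (t.toIso β).symm.continuous.tendsto (t.toIso β (vt β i + r * (vt β (i + 1) - vt β i)))
    rw [IsometryEquiv.symm_apply_apply] at this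
    filter_upwards [this.eventually (tile_near_edge hβ i hr)] with z hz
    rw [mem_image_iff, hz]
  have hl : ∀ z, lft (zpt β (t.vert i)) (zpt β (t.vert (i + 1))) z =
      if t.s then -lft (vt β i) (vt β (i + 1)) ((t.toIso β).symm z)
        else lft (vt β i) (vt β (i + 1)) ((t.toIso β).symm z) := by
    intro z
    rw [← t.toIso_vt, ← t.toIso_vt, ← lft_iso β, ← t.toIso_apply, ← t.toIso_apply,
      ← t.toIso_apply, IsometryEquiv.apply_symm_apply]
  have hp : ∀ r : ℝ, t.toIso β (vt β i + r * (vt β (i + 1) - vt β i)) =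
      zpt β (t.vert i) + r * (zpt β (t.vert (i + 1)) - zpt β (t.vert i)) := by
    intro r
    rw [iso_add, lp_mul, lp_apply, t.toIso_vt, t.toIso_vt]
  by_cases h : t.s
  · have h1 := key (r := 1 - s) ⟨by linarith [hs.2], by linarith [hs.1]⟩
    rw [hp] at h1
    simp only [Pl.src, Pl.tgt, h, if_true] at hl ⊢
    have e : zpt β (t.vert (i + 1)) + s * (zpt β (t.vert i) - zpt β (t.vert (i + 1))) =
        zpt β (t.vert i) + ↑(1 - s) * (zpt β (t.vert (i + 1)) - zpt β (t.vert i)) := by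
      push_cast; ring
    rw [e]
    filter_upwards [h1] with z hz
    rw [hz, lft_swap (zpt β (t.vert i)), hl, neg_neg]
  · have h1 := key hs
    rw [hp] at h1
    simp only [Pl.src, Pl.tgt, h, Bool.false_eq_true, if_false] at hl ⊢
    filter_upwards [h1] with z hz
    rw [hz, hl]

lemma succ_ne : ∀ i : Fin 14, i + 1 ≠ i := by decide

lemma succ_succ_ne : ∀ i j : Fin 14, i + 1 = j → j + 1 ≠ i := by decide

section
variable {β : ℝ} (hβ : Adm β)
include hβ

lemma Pl.vert_injective (t : Pl) : Function.Injective t.vert := fun i j h =>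
  vt_injective hβ <| (t.toIso β).injective <| by rw [t.toIso_vt, t.toIso_vt, h]

lemma Pl.src_ne_tgt (t : Pl) (i : Fin 14) : t.src i ≠ t.tgt i := by
  unfold Pl.src Pl.tgt
  intro h
  have := t.vert_injective hβ h
  split_ifs at this
  · exact absurd this (succ_ne i)
  · exact absurd this.symm (succ_ne i)

lemma Pl.not_opp (t : Pl) (i j : Fin 14) : ¬Opp (t, i) (t, j) := by
  rintro ⟨h1, h2⟩
  simp only [Pl.src, Pl.tgt] at h1 h2
  have h1 := t.vert_injective hβ h1
  have h2 := t.vert_injective hβ h2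
  split_ifs at h1 h2
  · exact succ_succ_ne j i h1 h2.symm
  · exact succ_succ_ne j i h2 h1.symm

omit hβ in
lemma Pl.edge (t : Pl) (i : Fin 14) :
    Edge β (t.toIso β) (zpt β (t.src i)) (zpt β (t.tgt i)) ∨
      Edge β (t.toIso β) (zpt β (t.tgt i)) (zpt β (t.src i)) := by
  unfold Edge Pl.src Pl.tgt
  rw [← t.toIso_vt, ← t.toIso_vt, IsometryEquiv.symm_apply_apply, IsometryEquiv.symm_apply_apply]
  split_ifs
  · exact (edge₀_succ β i).symm
  · exact edge₀_succ β i

omit hβ in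
lemma Pl.exists_of_edge {t : Pl} {q p : ℂ} (h : Edge β (t.toIso β) q p) :
    ∃ i, (q = zpt β (t.src i) ∧ p = zpt β (t.tgt i)) ∨
      (p = zpt β (t.src i) ∧ q = zpt β (t.tgt i)) := by
  obtain ⟨i, hi⟩ := Edge₀.exists_succ h
  refine ⟨i, ?_⟩
  simp only [IsometryEquiv.symm_apply_eq, t.toIso_vt] at hi
  unfold Pl.src Pl.tgt
  split_ifs
  · exact hi.symm.imp And.symm And.symm
  · exact hi

lemma inter_interior (t t' : Pl) (i j : Fin 14) (h1 : t'.src j = t.src i)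
    (h2 : t'.tgt j = t.tgt i) :
    ¬Disjoint (interior (t.toIso β '' tile β)) (interior (t'.toIso β '' tile β)) := by
  have hs : (1 / 2 : ℝ) ∈ Set.Ioo (0 : ℝ) 1 := by norm_num
  have a1 := (near_edge hβ t i hs).eventually_nhds
  have a2 := (near_edge hβ t' j hs).eventually_nhds
  rw [h1, h2] at a2
  set q := zpt β (t.src i)
  set p := zpt β (t.tgt i)
  have hqp : p - q ≠ 0 := sub_ne_zero.2 fun e => t.src_ne_tgt hβ i (zpt_injective hβ.2 e.symm)
  set m := q + ((1 / 2 : ℝ) : ℂ) * (p - q)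
  have hc : Tendsto (fun r : ℝ => m + r * (I * (p - q))) (𝓝[>] 0) (𝓝 m) := by
    have : Continuous fun r : ℝ => m + r * (I * (p - q)) := by fun_prop
    simpa using (this.tendsto 0).mono_left (nhdsWithin_le_nhds (s := Set.Ioi 0))
  obtain ⟨r, ⟨b1, b2⟩, hr⟩ := ((hc.eventually a1).and
    (hc.eventually a2) |>.and (self_mem_nhdsWithin (s := Set.Ioi 0))).exists
  have hl : 0 < lft q p (m + r * (I * (p - q))) := by
    have : lft q p (m + r * (I * (p - q))) = r * normSq (p - q) := by
      simp only [lft, m, normSq_apply]; simp; ring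
    rw [this]
    exact mul_pos hr (normSq_pos.2 hqp)
  have hcont : Continuous (lft q p) := by unfold lft; fun_prop
  have hev := hcont.continuousAt.eventually (lt_mem_nhds hl)
  rw [Set.not_disjoint_iff]
  refine ⟨m + r * (I * (p - q)), mem_interior_iff_mem_nhds.2 ?_,
    mem_interior_iff_mem_nhds.2 ?_⟩
  · filter_upwards [b1, hev] with z hz h
    exact hz.2 h.le
  · filter_upwards [b2, hev] with z hz h
    exact hz.2 h.le

variable {S : Set (ℂ ≃ᵢ ℂ)} (hS : Til β S) (hstd : ∀ g ∈ S, Std β g)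
include hS hstd

lemma exists_opp {t : Pl} (hk6 : t.k < 6) (ht : t.toIso β ∈ S) (i : Fin 14) :
    ∃! e : Pl × Fin 14, (e.1.k < 6 ∧ e.1.toIso β ∈ S) ∧ Opp (t, i) e := by
  have key : ∀ q p, Edge β (t.toIso β) q p → (q = zpt β (t.src i) ∧ p = zpt β (t.tgt i)) ∨
      (p = zpt β (t.src i) ∧ q = zpt β (t.tgt i)) →
      ∃! e : Pl × Fin 14, (e.1.k < 6 ∧ e.1.toIso β ∈ S) ∧ Opp (t, i) e := by
    intro q p hq hqp
    obtain ⟨h, hh, hne, hE⟩ := exists_mate hβ hS ht hq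
    obtain ⟨t', ht', rfl⟩ := std_iff.1 (hstd h hh)
    have hdis := hS.disj ht hh hne.symm
    obtain ⟨j, hj⟩ := Pl.exists_of_edge hE
    have hopp : Opp (t, i) (t', j) := by
      have inj := zpt_injective hβ.2
      rcases hqp with ⟨a1, a2⟩ | ⟨a1, a2⟩ <;> rcases hj with ⟨b1, b2⟩ | ⟨b1, b2⟩
      · exact absurd hdis (inter_interior hβ _ _ i j (inj (b1.symm.trans a1)) (inj (b2.symm.trans a2)))
      · exact ⟨inj (b1.symm.trans a2), inj (b2.symm.trans a1)⟩
      · exact ⟨inj (b1.symm.trans a2), inj (b2.symm.trans a1)⟩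
      · exact absurd hdis (inter_interior hβ _ _ i j (inj (b1.symm.trans a1)) (inj (b2.symm.trans a2)))
    refine ⟨(t', j), ⟨⟨ht', hh⟩, hopp⟩, ?_⟩
    rintro ⟨t'', j'⟩ ⟨⟨hk, h3⟩, h4⟩
    have hE' : Edge β (t''.toIso β) q p ∨ Edge β (t''.toIso β) p q := by
      have := Pl.edge (β := β) t'' j'
      rw [h4.1, h4.2] at this
      rcases hqp with ⟨a1, a2⟩ | ⟨a1, a2⟩ <;> rw [a1, a2]
      · exact this.symm
      · exact this
    have h6 : ct β (t''.toIso β) (q + ((1 / 2 : ℝ) : ℂ) * (p - q)) ≠ 0 := by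
      rcases hE' with h | h
      · rw [h.ct_open hβ (by norm_num)]; decide
      · have := h.ct_open hβ (t := 1 / 2) (by norm_num)
        rw [show q + ((1 / 2 : ℝ) : ℂ) * (p - q) = p + ((1 / 2 : ℝ) : ℂ) * (q - p) by
          push_cast; ring, this]; decide
    rcases eq_or_eq_of_mate hβ hS ht hh hne.symm hq hE h3 (by norm_num) h6 with h | h
    · obtain rfl := Pl.toIso_inj hβ.2 hk hk6 h
      exact (Pl.not_opp hβ _ _ _ h4).elim
    · obtain rfl := Pl.toIso_inj hβ.2 hk ht' h
      have : t''.src j' = t''.src j := h4.1.trans hopp.1.symm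
      have := t''.vert_injective hβ this
      have : j' = j := by split_ifs at this <;> simpa using this
      rw [this]
  rcases Pl.edge (β := β) t i with h | h
  · exact key _ _ h (.inl ⟨rfl, rfl⟩)
  · exact key _ _ h (.inr ⟨rfl, rfl⟩)

omit hstd in
/-- Distinct tiles that meet share a vertex. -/
lemma exists_vert_eq {t t' : Pl} (hk : t.k < 6) (hk' : t'.k < 6) (ht : t.toIso β ∈ S)
    (ht' : t'.toIso β ∈ S) (hne : t ≠ t') {x : ℂ} (h1 : x ∈ t.toIso β '' tile β)
    (h2 : x ∈ t'.toIso β '' tile β) : ∃ i j, t.vert i = t'.vert j := by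
  have hne' : t.toIso β ≠ t'.toIso β := fun h => hne (Pl.toIso_inj hβ.2 hk hk' h)
  rw [← ct_ne_zero hβ] at h1 h2
  have hsum := sum_two_le hβ hS ht ht' hne' x
  have key : ∀ a b : Pl, a.k < 6 → b.k < 6 → a.toIso β ∈ S → b.toIso β ∈ S → a.toIso β ≠ b.toIso β →
      ct β (b.toIso β) x ≠ 0 → (∃ q p, Edge β (a.toIso β) q p ∧ ∃ s ∈ Set.Ioo (0 : ℝ) 1,
        x = q + s * (p - q)) → ∃ i j, a.vert i = b.vert j := by
    rintro a b ha hb haS hbS hab hbx ⟨q, p, hE, s, hs, rfl⟩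
    obtain ⟨h, hh, hne, hE'⟩ := exists_mate hβ hS haS hE
    rcases eq_or_eq_of_mate hβ hS haS hh hne.symm hE hE' hbS hs hbx with h5 | h5
    · exact absurd h5.symm hab
    · rw [← h5] at hE'
      obtain ⟨i, hi⟩ := Edge₀.exists_succ hE
      obtain ⟨j, hj⟩ := Edge₀.exists_succ hE'
      simp only [IsometryEquiv.symm_apply_eq, Pl.toIso_vt] at hi hj
      have inj := zpt_injective hβ.2
      rcases hi with ⟨a1, a2⟩ | ⟨a1, a2⟩ <;> rcases hj with ⟨b1, b2⟩ | ⟨b1, b2⟩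
      · exact ⟨_, _, inj (a1.symm.trans b1)⟩
      · exact ⟨_, _, inj (a2.symm.trans b1)⟩
      · exact ⟨_, _, inj (a2.symm.trans b1)⟩
      · exact ⟨_, _, inj (a1.symm.trans b1)⟩
  rcases Std.mem_edge hβ h1 (by omega) with ⟨i, hi⟩ | h
  · rcases Std.mem_edge hβ h2 (by omega) with ⟨j, hj⟩ | h'
    · rw [Pl.toIso_vt] at hi hj
      exact ⟨i, j, zpt_injective hβ.2 (hi.symm.trans hj)⟩
    · obtain ⟨i, j, h⟩ := key t' t hk' hk ht' ht hne'.symm h1 h'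
      exact ⟨j, i, h.symm⟩
  · exact key t t' hk hk' ht ht' hne' h2 h

end

/-- The formal placements of the tiles of `S`. -/
def places (β : ℝ) (S : Set (ℂ ≃ᵢ ℂ)) : Set Pl := {t | t.k < 6 ∧ t.toIso β ∈ S}

lemma exists_bound_vert (ψ : V →+ ℂ) : ∃ C, 0 ≤ C ∧ ∀ t t' : Pl, t.k < 6 → t'.k < 6 → ∀ i j,
    t.vert i = t'.vert j → ‖ψ (t.x - t'.x)‖ ≤ C := by
  obtain ⟨C, hC, h⟩ := exists_bound ψ
  have hv : ∀ t : Pl, t.k < 6 → ∀ i, ‖ψ (t.vert i - t.x)‖ ≤ C := by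
    intro t ht i
    by_cases hs : t.s
    · have := (h t ht i).2.2
      simpa [Pl.tgt, hs] using this
    · have := (h t ht i).2.1
      simpa [Pl.src, hs] using this
  refine ⟨C + C, by positivity, fun t t' ht ht' i j e => ?_⟩
  have e : t.x - t'.x = (t'.vert j - t'.x) - (t.vert i - t.x) := by rw [e]; abel
  rw [e, map_sub]
  exact (norm_sub_le _ _).trans (add_le_add (hv t' ht' j) (hv t ht i))

section
variable {β : ℝ} (hβ : Adm β)
include hβ

lemma exists_near_bound (ψ : V →+ ℂ) (r : ℝ) : ∃ C, ∀ S, Til β S → (∀ g ∈ S, Std β g) → ∀ p,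
    ∀ t ∈ places β S, ∀ t' ∈ places β S, dist (t.toIso β ctr) p ≤ r →
      dist (t'.toIso β ctr) p ≤ r → ‖ψ (t'.x - t.x)‖ ≤ C := by
  classical
  obtain ⟨D, hD, hrad⟩ := exists_radius hβ
  obtain ⟨N, hN⟩ := exists_card_le hβ (r + D)
  obtain ⟨C, hC, hv⟩ := exists_bound_vert ψ
  refine ⟨(N + 1 : ℕ) * C, fun S hS hstd p t ht t' ht' hd hd' => ?_⟩
  by_contra! hlt
  obtain ⟨hfin, hcard⟩ := hN S hS p
  have hcover : ∀ x, dist x p ≤ r → ∃ u ∈ places β S, x ∈ u.toIso β '' tile β ∧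
      u.toIso β ∈ hfin.toFinset := by
    intro x hx
    obtain ⟨g, hg, hgx⟩ := hS.cover x
    obtain ⟨u, hu, rfl⟩ := std_iff.1 (hstd g hg)
    refine ⟨u, ⟨hu, hg⟩, hgx, hfin.mem_toFinset.2 ⟨hg, ?_⟩⟩
    have := hrad _ _ hgx
    rw [dist_comm] at this
    linarith [dist_triangle (u.toIso β ctr) x p]
  obtain ⟨a, haN, ha⟩ : ∃ a ∈ Finset.range (N + 1), ∀ u ∈ places β S, u.toIso β ∈ hfin.toFinset →
      a * C < ‖ψ (u.x - t.x)‖ → (a + 1 : ℕ) * C < ‖ψ (u.x - t.x)‖ := by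
    by_contra! hcon
    have : Nonempty Pl := ⟨t⟩
    choose! u hu hu1 hu2 hu3 using hcon
    have hlt : hfin.toFinset.card < (Finset.range (N + 1)).card := by
      rw [← Set.ncard_eq_toFinset_card _ hfin, Finset.card_range]; omega
    obtain ⟨a, ha, b, hb, hab, e⟩ := Finset.exists_ne_map_eq_of_card_lt_of_maps_to hlt
      (f := fun a => (u a).toIso β) hu1
    have e := Pl.toIso_inj hβ.2 (hu a ha).1 (hu b hb).1 e
    have key : ∀ a ∈ Finset.range (N + 1), ∀ b ∈ Finset.range (N + 1), u a = u b → b ≤ a := by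
      intro a ha b hb e
      have h1 := (hu2 b hb).trans_le (e ▸ hu3 a ha)
      have := lt_of_mul_lt_mul_right h1 hC
      exact Nat.lt_succ_iff.1 (by exact_mod_cast this)
    exact hab (le_antisymm (key b hb a ha e.symm) (key a ha b hb e))
  let A : Set (ℂ ≃ᵢ ℂ) := {g | g ∈ S ∧ ∃ u : Pl, u.k < 6 ∧ u.toIso β = g ∧ ‖ψ (u.x - t.x)‖ ≤ a * C}
  let B : Set (ℂ ≃ᵢ ℂ) :=
    {g | g ∈ S ∧ ∃ u : Pl, u.k < 6 ∧ u.toIso β = g ∧ (a + 1 : ℕ) * C < ‖ψ (u.x - t.x)‖}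
  have hAc := isClosed_biUnion hβ hS (T := A) fun _ h => h.1
  have hBc := isClosed_biUnion hβ hS (T := B) fun _ h => h.1
  have hconn : IsPreconnected (Metric.closedBall p r) := (convex_closedBall p r).isPreconnected
  have := isPreconnected_closed_iff.1 hconn _ _ hAc hBc ?_ ⟨t.toIso β ctr, hd, ?_⟩
    ⟨t'.toIso β ctr, hd', ?_⟩
  · obtain ⟨x, -, hxA, hxB⟩ := this
    simp only [Set.mem_iUnion] at hxA hxB
    obtain ⟨_, ⟨hg, u, hu, rfl, huA⟩, hgx⟩ := hxA
    obtain ⟨_, ⟨hh, w, hw, rfl, hwB⟩, hhx⟩ := hxB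
    have hne : w ≠ u := by
      rintro rfl
      push_cast at hwB; nlinarith
    obtain ⟨i, j, e⟩ := exists_vert_eq hβ hS hw hu hh hg hne hhx hgx
    have h1 := hv w u hw hu i j e
    have h2 : ψ (w.x - t.x) = ψ (w.x - u.x) + ψ (u.x - t.x) := by rw [← map_add]; congr 1; abel
    have h3 := norm_add_le (ψ (w.x - u.x)) (ψ (u.x - t.x))
    rw [← h2] at h3
    push_cast at hwB
    linarith
  · intro x hx
    obtain ⟨u, hu, hux, huF⟩ := hcover x hx
    rcases le_or_gt ‖ψ (u.x - t.x)‖ (a * C) with h | h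
    · exact .inl (Set.mem_biUnion (show u.toIso β ∈ A from ⟨hu.2, u, hu.1, rfl, h⟩) hux)
    · exact .inr (Set.mem_biUnion (show u.toIso β ∈ B from ⟨hu.2, u, hu.1, rfl, ha u hu huF h⟩) hux)
  · refine Set.mem_biUnion (show t.toIso β ∈ A from ⟨ht.2, t, ht.1, rfl, ?_⟩)
      (interior_subset (image_ctr_mem hβ _))
    simp; positivity
  · refine Set.mem_biUnion (show t'.toIso β ∈ B from ⟨ht'.2, t', ht'.1, rfl, ?_⟩)
      (interior_subset (image_ctr_mem hβ _))
    refine lt_of_le_of_lt ?_ hlt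
    have : ((a + 1 : ℕ) : ℝ) ≤ (N + 1 : ℕ) := by
      exact_mod_cast Nat.succ_le_of_lt (Finset.mem_range.1 haN)
    exact mul_le_mul_of_nonneg_right this hC

end

lemma abs_floor_sub_le {a b : ℝ} (h : |a - b| ≤ 1) : |⌊a⌋ - ⌊b⌋| ≤ 1 := by
  rw [abs_le] at h ⊢
  have h1 : a ≤ b + 1 := by linarith
  have h2 : b ≤ a + 1 := by linarith
  have h1 := Int.floor_le_floor h1
  have h2 := Int.floor_le_floor h2
  rw [Int.floor_add_one] at h1 h2
  constructor <;> omega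

lemma Pl.shift_toIso (β : ℝ) (t : Pl) (x : V) (z : ℂ) :
    (t.shift x).toIso β z = t.toIso β z + zpt β x := by
  simp only [toIso_apply, Pl.iso, Pl.shift, zpt_add, add_assoc]

lemma zpt_zsmul (β : ℝ) (j : ℤ) (x : V) : zpt β (j • x) = j * zpt β x := by
  let F : V →+ ℂ := ⟨⟨zpt β, zpt_zero β⟩, zpt_add β⟩
  exact (map_zsmul F j x).trans (zsmul_eq_mul _ _)

/-- A tiling by standard tiles with a formal period gives strip data. -/
lemma false_of_places {β : ℝ} (hβ : Adm β) {S : Set (ℂ ≃ᵢ ℂ)} (hS : Til β S)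
    (hstd : ∀ g ∈ S, Std β g) {v : V} (hv : v ≠ 0)
    (hshift : ∀ t ∈ places β S, ∀ j : ℤ, t.shift (j • v) ∈ places β S) : False := by
  obtain ⟨D, hD, hrad⟩ := exists_radius hβ
  set w := zpt β v
  have hw : w ≠ 0 := fun h => hv (zpt_injective hβ.2 (by rw [zpt_zero]; exact h))
  have hw' : conj w ≠ 0 := by simpa using hw
  have hn : 0 < ‖w‖ := norm_pos_iff.2 hw
  have hN : 0 < normSq w := normSq_pos.2 hw
  set H := 2 * (D + 1) * ‖w‖ with hH
  have hHp : 0 < H := by positivity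
  let c : Pl → ℂ := fun t => t.toIso β ctr * conj w
  have hc : ∀ t, ∀ j : ℤ, c (t.shift (j • v)) = c t + (j * normSq w : ℝ) := by
    intro t j
    simp only [c, t.shift_toIso, zpt_zsmul]
    rw [add_mul, mul_assoc, mul_conj]; push_cast; rfl
  have hcd : ∀ t y, ‖c t - y * conj w‖ = dist (t.toIso β ctr) y * ‖w‖ := by
    intro t y
    rw [← sub_mul, norm_mul, RCLike.norm_conj, dist_eq]
  let p : ℤ → ℂ := fun j => (I * (j * H : ℝ)) / conj w
  set r := (normSq w + H) / ‖w‖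
  have hbox : ∀ t j, ⌊(c t).re / normSq w⌋ = 0 → ⌊(c t).im / H⌋ = j →
      dist (t.toIso β ctr) (p j) ≤ r := by
    intro t j h1 h2
    rw [Int.floor_eq_iff, le_div_iff₀ (by assumption), div_lt_iff₀ (by assumption)] at h1 h2
    rw [le_div_iff₀ hn, ← hcd]
    simp only [p, div_mul_cancel₀ _ hw']
    refine (norm_le_abs_re_add_abs_im _).trans (add_le_add ?_ ?_)
    · rw [abs_le]; simp at h1 ⊢; constructor <;> nlinarith
    · rw [abs_le]; simp; constructor <;> nlinarith
  obtain ⟨K, hK⟩ := exists_card_le hβ r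
  have hsub : ∀ j, Set.MapsTo (Pl.toIso β)
      {t ∈ places β S | ⌊(c t).re / normSq w⌋ = 0 ∧ ⌊(c t).im / H⌋ = j}
      {g ∈ S | dist (g ctr) (p j) ≤ r} :=
    fun j t ht => ⟨ht.1.2, hbox t j ht.2.1 ht.2.2⟩
  have hinj : ∀ j, Set.InjOn (Pl.toIso β)
      {t ∈ places β S | ⌊(c t).re / normSq w⌋ = 0 ∧ ⌊(c t).im / H⌋ = j} :=
    fun j t ht t' ht' e => Pl.toIso_inj hβ.2 ht.1.1 ht'.1.1 e
  have hcol : ∀ t, ∀ j : ℤ, ⌊(c (t.shift (j • v))).re / normSq w⌋ = ⌊(c t).re / normSq w⌋ + j := by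
    intro t j
    rw [hc, add_re, ofReal_re, add_div, mul_div_cancel_right₀ _ hN.ne', Int.floor_add_intCast]
  have hlay : ∀ t, ∀ j : ℤ, ⌊(c (t.shift (j • v))).im / H⌋ = ⌊(c t).im / H⌋ := by
    intro t j
    rw [hc, add_im, ofReal_im, add_zero]
  refine Strip.false (T := places β S) (v := v) (col := fun t => ⌊(c t).re / normSq w⌋)
    (lay := fun t => ⌊(c t).im / H⌋) ⟨fun t ht => ht.1, hshift,
      fun t ht i => exists_opp hβ hS hstd ht.1 ht.2 i, hcol, hlay, ?_, ?_, ?_, ?_, ?_⟩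
  · rintro ⟨t, i⟩ ⟨t', j⟩ ht ht' ho
    apply abs_floor_sub_le
    rw [← sub_div, abs_div, abs_of_pos hHp, div_le_one hHp, ← sub_im]
    refine (abs_im_le_norm _).trans ?_
    have hmem : ∀ t : Pl, ∀ i, zpt β (t.src i) ∈ t.toIso β '' tile β ∧
        zpt β (t.tgt i) ∈ t.toIso β '' tile β := by
      intro t i
      have : ∀ i, zpt β (t.vert i) ∈ t.toIso β '' tile β := fun i => by
        rw [← t.toIso_vt]
        refine Set.mem_image_of_mem _ ?_
        rw [← not_not (a := vt β i ∈ tile β), ← cnt_eq_zero hβ, cnt_vt hβ]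
        revert i; decide
      exact ⟨this _, this _⟩
    have h1 := hrad _ _ (hmem t i).2
    have h2 := hrad _ _ (hmem t' j).1
    rw [show t'.src j = t.tgt i from ho.1] at h2
    have h3 := dist_triangle_left (t.toIso β ctr) (t'.toIso β ctr) (zpt β (t.tgt i))
    rw [hcd]
    nlinarith
  · exact fun j => Set.Finite.of_injOn (hsub j) (hinj j) (hK S hS (p j)).1
  · intro j
    set y := (I * ((j + 1 / 2) * H : ℝ)) / conj w with hy
    obtain ⟨g, hg, hgy⟩ := hS.cover y
    obtain ⟨t, ht, rfl⟩ := std_iff.1 (hstd g hg)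
    have h1 := hrad _ _ hgy
    rw [dist_comm] at h1
    have h2 := hcd t y
    rw [hy, div_mul_cancel₀ _ hw'] at h2
    have h3 := abs_im_le_norm (c t - I * ((j + 1 / 2) * H : ℝ))
    rw [h2, ← hy] at h3
    have h4 : ⌊(c t).im / H⌋ = j := by
      rw [Int.floor_eq_iff, le_div_iff₀ hHp, div_lt_iff₀ hHp]
      have h3 := h3.trans (mul_le_mul_of_nonneg_right h1 hn.le)
      rw [abs_le] at h3
      simp at h3
      constructor <;> nlinarith
    exact ⟨t.shift ((-⌊(c t).re / normSq w⌋) • v), hshift t ⟨ht, hg⟩ _,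
      by rw [hcol]; ring, by rw [hlay, h4]⟩
  · exact ⟨K, fun j => (Set.ncard_le_ncard_of_injOn _ (hsub j) (hinj j) (hK S hS (p j)).1).trans
      (hK S hS (p j)).2⟩
  · let FA : V →+ ℂ := ⟨⟨fun x => eis (eA x), by simp [eis, eA]⟩, fun x y => by
      simp [eis, eA]; ring⟩
    let FB : V →+ ℂ := ⟨⟨fun x => eis (eB x), by simp [eis, eB]⟩, fun x y => by
      simp [eis, eB]; ring⟩
    obtain ⟨C, hC⟩ := exists_near_bound hβ FA r
    obtain ⟨C', hC'⟩ := exists_near_bound hβ FB r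
    refine ⟨max C C', fun t ht t' ht' h1 h2 h3 => ?_⟩
    have b1 := hbox t _ h1 rfl
    have b2 := hbox t' _ h2 rfl
    rw [← show ⌊(c t).im / H⌋ = ⌊(c t').im / H⌋ from h3] at b2
    exact ⟨(hC S hS hstd _ t' ht' t ht b2 b1).trans (le_max_left _ _),
      (hC' S hS hstd _ t' ht' t ht b2 b1).trans (le_max_right _ _)⟩

lemma std_refl (β : ℝ) : Std β (IsometryEquiv.refl ℂ) :=
  ⟨⟨false, 0, 0⟩, by norm_num, by ext z; change z = _; simp [Pl.iso, zpt_zero]⟩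

lemma false_of_shift {β : ℝ} (hβ : Adm β) {S : Set (ℂ ≃ᵢ ℂ)} (hS : Til β S)
    (hstd : ∀ g ∈ S, Std β g) {v : ℂ} (hv : v ≠ 0)
    (h1 : ∀ g ∈ S, g.trans (IsometryEquiv.addRight v) ∈ S)
    (h2 : ∀ g ∈ S, g.trans (IsometryEquiv.addRight (-v)) ∈ S) : False := by
  obtain ⟨g, hg, -⟩ := hS.cover 0
  have a1 := (hstd g hg).vt_mem 0
  have a2 := (hstd _ (h1 g hg)).vt_mem 0
  obtain ⟨w, hw⟩ := mem_range_sub a2 a1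
  have hw : zpt β w = v := by rw [hw]; simp
  refine false_of_places hβ hS hstd (v := w) (fun h => hv (by rw [← hw, h, zpt_zero])) ?_
  have key : ∀ t ∈ places β S, t.shift w ∈ places β S ∧ t.shift (-w) ∈ places β S := by
    intro t ht
    refine ⟨⟨ht.1, ?_⟩, ⟨ht.1, ?_⟩⟩
    · convert h1 _ ht.2 using 1
      ext z; rw [Pl.shift_toIso, hw]; rfl
    · convert h2 _ ht.2 using 1
      ext z; rw [Pl.shift_toIso, zpt_neg, hw]; rfl
  intro t ht j
  induction j using Int.induction_on with
  | zero => simpa [Pl.shift_zero] using ht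
  | succ n ih => rw [add_smul, one_smul, ← Pl.shift_shift]; exact (key _ ih).1
  | pred n ih =>
    rw [sub_smul, one_smul, sub_eq_add_neg, ← Pl.shift_shift]; exact (key _ ih).2

/-- No tiling by the prototile has a nonzero period. -/
theorem no_period {β : ℝ} (hβ : Adm β) {S : Set (ℂ ≃ᵢ ℂ)} (hS : Til β S) {v : ℂ} (hv : v ≠ 0)
    (h : (fun A => (fun x => v + x) '' A) '' ((fun g : ℂ ≃ᵢ ℂ => g '' tile β) '' S) =
      (fun g : ℂ ≃ᵢ ℂ => g '' tile β) '' S) : False := by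
  have key : ∀ g h : ℂ ≃ᵢ ℂ, (fun x => v + x) '' (g '' tile β) = h '' tile β →
      g.trans (IsometryEquiv.addRight v) = h := by
    intro g h e
    have : ((g.trans (IsometryEquiv.addRight v)).trans h.symm) '' tile β = tile β := by
      have e2 : h.symm '' ((fun x => v + x) '' (g '' tile β)) = h.symm '' (h '' tile β) := by rw [e]
      rw [Set.image_image h.symm h] at e2
      simp only [IsometryEquiv.symm_apply_apply, Set.image_id'] at e2
      refine Eq.trans ?_ e2
      rw [Set.image_image, Set.image_image]
      refine Set.image_congr fun x _ => ?_
      simp [add_comm]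
    have := eq_refl_of_image_eq hβ this
    ext x
    have : h (h.symm (g x + v)) = h x := congrArg (fun f : ℂ ≃ᵢ ℂ => h (f x)) this
    rwa [h.apply_symm_apply] at this
  have h1 : ∀ g ∈ S, g.trans (IsometryEquiv.addRight v) ∈ S := by
    intro g hg
    have : (fun x => v + x) '' (g '' tile β) ∈ (fun g : ℂ ≃ᵢ ℂ => g '' tile β) '' S := by
      rw [← h]; exact Set.mem_image_of_mem _ (Set.mem_image_of_mem _ hg)
    obtain ⟨k, hk, e⟩ := this
    rwa [key g k e.symm]
  have h2 : ∀ g ∈ S, g.trans (IsometryEquiv.addRight (-v)) ∈ S := by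
    intro g hg
    have : g '' tile β ∈ (fun g : ℂ ≃ᵢ ℂ => g '' tile β) '' S := ⟨g, hg, rfl⟩
    rw [← h] at this
    obtain ⟨_, ⟨k, hk, rfl⟩, e⟩ := this
    rw [← key k g e]
    convert hk
    ext x; simp
  obtain ⟨g₀, hg₀, -⟩ := hS.cover 0
  let S' : Set (ℂ ≃ᵢ ℂ) := {k | k.trans g₀ ∈ S}
  have himg : ∀ k : ℂ ≃ᵢ ℂ, (k.trans g₀) '' tile β = g₀ '' (k '' tile β) := fun k => by
    rw [Set.image_image]; rfl
  have hS' : Til β S' := by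
    refine ⟨fun x => ?_, fun k hk l hl hne => ?_⟩
    · obtain ⟨g, hg, hgx⟩ := hS.cover (g₀ x)
      have hgg : (g.trans g₀.symm).trans g₀ = g := by ext z; simp
      refine ⟨g.trans g₀.symm, show _ ∈ S by rwa [hgg], ?_⟩
      rw [← hgg, himg] at hgx
      exact (g₀.injective.mem_set_image).1 hgx
    · have hne' : k.trans g₀ ≠ l.trans g₀ := fun e => hne (by
        ext z; exact g₀.injective (congrArg (fun f : ℂ ≃ᵢ ℂ => f z) e))
      have := hS.disj hk hl hne'
      simp only [himg] at this
      have e : ∀ A, interior (g₀ '' A) = g₀ '' interior A := fun A =>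
        (g₀.toHomeomorph.image_interior A).symm
      simp only [e] at this
      exact (Set.disjoint_image_iff g₀.injective).1 this
  have hstd := all_std hβ hS' (g₀ := IsometryEquiv.refl ℂ) (by
    change (IsometryEquiv.refl ℂ).trans g₀ ∈ S
    exact (show (IsometryEquiv.refl ℂ).trans g₀ = g₀ from rfl) ▸ hg₀) (std_refl β)
  have hadd : ∀ (k : ℂ ≃ᵢ ℂ) w, (k.trans (IsometryEquiv.addRight ((lp g₀).symm w))).trans g₀ =
      (k.trans g₀).trans (IsometryEquiv.addRight w) := by
    intro k w
    ext z
    simp [iso_add]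
  refine false_of_shift hβ hS' hstd (v := (lp g₀).symm v) (by simpa using hv) ?_ ?_
  · intro k hk
    change _ ∈ S
    rw [hadd]; exact h1 _ hk
  · intro k hk
    change _ ∈ S
    rw [← map_neg, hadd]; exact h2 _ hk

/-- The edge steps are spanned by `A`- and `B`-parts; this exchanges them. -/
def swapAB (x : V) : V := (x.2.2.1, x.2.2.2, x.1, x.2.1)

/-- An oriented edge, given by its starting position and its step. -/
abbrev Arc : Type := V × V

/-- The action of a rotation followed by a translation on arcs. -/
def arcAct (k : ℕ) (a : V) (e : Arc) : Arc := (rot^[k] e.1 + a, rot^[k] e.2)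

/-- Evaluation of an edge weight on a chain of signed arcs. -/
def eval (ψ : Arc → ℤ) (l : List (Bool × Arc)) : ℤ :=
  (l.map fun c => if c.1 then ψ c.2 else -ψ c.2).sum

lemma eval_cons (ψ : Arc → ℤ) (c : Bool × Arc) (l : List (Bool × Arc)) :
    eval ψ (c :: l) = (if c.1 then ψ c.2 else -ψ c.2) + eval ψ l := by simp [eval]

lemma eval_append (ψ : Arc → ℤ) (l l' : List (Bool × Arc)) :
    eval ψ (l ++ l') = eval ψ l + eval ψ l' := by simp [eval]

lemma eval_flatMap {α : Type*} (ψ : Arc → ℤ) (l : List α) (f : α → List (Bool × Arc)) :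
    eval ψ (l.flatMap f) = (l.map fun x => eval ψ (f x)).sum := by
  induction l with
  | nil => rfl
  | cons a l ih => simp [List.flatMap_cons, eval_append, ih]

/-- Map the arcs of a chain. -/
def chainMap (f : Arc → Arc) (l : List (Bool × Arc)) : List (Bool × Arc) :=
  l.map fun c => (c.1, f c.2)

lemma eval_chainMap (ψ : Arc → ℤ) (f : Arc → Arc) (l : List (Bool × Arc)) :
    eval ψ (chainMap f l) = eval (ψ ∘ f) l := by
  simp [eval, chainMap, Function.comp_def]

/-- Reverse the signs of a chain. -/
def chainNeg (l : List (Bool × Arc)) : List (Bool × Arc) := l.map fun c => (!c.1, c.2)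

lemma eval_chainNeg (ψ : Arc → ℤ) (l : List (Bool × Arc)) :
    eval ψ (chainNeg l) = -eval ψ l := by
  induction l with
  | nil => rfl
  | cons c l ih =>
    rw [chainNeg, List.map_cons, ← chainNeg, eval_cons, eval_cons, ih]
    cases c.1 <;> simp <;> ring

/-- The arcs of a chain with the given sign. -/
def part (b : Bool) (l : List (Bool × Arc)) : List Arc :=
  (l.filter fun c => c.1 = b).map Prod.snd

lemma eval_eq_part (ψ : Arc → ℤ) (l : List (Bool × Arc)) :
    eval ψ l = ((part true l).map ψ).sum - ((part false l).map ψ).sum := by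
  induction l with
  | nil => rfl
  | cons c l ih =>
    rw [eval_cons, ih]
    rcases c with ⟨_ | _, e⟩ <;> simp [part] <;> ring

lemma eval_eq_of_perm {l l' : List (Bool × Arc)}
    (h : (part true l ++ part false l').Perm (part true l' ++ part false l)) (ψ : Arc → ℤ) :
    eval ψ l = eval ψ l' := by
  have h := (h.map ψ).sum_eq
  simp only [List.map_append, List.sum_append] at h
  rw [eval_eq_part, eval_eq_part]
  linarith

/-- The boundary chain of a placed tile; arcs start at even vertices. -/
def Pl.bd (t : Pl) : List (Bool × Arc) :=
  (List.finRange 14).map fun i =>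
    (xor (decide (i.val % 2 = 0)) t.s, (t.vert (hx i), lin t.s t.k (fv (sq i) - fv (hx i))))

lemma Pl.bd_eq (s : Bool) (k : ℕ) (x : V) :
    Pl.bd ⟨s, k, x⟩ = chainMap (arcAct k x) (Pl.bd ⟨s, 0, 0⟩) := by
  simp [Pl.bd, chainMap, arcAct, Pl.vert, Pl.act, lin, Function.comp_def]

/-- A formal placement of a supertile: a single tile, or a compound of two tiles. -/
structure St where
  c : Bool
  k : ℕ
  x : V
deriving DecidableEq

/-- The tiles of a formal cluster. -/
def St.tiles (t : St) : List Pl :=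
  if t.c then [⟨true, t.k, t.x⟩, ⟨false, t.k + 3, t.x + rot^[t.k] (0, 3, 0, 1)⟩]
  else [⟨false, t.k, t.x⟩]

/-- The boundary chain of a cluster. -/
def St.bd (t : St) : List (Bool × Arc) := t.tiles.flatMap Pl.bd

lemma arcAct_arcAct (k j : ℕ) (a b : V) (e : Arc) :
    arcAct k a (arcAct j b e) = arcAct (k + j) (a + rot^[k] b) e := by
  simp only [arcAct, rot_iter_add, Function.iterate_add_apply]
  congr 1
  abel

lemma chainMap_chainMap (f g : Arc → Arc) (l : List (Bool × Arc)) :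
    chainMap f (chainMap g l) = chainMap (f ∘ g) l := by
  simp [chainMap]

lemma St.bd_eq (c : Bool) (k : ℕ) (x : V) :
    St.bd ⟨c, k, x⟩ = chainMap (arcAct k x) (St.bd ⟨c, 0, 0⟩) := by
  cases c
  · simp [St.bd, St.tiles, Pl.bd_eq _ k x]
  · have h : arcAct (k + 3) (x + rot^[k] (0, 3, 0, 1)) =
        arcAct k x ∘ arcAct 3 (0, 3, 0, 1) :=
      funext fun e => by simp [arcAct_arcAct]
    have e1 : St.bd ⟨true, k, x⟩ =
        Pl.bd ⟨true, k, x⟩ ++ Pl.bd ⟨false, k + 3, x + rot^[k] (0, 3, 0, 1)⟩ := by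
      simp [St.bd, St.tiles]
    have e2 : St.bd ⟨true, 0, 0⟩ = Pl.bd ⟨true, 0, 0⟩ ++ Pl.bd ⟨false, 3, (0, 3, 0, 1)⟩ := by
      simp [St.bd, St.tiles]
    rw [e1, e2, Pl.bd_eq _ k, Pl.bd_eq _ (k + 3), Pl.bd_eq _ 3, h, ← chainMap_chainMap]
    simp [chainMap]

/-- The linear inflation of formal positions. -/
def infl (x : V) : V :=
  rot (rot (-2 * x.1 - x.2.1 + 2 * x.2.2.1, x.1 - x.2.1 + 2 * x.2.2.2,
    x.1 - x.2.2.1 + x.2.2.2, x.2.1 - x.2.2.1 - 2 * x.2.2.2))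

lemma infl_add (x y : V) : infl (x + y) = infl x + infl y := by
  ext <;> simp [infl, rot] <;> ring

lemma infl_rot (x : V) : infl (rot x) = rot (infl x) := by
  ext <;> simp [infl, rot] <;> ring

lemma infl_rot_iter (k : ℕ) (x : V) : infl (rot^[k] x) = rot^[k] (infl x) := by
  induction k with
  | zero => rfl
  | succ k ih => rw [Function.iterate_succ_apply', infl_rot, ih, Function.iterate_succ_apply']

/-- The steps of the path replacing an edge with step `u`. -/
def steps (u : V) : List V :=
  let v := rot (rot u)
  let w := swapAB v
  if u.2.2 = 0 then [w, rot (rot (rot v)), rot (rot v)]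
  else [rot w, -rot v, rot (rot (rot v)), w, -rot (rot w)]

lemma rot_eq_zero {x : ℤ × ℤ} : ((-x.2, x.1 + x.2) : ℤ × ℤ) = 0 ↔ x = 0 := by
  constructor
  · intro h
    have h1 := congrArg Prod.fst h
    have h2 := congrArg Prod.snd h
    ext <;> simp_all
  · rintro rfl; simp

lemma swapAB_rot (x : V) : swapAB (rot x) = rot (swapAB x) := rfl

lemma rot_neg (x : V) : rot (-x) = -rot x := by
  ext <;> simp [rot] <;> ring

lemma steps_rot (u : V) : steps (rot u) = (steps u).map rot := by
  have : (rot u).2.2 = 0 ↔ u.2.2 = 0 := rot_eq_zero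
  by_cases h : u.2.2 = 0 <;> simp [steps, this, h, swapAB_rot, rot_neg]

lemma steps_rot_iter (k : ℕ) (u : V) : steps (rot^[k] u) = (steps u).map rot^[k] := by
  induction k with
  | zero => simp
  | succ k ih => rw [Function.iterate_succ_apply', steps_rot, ih, List.map_map,
      Function.iterate_succ']

/-- The chain of an alternating path; arcs start at positions of the first kind. -/
def pathChain : V → Bool → List V → List (Bool × Arc)
  | _, _, [] => []
  | p, b, s :: l => (b, if b then (p, s) else (p + s, -s)) :: pathChain (p + s) (!b) l

lemma rot_iter_neg (k : ℕ) (x : V) : rot^[k] (-x) = -rot^[k] x := by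
  simpa [lin] using lin_neg false k x

lemma pathChain_act (k : ℕ) (a p : V) (b : Bool) (l : List V) :
    pathChain (rot^[k] p + a) b (l.map rot^[k]) = chainMap (arcAct k a) (pathChain p b l) := by
  induction l generalizing p b with
  | nil => rfl
  | cons s l ih =>
    have h : rot^[k] p + a + rot^[k] s = rot^[k] (p + s) + a := by rw [rot_iter_add]; abel
    rw [List.map_cons, pathChain, pathChain, h, ih, chainMap, chainMap, List.map_cons]
    cases b <;> simp [arcAct, rot_iter_neg]

/-- The substitution of arcs, without translation. -/
def sub₀ (e : Arc) : List (Bool × Arc) := pathChain (infl e.1) true (steps e.2)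

lemma sub₀_act (k : ℕ) (a : V) (e : Arc) :
    sub₀ (arcAct k a e) = chainMap (arcAct k (infl a)) (sub₀ e) := by
  simp only [sub₀, arcAct]
  rw [steps_rot_iter, infl_add, infl_rot_iter, pathChain_act]

/-- The substitution of chains, without translation. -/
def chainSub₀ (l : List (Bool × Arc)) : List (Bool × Arc) :=
  l.flatMap fun c => if c.1 then sub₀ c.2 else chainNeg (sub₀ c.2)

lemma eval_chainSub₀ (ψ : Arc → ℤ) (l : List (Bool × Arc)) :
    eval ψ (chainSub₀ l) = eval (fun e => eval ψ (sub₀ e)) l := by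
  rw [chainSub₀, eval_flatMap, eval]
  congr 1
  apply List.map_congr_left
  rintro ⟨_ | _, e⟩ _ <;> simp [eval_chainNeg]

/-- The inflation of positions, normalized to fix the base tile. -/
def inflPos (x : V) : V := infl x - rot (rot (-5, 2, 1, 2))

/-- The clusters replacing a single tile (`false`) and a compound (`true`). -/
def children : Bool → List St
  | false => [⟨false, 4, (-5, 2, 1, 2)⟩, ⟨false, 2, (-4, 3, 4, -1)⟩, ⟨false, 3, (-6, 4, 4, 0)⟩,
      ⟨false, 1, (-3, 1, 3, -1)⟩, ⟨false, 3, (-1, 0, 1, 0)⟩, ⟨false, 5, (-4, 0, 0, 2)⟩,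
      ⟨true, 0, (-4, 0, 2, 0)⟩]
  | true => [⟨true, 3, (1, -1, -1, 1)⟩, ⟨false, 5, (1, -4, -3, 2)⟩, ⟨false, 6, (3, -5, -3, 1)⟩,
      ⟨false, 4, (0, -2, -2, 2)⟩, ⟨false, 7, (2, -3, 0, -1)⟩, ⟨false, 8, (1, -1, 1, -1)⟩]

/-- The substitution of clusters. -/
def St.next (t : St) : List St :=
  (children t.c).map fun d =>
    ⟨d.c, (t.k + d.k + 2) % 6, inflPos t.x + rot^[t.k + 2] d.x⟩

/-- The substitution of arcs. -/
def arcSub (e : Arc) : List (Bool × Arc) :=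
  chainMap (arcAct 0 (-rot (rot (-5, 2, 1, 2)))) (sub₀ e)

lemma base_perm (c : Bool) :
    (part true ((children c).flatMap fun d => St.bd ⟨d.c, d.k + 2, rot (rot d.x)⟩) ++
      part false (chainSub₀ (St.bd ⟨c, 0, 0⟩))).Perm
    (part true (chainSub₀ (St.bd ⟨c, 0, 0⟩)) ++
      part false ((children c).flatMap fun d => St.bd ⟨d.c, d.k + 2, rot (rot d.x)⟩)) := by
  revert c
  decide +kernel

lemma arcAct_mod (k : ℕ) (a : V) : arcAct (k % 6) a = arcAct k a := by
  funext e
  simp [arcAct, rot_iter_mod]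

/-- The pullback of arc weights under the substitution. -/
def pull (ψ : Arc → ℤ) (e : Arc) : ℤ := eval ψ (arcSub e)

lemma eval_next (ψ : Arc → ℤ) (t : St) :
    (t.next.map fun d => eval ψ d.bd).sum = eval (pull ψ) t.bd := by
  obtain ⟨c, k, x⟩ := t
  have h1 (d : St) : eval ψ (St.bd ⟨d.c, (k + d.k + 2) % 6, inflPos x + rot^[k + 2] d.x⟩) =
      eval (ψ ∘ arcAct k (inflPos x)) (St.bd ⟨d.c, d.k + 2, rot (rot d.x)⟩) := by
    rw [St.bd_eq, St.bd_eq d.c (d.k + 2), arcAct_mod, eval_chainMap, eval_chainMap]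
    congr 1
    funext e
    simp only [Function.comp, arcAct_arcAct, ← add_assoc, Function.iterate_add_apply]
    rfl
  have h2 (e : Arc) : pull ψ (arcAct k x e) = eval (ψ ∘ arcAct k (inflPos x)) (sub₀ e) := by
    rw [pull, arcSub, sub₀_act, eval_chainMap, eval_chainMap]
    congr 1
    funext e
    simp [arcAct_arcAct, inflPos, sub_eq_neg_add]
  rw [St.bd_eq, eval_chainMap]
  have h3 : pull ψ ∘ arcAct k x = fun e => eval (ψ ∘ arcAct k (inflPos x)) (sub₀ e) :=
    funext h2
  rw [h3, ← eval_chainSub₀, ← eval_eq_of_perm (base_perm c), eval_flatMap]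
  simp only [St.next, List.map_map, Function.comp_def, h1]

/-- The base tile. -/
def baseSt : St := ⟨false, 0, 0⟩

/-- The clusters surrounding the base tile in its substitution. -/
def ring₁ : List St := [⟨false, 4, (-2, 1, 0, 3)⟩, ⟨false, 5, (-1, -1, -1, 3)⟩,
  ⟨false, 3, (-1, 2, 1, 2)⟩, ⟨false, 5, (-2, 4, 2, 0)⟩, ⟨false, 1, (1, 1, 1, -1)⟩,
  ⟨true, 2, (1, 1, 1, 1)⟩]

lemma baseSt_next : baseSt.next = baseSt :: ring₁ := by decide +kernel

/-- The clusters other than the base tile in the iterated substitution. -/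
def outer : ℕ → List St
  | 0 => []
  | n + 1 => ring₁ ++ (outer n).flatMap St.next

/-- The clusters in the iterated substitution of the base tile. -/
def patch (n : ℕ) : List St := baseSt :: outer n

lemma patch_succ (n : ℕ) : patch (n + 1) = (patch n).flatMap St.next := by
  simp [patch, outer, baseSt_next]

lemma eval_patch (ψ : Arc → ℤ) (n : ℕ) :
    ((patch n).map fun d => eval ψ d.bd).sum = eval (pull^[n] ψ) baseSt.bd := by
  induction n generalizing ψ with
  | zero => simp [patch, outer]
  | succ n ih =>
    rw [Function.iterate_succ_apply, ← ih, patch_succ]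
    simp only [← eval_next, List.map_flatMap]
    rw [List.flatMap_def, List.sum_flatten, List.map_map]
    rfl

/-- `√5`. -/
abbrev r5 : ℝ := √5

lemma r5_sq : r5 * r5 = 5 := Real.mul_self_sqrt (by norm_num)

lemma r5_bounds : 2.236067 < r5 ∧ r5 < 2.236068 :=
  ⟨Real.lt_sqrt_of_sq_lt (by norm_num), (Real.sqrt_lt' (by norm_num)).2 (by norm_num)⟩

/-- The eigenforms of the inflation, for `σ = ±√5`. -/
def lc (σ : ℝ) (x : V) : ℂ :=
  ⟨x.1 + x.2.1 / 2 - σ / 2 * (x.2.2.1 + x.2.2.2 / 2) + 3 / 4 * x.2.2.2,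
    r3 * (x.2.1 / 2 - x.2.2.1 / 2 - x.2.2.2 / 4 - σ * x.2.2.2 / 4)⟩

lemma lc_add (σ : ℝ) (x y : V) : lc σ (x + y) = lc σ x + lc σ y := by
  apply Complex.ext <;> simp [lc] <;> ring

lemma lc_rot (σ : ℝ) (x : V) : lc σ (rot x) = om * lc σ x := by
  have := r3_sq
  apply Complex.ext <;> simp only [lc, rot, om, mul_re, mul_im] <;> push_cast
  · linear_combination (-(x.2.1 / 2 - x.2.2.1 / 2 - x.2.2.2 / 4 - σ * x.2.2.2 / 4) / 2 : ℝ) * -this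
  · ring

lemma norm_lc_rot_iter (σ : ℝ) (k : ℕ) (x : V) : ‖lc σ (rot^[k] x)‖ = ‖lc σ x‖ := by
  induction k with
  | zero => rfl
  | succ k ih => rw [Function.iterate_succ_apply', lc_rot, norm_mul, norm_om, one_mul, ih]

lemma norm_lc_infl {σ : ℝ} (hσ : σ * σ = 5) (x : V) :
    ‖lc σ (infl x)‖ = |(3 + σ) / 2| * ‖lc σ x‖ := by
  have h : lc σ (-2 * x.1 - x.2.1 + 2 * x.2.2.1, x.1 - x.2.1 + 2 * x.2.2.2,
      x.1 - x.2.2.1 + x.2.2.2, x.2.1 - x.2.2.1 - 2 * x.2.2.2) =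
      (-((3 + σ) / 2) : ℝ) * lc σ x := by
    apply Complex.ext <;> simp only [lc, re_ofReal_mul, im_ofReal_mul] <;> push_cast
    · linear_combination (-x.2.2.1 / 4 - x.2.2.2 / 8 : ℝ) * hσ
    · linear_combination (-r3 * x.2.2.2 / 8 : ℝ) * hσ
  rw [infl, lc_rot, lc_rot, h, norm_mul, norm_mul, norm_mul, norm_om, norm_real, norm_neg,
    Real.norm_eq_abs]
  ring

/-- The rational part of `2 ‖lc σ x‖²`. -/
def qa (x : V) : ℤ := 2 * (x.1 * x.1 + x.1 * x.2.1 + x.2.1 * x.2.1) +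
  4 * (x.2.2.1 * x.2.2.1 + x.2.2.1 * x.2.2.2 + x.2.2.2 * x.2.2.2) +
  3 * (x.1 * x.2.2.2 - x.2.1 * x.2.2.1)

/-- The irrational part of `2 ‖lc σ x‖²`. -/
def qb (x : V) : ℤ := 2 * (x.1 * x.2.2.1) + x.1 * x.2.2.2 + x.2.1 * x.2.2.1 +
  2 * (x.2.1 * x.2.2.2)

lemma norm_lc_sq {σ : ℝ} (hσ : σ * σ = 5) (x : V) : 2 * ‖lc σ x‖ ^ 2 = qa x - σ * qb x := by
  have := r3_sq
  rw [Complex.sq_norm, normSq_apply]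
  simp only [lc, qa, qb]
  push_cast
  have h : r3 * r3 = 3 := this
  set s : ℝ := (x.2.1 / 2 - x.2.2.1 / 2 - x.2.2.2 / 4 - σ * x.2.2.2 / 4) with hs
  have : r3 * s * (r3 * s) = 3 * (s * s) := by linear_combination s * s * h
  rw [this, hs]
  linear_combination ((x.2.2.1 : ℝ) ^ 2 / 2 + x.2.2.1 * x.2.2.2 / 2 + x.2.2.2 ^ 2 / 2 : ℝ) * hσ

/-- A sufficient condition for `0 ≤ a + b √5`. -/
abbrev N5 (a b : ℤ) : Prop :=
  0 ≤ 1000000 * a + 2236067 * b ∧ 0 ≤ 1000000 * a + 2236068 * b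

lemma N5.nonneg {a b : ℤ} (h : N5 a b) : 0 ≤ a + r5 * b := by
  obtain ⟨h1, h2⟩ := h
  obtain ⟨l, u⟩ := r5_bounds
  have h1 : (0 : ℝ) ≤ 1000000 * a + 2236067 * b := by exact_mod_cast h1
  have h2 : (0 : ℝ) ≤ 1000000 * a + 2236068 * b := by exact_mod_cast h2
  rcases le_total 0 (b : ℝ) with hb | hb <;> nlinarith

lemma neg_r5_sq : -r5 * -r5 = 5 := by rw [neg_mul_neg, r5_sq]

lemma le_norm_lc {x : V} {c : ℤ} (h : N5 (qa x - c) (-qb x)) {r : ℝ} (hr : 2 * r ^ 2 ≤ c) :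
    r ≤ ‖lc r5 x‖ := by
  have h := h.nonneg
  have h2 := norm_lc_sq r5_sq x
  push_cast at h
  by_contra! hlt
  nlinarith [norm_nonneg (lc r5 x)]

lemma norm_lc_le {x : V} {c : ℤ} (h : N5 (c - qa x) (qb x)) {r : ℝ} (hr : c ≤ 2 * r ^ 2)
    (hr0 : 0 ≤ r) : ‖lc r5 x‖ ≤ r := by
  have h := h.nonneg
  have h2 := norm_lc_sq r5_sq x
  push_cast at h
  by_contra! hlt
  nlinarith [norm_nonneg (lc r5 x)]

lemma norm_lc_neg_le {x : V} {c : ℤ} (h : N5 (c - qa x) (-qb x)) {r : ℝ} (hr : c ≤ 2 * r ^ 2)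
    (hr0 : 0 ≤ r) : ‖lc (-r5) x‖ ≤ r := by
  have h := h.nonneg
  have h2 := norm_lc_sq neg_r5_sq x
  push_cast at h
  by_contra! hlt
  nlinarith [norm_nonneg (lc (-r5) x)]

lemma norm_lc_infl_ge (x : V) : 2.618 * ‖lc r5 x‖ ≤ ‖lc r5 (infl x)‖ := by
  obtain ⟨l, u⟩ := r5_bounds
  rw [norm_lc_infl r5_sq, abs_of_pos (by linarith)]
  nlinarith [norm_nonneg (lc r5 x)]

lemma norm_lc_neg_infl_le (x : V) : ‖lc (-r5) (infl x)‖ ≤ 0.382 * ‖lc (-r5) x‖ := by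
  obtain ⟨l, u⟩ := r5_bounds
  rw [norm_lc_infl neg_r5_sq, abs_of_pos (by linarith)]
  nlinarith [norm_nonneg (lc (-r5) x)]

/-- Twice the displacement from the fixed position of the normalized inflation. -/
def cen (x : V) : V := x + x - (3, 3, 1, -1)

lemma cen_inflPos_add (x y : V) : cen (inflPos x + y) = infl (cen x) + (y + y) := by
  ext <;> simp [cen, inflPos, infl, rot] <;> ring

lemma norm_lc_cen_ge (x y : V) :
    2.618 * ‖lc r5 (cen x)‖ - 2 * ‖lc r5 y‖ ≤ ‖lc r5 (cen (inflPos x + y))‖ := by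
  rw [cen_inflPos_add, lc_add, lc_add]
  have h1 := norm_lc_infl_ge (cen x)
  have h2 := norm_sub_le_norm_add (lc r5 (infl (cen x))) (lc r5 y + lc r5 y)
  have h3 := norm_add_le (lc r5 y) (lc r5 y)
  linarith

lemma norm_lc_neg_cen_le (x y : V) :
    ‖lc (-r5) (cen (inflPos x + y))‖ ≤ 0.382 * ‖lc (-r5) (cen x)‖ + 2 * ‖lc (-r5) y‖ := by
  rw [cen_inflPos_add, lc_add, lc_add]
  have h1 := norm_lc_neg_infl_le (cen x)
  have h2 := norm_add_le (lc (-r5) (infl (cen x))) (lc (-r5) y + lc (-r5) y)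
  have h3 := norm_add_le (lc (-r5) y) (lc (-r5) y)
  linarith

/-- Positions with a large expanding and a small contracting displacement. -/
def FarPos (K : ℝ) (x : V) : Prop := K ≤ ‖lc r5 (cen x)‖ ∧ ‖lc (-r5) (cen x)‖ ≤ 12

lemma zpt_eq_lc (β : ℝ) (x : V) : zpt β x = (lc r5 x + lc (-r5) x) / 2 -
    I * (r3 * ((2 * β + 1) / r5) : ℝ) * ((lc r5 x - lc (-r5) x) / 2) := by
  have h5 : r5 ≠ 0 := by positivity
  have := r3_sq
  have e : (lc r5 x - lc (-r5) x) / 2 = ((r5 / 2 : ℝ) : ℂ) *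
      ⟨-(x.2.2.1 + x.2.2.2 / 2), -r3 * x.2.2.2 / 2⟩ := by
    apply Complex.ext <;> simp [lc] <;> ring
  have e2 : I * (r3 * ((2 * β + 1) / r5) : ℝ) * ((lc r5 x - lc (-r5) x) / 2) =
      ((r3 * (2 * β + 1) / 2 : ℝ) : ℂ) * (I * ⟨-(x.2.2.1 + x.2.2.2 / 2), -r3 * x.2.2.2 / 2⟩) := by
    rw [e]
    have : ((r3 * ((2 * β + 1) / r5) : ℝ) : ℂ) * ((r5 / 2 : ℝ) : ℂ) =
        ((r3 * (2 * β + 1) / 2 : ℝ) : ℂ) := by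
      rw [← ofReal_mul]; congr 1; field_simp
    linear_combination I * ⟨-(x.2.2.1 + x.2.2.2 / 2), -r3 * x.2.2.2 / 2⟩ * this
  rw [e2]
  apply Complex.ext
  · simp [lc, zpt]
    linear_combination (-(2 * β + 1) / 4 * x.2.2.2 : ℝ) * -this
  · simp [lc, zpt]
    ring

lemma norm_zpt_ge {β : ℝ} (hβ : 0 < 2 * β + 1 - 2.1) {x : V}
    (h : ‖lc (-r5) x‖ ≤ ‖lc r5 x‖) : 0.9 * (‖lc r5 x‖ - ‖lc (-r5) x‖) ≤ ‖zpt β x‖ := by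
  have h5 : 0 < r5 := by positivity
  set τ : ℝ := r3 * ((2 * β + 1) / r5) with hτ
  have hτ2 : 2.5 ≤ τ ^ 2 := by
    have : τ ^ 2 = 3 * (2 * β + 1) ^ 2 / 5 := by
      rw [hτ, mul_pow, div_pow, pow_two r3, r3_sq, pow_two r5, r5_sq]; ring
    rw [this]; nlinarith
  have hn (ε : ℝ) (hε : ε ^ 2 = 1) : ‖(⟨1 / 2, ε * τ / 2⟩ : ℂ)‖ ^ 2 = (1 + τ ^ 2) / 4 := by
    rw [Complex.sq_norm, normSq_apply]
    linear_combination τ ^ 2 / 4 * hε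
  have e : zpt β x = ⟨1 / 2, -1 * τ / 2⟩ * lc r5 x - -(⟨1 / 2, 1 * τ / 2⟩ * lc (-r5) x) := by
    rw [zpt_eq_lc, ← hτ]
    apply Complex.ext <;> simp <;> ring
  have h1 := hn 1 (by norm_num)
  have h2 := hn (-1) (by norm_num)
  have h3 : ‖(⟨1 / 2, -1 * τ / 2⟩ : ℂ)‖ = ‖(⟨1 / 2, 1 * τ / 2⟩ : ℂ)‖ :=
    (sq_eq_sq₀ (norm_nonneg _) (norm_nonneg _)).1 (h2.trans h1.symm)
  have h4 : 0.9 ≤ ‖(⟨1 / 2, 1 * τ / 2⟩ : ℂ)‖ := by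
    by_contra! hlt
    nlinarith [norm_nonneg (⟨1 / 2, 1 * τ / 2⟩ : ℂ)]
  have h5 := norm_sub_norm_le (⟨1 / 2, -1 * τ / 2⟩ * lc r5 x) (-(⟨1 / 2, 1 * τ / 2⟩ * lc (-r5) x))
  rw [← e, norm_mul, norm_neg, norm_mul, h3] at h5
  nlinarith

/-- The centre of the expansion. -/
def zc (β : ℝ) : ℂ := zpt β (3, 3, 1, -1) / 2

lemma FarPos.le_norm {β : ℝ} (hβ : 0 < 2 * β + 1 - 2.1) {K : ℝ} (hK : 12 ≤ K) {x : V}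
    (h : FarPos K x) : 0.45 * (K - 12) ≤ ‖zpt β x - zc β‖ := by
  have h1 := norm_zpt_ge hβ (h.2.trans (hK.trans h.1))
  have e : zpt β (cen x) = 2 * (zpt β x - zc β) := by
    rw [cen, zpt_sub, zpt_add, zc]; ring
  rw [e, norm_mul, Complex.norm_ofNat] at h1
  linarith [h.1, h.2]

/-- The unit steps. -/
def units : List V :=
  (List.range 6).flatMap fun k => [rot^[k] (1, 0, 0, 0), rot^[k] (0, 0, 1, 0)]

/-- Weights vanishing on arcs at distance at least `5 + δ`. -/
def Vanishes (δ : ℝ) (ψ : Arc → ℤ) : Prop :=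
  ∀ e : Arc, e.2 ∈ units → FarPos (5 + δ) e.1 → ψ e = 0

lemma eval_eq_zero {ψ : Arc → ℤ} {l : List (Bool × Arc)} (h : ∀ c ∈ l, ψ c.2 = 0) :
    eval ψ l = 0 := by
  induction l with
  | nil => rfl
  | cons c l ih =>
    rw [eval_cons, ih fun c hc => h c (List.mem_cons_of_mem _ hc), h c List.mem_cons_self]
    simp

lemma sub₀_units : ∀ u ∈ units, ∀ c ∈ sub₀ (0, u), c.2.2 ∈ units ∧
    N5 (32 - qa c.2.1) (qb c.2.1) ∧ N5 (5 - qa c.2.1) (-qb c.2.1) := by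
  decide +kernel

lemma Vanishes.pull {δ : ℝ} (hδ : 0 ≤ δ) {ψ : Arc → ℤ} (h : Vanishes δ ψ) :
    Vanishes (δ / 2) (pull ψ) := by
  rintro ⟨x, u⟩ hu ⟨h1, h2⟩
  apply eval_eq_zero
  intro c hc
  have e : ((x, u) : Arc) = arcAct 0 x (0, u) := by simp [arcAct]
  rw [arcSub, e, sub₀_act, chainMap_chainMap, chainMap, List.mem_map] at hc
  obtain ⟨c, hc, rfl⟩ := hc
  obtain ⟨hu', h3, h4⟩ := sub₀_units u hu c hc
  have e : (arcAct 0 (-rot (rot (-5, 2, 1, 2))) ∘ arcAct 0 (infl x)) c.2 =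
      (inflPos x + c.2.1, c.2.2) := by
    simp only [Function.comp, arcAct, inflPos]
    simp only [Function.iterate_zero, id]
    congr 1; abel
  simp only [e]
  apply h (inflPos x + c.2.1, c.2.2) hu'
  have h3 := norm_lc_le h3 (r := 4) (by norm_num) (by norm_num)
  have h4 := norm_lc_neg_le h4 (r := 2) (by norm_num) (by norm_num)
  have h5 := norm_lc_cen_ge x c.2.1
  have h6 := norm_lc_neg_cen_le x c.2.1
  constructor <;> simp only at h1 h2 ⊢ <;> linarith

lemma Vanishes.pull_iter {δ : ℝ} (hδ : 0 ≤ δ) {ψ : Arc → ℤ} (h : Vanishes δ ψ) (n : ℕ) :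
    Vanishes (δ / 2 ^ n) (HatFamily.pull^[n] ψ) := by
  induction n with
  | zero => simpa using h
  | succ n ih =>
    rw [Function.iterate_succ_apply', pow_succ, ← div_div]
    exact ih.pull (by positivity)

lemma baseSt_arcs : ∀ c ∈ baseSt.bd, ∀ c' ∈ arcSub c.2, ∀ c'' ∈ arcSub c'.2,
    c''.2.2 ∈ units ∧ N5 (qa (cen c''.2.1) - 54) (-qb (cen c''.2.1)) ∧
      N5 (280 - qa (cen c''.2.1)) (-qb (cen c''.2.1)) := by
  decide +kernel

lemma exists_eval_pull_eq_zero {δ : ℝ} (hδ : 0 ≤ δ) :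
    ∃ n₀, ∀ n ≥ n₀, ∀ ψ, Vanishes δ ψ → eval (pull^[n] ψ) baseSt.bd = 0 := by
  obtain ⟨m, hm⟩ := pow_unbounded_of_one_lt (10 * δ) (one_lt_two (α := ℝ))
  refine ⟨m + 2, fun n hn ψ hψ => ?_⟩
  obtain ⟨k, rfl⟩ : ∃ k, n = (m + k) + 2 := ⟨n - (m + 2), by omega⟩
  rw [Function.iterate_succ_apply', Function.iterate_succ_apply']
  have hv := hψ.pull_iter hδ (m + k)
  refine eval_eq_zero fun c hc => eval_eq_zero fun c' hc' => eval_eq_zero fun c'' hc'' => ?_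
  obtain ⟨h1, h2, h3⟩ := baseSt_arcs c hc c' hc' c'' hc''
  refine hv _ h1 ⟨?_, norm_lc_neg_le h3 (by norm_num) (by norm_num)⟩
  refine le_trans ?_ (le_norm_lc h2 (r := 5.1) (by norm_num))
  have : δ / 2 ^ (m + k) ≤ 0.1 := by
    rw [div_le_iff₀ (by positivity), pow_add]
    nlinarith [one_le_pow₀ (one_le_two (α := ℝ)) (n := k)]
  linarith

lemma Pl.exists_vert_le {β : ℝ} (hβ : Adm β) (t : Pl) (f : ℂ →L[ℝ] ℝ) {z : ℂ}
    (hz : z ∈ t.toIso β '' tile β) : ∃ i, f (zpt β (t.vert i)) ≤ f z := by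
  have hc : IsCompact (t.toIso β '' tile β) :=
    (isCompact_tile hβ.1).image (t.toIso β).continuous
  obtain ⟨_, ⟨w, hw, rfl⟩, hmin⟩ := hc.exists_isMinOn ⟨z, hz⟩ f.continuous.continuousOn
  suffices h : ∃ i, f (zpt β (t.vert i)) ≤ f (t.toIso β w) by
    obtain ⟨i, hi⟩ := h
    exact ⟨i, hi.trans (hmin hz)⟩
  rcases tile_cases hβ w with ⟨h, -⟩ | ⟨h, -⟩ | ⟨i, s, hs, h, -⟩ | ⟨i, rfl, -⟩
  · exact absurd hw h
  · have h1 : t.toIso β '' tile β ∈ 𝓝 (t.toIso β w) :=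
      (t.toIso β).toHomeomorph.isOpenMap.image_mem_nhds (mem_interior_iff_mem_nhds.1 h)
    have h2 : IsLocalMin f (t.toIso β w) := hmin.isLocalMin h1
    have h3 := h2.fderiv_eq_zero
    rw [f.fderiv] at h3
    exact ⟨0, by simp [h3]⟩
  · have h1 : t.toIso β w = zpt β (t.vert i) + s * (zpt β (t.vert (i + 1)) - zpt β (t.vert i)) := by
      have h1 := iso_add (t.toIso β) (vt β i) (vt β (i + 1) - vt β i)
      rw [add_sub_cancel] at h1
      rw [h, iso_add, lp_mul, ← t.toIso_vt, ← t.toIso_vt, h1, add_sub_cancel_left]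
    have h2 : f (t.toIso β w) = f (zpt β (t.vert i)) +
        s * (f (zpt β (t.vert (i + 1))) - f (zpt β (t.vert i))) := by
      rw [h1, ← Complex.real_smul, map_add, map_smul, map_sub, smul_eq_mul]
    rcases le_total (f (zpt β (t.vert i))) (f (zpt β (t.vert (i + 1)))) with h3 | h3
    · exact ⟨i, by rw [h2]; nlinarith [hs.1]⟩
    · exact ⟨i + 1, by rw [h2]; nlinarith [hs.2]⟩
  · exact ⟨i, by rw [t.toIso_vt]⟩

/-- The linear form `sd d` as a continuous linear map. -/
def sdCLM (d : Fin 12) : ℂ →L[ℝ] ℝ := (cX d : ℝ) • reCLM + (cY d / r3 : ℝ) • imCLM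

lemma sdCLM_apply (d : Fin 12) (z : ℂ) : sdCLM d z = sd d z := by
  simp [sdCLM, sd, yc]; ring

/-- Twenty times the displacement from the centre of the prototile. -/
def fromCtr (v : V) : V := (20 * v.1 - 41, 20 * v.2.1 + 6, 20 * v.2.2.1, 20 * v.2.2.2)

lemma zpt_fromCtr (β : ℝ) (v : V) : zpt β (fromCtr v) = 20 * (zpt β v - ctr) := by
  apply Complex.ext <;> simp [zpt, fromCtr, ctr] <;> ring

/-- A separation criterion for a placed tile to miss the centre of the prototile. -/
abbrev Pl.Excl (t : Pl) : Prop :=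
  ∃ d : Fin 12, ∀ i : Fin 14, Ps (s0 d (fromCtr (t.vert i))) (s1 d (fromCtr (t.vert i)))

lemma Pl.Excl.not_mem {t : Pl} (h : t.Excl) {β : ℝ} (hβ : Adm β) :
    ctr ∉ t.toIso β '' tile β := by
  intro hz
  obtain ⟨d, hd⟩ := h
  obtain ⟨i, hi⟩ := t.exists_vert_le hβ (sdCLM d) hz
  rw [sdCLM_apply, sdCLM_apply] at hi
  have h1 := (hd i).pos hβ.1
  have h2 := sd_zpt β d (fromCtr (t.vert i))
  have h3 := sd_smul d 20 (zpt β (t.vert i) - ctr)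
  rw [zpt_fromCtr] at h2
  push_cast at h3
  rw [h3, sd_sub] at h2
  linarith

lemma norm_zpt_le {β : ℝ} (hβ : Adm β) (x : V) :
    ‖zpt β x‖ ≤ |(x.1 : ℝ)| + |(x.2.1 : ℝ)| + 1.2 * (|(x.2.2.1 : ℝ)| + |(x.2.2.2 : ℝ)|) := by
  have e : zpt β x = (x.1 : ℝ) + (x.2.1 : ℝ) * om + I * ((r3 * β : ℝ) *
      ((x.2.2.1 : ℝ) + (x.2.2.2 : ℝ) * om)) := by
    have := r3_sq
    apply Complex.ext <;> simp [zpt, om]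
    · linear_combination (-β * x.2.2.2 / 2 : ℝ) * -this
    · ring
  have hr : r3 * β ≤ 1.2 := by
    have h1 := r3_sq
    have h2 := r3_pos
    have h3 : r3 ≤ 1.8 := by nlinarith
    nlinarith [hβ.1.1, hβ.1.2]
  have hr0 : 0 ≤ r3 * β := mul_nonneg r3_pos.le (by linarith [hβ.1.1])
  have hn (a b : ℝ) : ‖(a : ℂ) + b * om‖ ≤ |a| + |b| := by
    refine (norm_add_le _ _).trans ?_
    rw [norm_mul, norm_om, mul_one, norm_real, norm_real, Real.norm_eq_abs, Real.norm_eq_abs]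
  rw [e]
  refine (norm_add_le _ _).trans (add_le_add (hn _ _) ?_)
  rw [norm_mul, norm_I, one_mul, norm_mul, norm_real, Real.norm_eq_abs, abs_of_nonneg hr0]
  exact mul_le_mul hr (hn _ _) (norm_nonneg _) (by norm_num)

lemma norm_fv_le {β : ℝ} (hβ : Adm β) (i : Fin 14) : ‖zpt β (fv i)‖ ≤ 6.4 := by
  refine (norm_zpt_le hβ _).trans ?_
  fin_cases i <;> norm_num [fv, abs_of_nonneg, abs_of_neg]

lemma Pl.norm_sub_le {β : ℝ} (hβ : Adm β) (t : Pl) {z : ℂ} (hz : z ∈ t.toIso β '' tile β) :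
    ‖z - zpt β t.x‖ ≤ 6.4 := by
  set w := z - zpt β t.x with hw
  obtain ⟨i, hi⟩ := t.exists_vert_le hβ (innerSL ℝ (-w)) hz
  have h0 : t.toIso β 0 = zpt β t.x := by simp [Pl.iso]
  have h1 : ‖zpt β (t.vert i) - zpt β t.x‖ ≤ 6.4 := by
    rw [← t.toIso_vt, ← h0, ← dist_eq_norm, (t.toIso β).dist_eq, dist_zero_right]
    exact norm_fv_le hβ i
  have h2 : inner ℝ w (z - zpt β (t.vert i)) ≤ 0 := by
    simp only [innerSL_apply_apply, inner_neg_left] at hi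
    rw [inner_sub_right]; linarith
  have h3 : ‖w‖ ^ 2 = inner ℝ w (z - zpt β (t.vert i)) +
      inner ℝ w (zpt β (t.vert i) - zpt β t.x) := by
    rw [← inner_add_right, sub_add_sub_cancel, ← hw, real_inner_self_eq_norm_sq]
  have h4 := real_inner_le_norm w (zpt β (t.vert i) - zpt β t.x)
  by_contra! h5
  nlinarith

/-- A decidable sufficient condition for a cluster to be far. -/
abbrev St.Far (t : St) : Prop := N5 (qa (cen t.x) - 3872) (-qb (cen t.x)) ∧
  N5 (288 - qa (cen t.x)) (-qb (cen t.x))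

lemma St.Far.farPos {t : St} (h : t.Far) : FarPos 44 t.x :=
  ⟨le_norm_lc h.1 (by norm_num), norm_lc_neg_le h.2 (by norm_num) (by norm_num)⟩

/-- All descendants of the cluster are certified, within the given number of steps, to miss the
centre of the prototile. -/
def St.misses : ℕ → St → Bool
  | 0, t => decide t.Far
  | f + 1, t => decide t.Far || (t.tiles.all fun p => decide p.Excl) && t.next.all (St.misses f)

lemma ring₁_misses : ∀ t ∈ ring₁, t.misses 6 = true := by decide +kernel

lemma children_bound : ∀ c, ∀ d ∈ children c,
    N5 (144 - qa d.x) (qb d.x) ∧ N5 (21 - qa d.x) (-qb d.x) := by decide +kernel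

lemma farPos_next {t : St} (h : FarPos 44 t.x) {d : St} (hd : d ∈ t.next) : FarPos 44 d.x := by
  obtain ⟨d, hd', rfl⟩ := List.mem_map.1 hd
  obtain ⟨h1, h2⟩ := children_bound _ d hd'
  have h1 := norm_lc_le h1 (r := 8.5) (by norm_num) (by norm_num)
  have h2 := norm_lc_neg_le h2 (r := 3.25) (by norm_num) (by norm_num)
  have h5 := norm_lc_cen_ge t.x (rot^[t.k + 2] d.x)
  have h6 := norm_lc_neg_cen_le t.x (rot^[t.k + 2] d.x)
  rw [norm_lc_rot_iter] at h5 h6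
  obtain ⟨h3, h4⟩ := h
  constructor <;> simp only <;> linarith

lemma norm_zc_sub_ctr {β : ℝ} (hβ : Adm β) : ‖zc β - ctr‖ ≤ 3.55 := by
  have h : zpt β (-11, 36, 10, -10) = 20 * (zc β - ctr) := by
    apply Complex.ext <;> simp [zpt, zc, ctr] <;> ring
  have h1 := norm_zpt_le hβ (-11, 36, 10, -10)
  rw [h, norm_mul, Complex.norm_ofNat] at h1
  norm_num at h1
  linarith

lemma FarPos.ctr_not_mem {β : ℝ} (hβ : Adm β) {t : St} (h : FarPos 44 t.x) {p : Pl}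
    (hp : p ∈ t.tiles) : ctr ∉ p.toIso β '' tile β := by
  intro hz
  have h1 := h.le_norm (β := β) (by linarith [hβ.1.1]) (by norm_num)
  have h2 := p.norm_sub_le hβ hz
  have h3 := norm_zc_sub_ctr hβ
  have h4 : ‖zpt β p.x - zpt β t.x‖ ≤ 4.2 := by
    have key : ∀ k, ‖zpt β (rot^[k] (0, 3, 0, 1))‖ ≤ 4.2 := fun k => by
      rw [zpt_rot_iter, norm_mul, norm_pow, norm_om, one_pow, one_mul]
      refine (norm_zpt_le hβ _).trans ?_
      norm_num
    unfold St.tiles at hp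
    split_ifs at hp <;> simp only [List.mem_cons, List.not_mem_nil, or_false] at hp
    · rcases hp with rfl | rfl
      · simp; norm_num
      · simpa [zpt_add] using key t.k
    · subst hp; simp; norm_num
  have h5 : zpt β t.x - zc β = -(zpt β p.x - zpt β t.x) - (ctr - zpt β p.x) - (zc β - ctr) := by
    ring
  have h6 := norm_sub_le (-(zpt β p.x - zpt β t.x) - (ctr - zpt β p.x)) (zc β - ctr)
  have h7 := norm_sub_le (-(zpt β p.x - zpt β t.x)) (ctr - zpt β p.x)
  rw [← h5] at h6
  rw [norm_neg] at h7
  linarith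

lemma St.ctr_not_mem_of_misses {β : ℝ} (hβ : Adm β) {t : St}
    (h : FarPos 44 t.x ∨ ∃ f, t.misses f = true) {p : Pl} (hp : p ∈ t.tiles) :
    ctr ∉ p.toIso β '' tile β := by
  rcases h with h | ⟨_ | f, h⟩
  · exact h.ctr_not_mem hβ hp
  · exact (of_decide_eq_true h : t.Far).farPos.ctr_not_mem hβ hp
  · rw [St.misses, Bool.or_eq_true, Bool.and_eq_true, List.all_eq_true] at h
    rcases h with h | ⟨h, -⟩
    · exact (of_decide_eq_true h : t.Far).farPos.ctr_not_mem hβ hp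
    · exact (of_decide_eq_true (h p hp) : p.Excl).not_mem hβ

lemma St.misses_next {t : St} (h : FarPos 44 t.x ∨ ∃ f, t.misses f = true) {d : St}
    (hd : d ∈ t.next) : FarPos 44 d.x ∨ ∃ f, d.misses f = true := by
  rcases h with h | ⟨_ | f, h⟩
  · exact .inl (farPos_next h hd)
  · exact .inl (farPos_next (of_decide_eq_true h : t.Far).farPos hd)
  · rw [St.misses, Bool.or_eq_true, Bool.and_eq_true, List.all_eq_true, List.all_eq_true] at h
    rcases h with h | ⟨-, h⟩
    · exact .inl (farPos_next (of_decide_eq_true h : t.Far).farPos hd)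
    · exact .inr ⟨f, h d hd⟩

lemma outer_misses (n : ℕ) : ∀ t ∈ outer n, FarPos 44 t.x ∨ ∃ f, t.misses f = true := by
  induction n with
  | zero => simp [outer]
  | succ n ih =>
    intro t ht
    rw [outer, List.mem_append, List.mem_flatMap] at ht
    rcases ht with ht | ⟨s, hs, ht⟩
    · exact .inr ⟨6, ring₁_misses t ht⟩
    · exact St.misses_next (ih s hs) ht

lemma ctr_not_mem_outer {β : ℝ} (hβ : Adm β) {n : ℕ} {t : St} (ht : t ∈ outer n) {p : Pl}
    (hp : p ∈ t.tiles) : ctr ∉ p.toIso β '' tile β :=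
  St.ctr_not_mem_of_misses hβ (outer_misses n t ht) hp

/-- The form `sd d` based at the vertex `m` is positive on the open edge `i`, and not positive
on the edge `j`. -/
abbrev SepE (d : Fin 12) (m i j : Fin 14) : Prop :=
  let p (k : Fin 14) := Nn (s0 d (fv k - fv m)) (s1 d (fv k - fv m))
  let q (k : Fin 14) := Ps (s0 d (fv k - fv m)) (s1 d (fv k - fv m))
  let n (k : Fin 14) := Nn (s0 d (fv m - fv k)) (s1 d (fv m - fv k))
  p i ∧ p (i + 1) ∧ (q i ∨ q (i + 1)) ∧ n j ∧ n (j + 1)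

lemma exists_sepE : ∀ i j : Fin 14, i ≠ j → ∃ d m, SepE d m i j ∨ SepE d m j i := by
  decide +kernel

lemma SepE.false {d : Fin 12} {m i j : Fin 14} (h : SepE d m i j) {β : ℝ} (hβ : Adm β) {y : ℂ}
    (hi : y ∈ openSegment ℝ (vt β i) (vt β (i + 1)))
    (hj : y ∈ openSegment ℝ (vt β j) (vt β (j + 1))) : False := by
  obtain ⟨a1, a2, a3, b1, b2⟩ := h
  have hp (k : Fin 14) : sdCLM d (vt β k) - sdCLM d (vt β m) = sd d (zpt β (fv k - fv m)) := by
    rw [zpt_sub, sd_sub, sdCLM_apply, sdCLM_apply]; rfl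
  have hn (k : Fin 14) : sdCLM d (vt β m) - sdCLM d (vt β k) = sd d (zpt β (fv m - fv k)) := by
    rw [zpt_sub, sd_sub, sdCLM_apply, sdCLM_apply]; rfl
  simp only [sd_zpt] at hp hn
  obtain ⟨s, s', hs, hs', hss, rfl⟩ := hi
  obtain ⟨t, t', ht, ht', htt, hy⟩ := hj
  have hy := congrArg (sdCLM d) hy
  simp only [map_add, map_smul, smul_eq_mul] at hy
  have a1 := (hp i).trans_ge (div_nonneg (a1.nonneg hβ.1) zero_le_two)
  have a2 := (hp (i + 1)).trans_ge (div_nonneg (a2.nonneg hβ.1) zero_le_two)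
  have b1 := (hn j).trans_ge (div_nonneg (b1.nonneg hβ.1) zero_le_two)
  have b2 := (hn (j + 1)).trans_ge (div_nonneg (b2.nonneg hβ.1) zero_le_two)
  have e1 : s * sdCLM d (vt β i) + s' * sdCLM d (vt β (i + 1)) - sdCLM d (vt β m) =
      s * (sdCLM d (vt β i) - sdCLM d (vt β m)) +
      s' * (sdCLM d (vt β (i + 1)) - sdCLM d (vt β m)) := by
    linear_combination sdCLM d (vt β m) * hss
  have e2 : sdCLM d (vt β m) - (t * sdCLM d (vt β j) + t' * sdCLM d (vt β (j + 1))) =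
      t * (sdCLM d (vt β m) - sdCLM d (vt β j)) +
      t' * (sdCLM d (vt β m) - sdCLM d (vt β (j + 1))) := by
    linear_combination -sdCLM d (vt β m) * htt
  have b3 := mul_nonneg ht.le b1
  have b4 := mul_nonneg ht'.le b2
  have a4 := mul_nonneg hs.le a1
  have a5 := mul_nonneg hs'.le a2
  rcases a3 with a3 | a3
  · have a3 := (hp i).trans_gt (div_pos (a3.pos hβ.1) zero_lt_two)
    have := mul_pos hs a3
    linarith
  · have a3 := (hp (i + 1)).trans_gt (div_pos (a3.pos hβ.1) zero_lt_two)
    have := mul_pos hs' a3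
    linarith

lemma edge_unique {β : ℝ} (hβ : Adm β) {i j : Fin 14} {y : ℂ}
    (hi : y ∈ openSegment ℝ (vt β i) (vt β (i + 1)))
    (hj : y ∈ openSegment ℝ (vt β j) (vt β (j + 1))) : i = j := by
  by_contra hij
  obtain ⟨d, m, h | h⟩ := exists_sepE i j hij
  · exact h.false hβ hi hj
  · exact h.false hβ hj hi

/-- The open edge `i` of a placed tile. -/
def Pl.seg (β : ℝ) (t : Pl) (i : Fin 14) : Set ℂ :=
  openSegment ℝ (zpt β (t.vert i)) (zpt β (t.vert (i + 1)))

lemma Pl.mem_seg_iff {β : ℝ} {t : Pl} {i : Fin 14} {y : ℂ} :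
    y ∈ t.seg β i ↔ (t.toIso β).symm y ∈ openSegment ℝ (vt β i) (vt β (i + 1)) := by
  have h (s : ℝ) : t.toIso β (vt β i + s • (vt β (i + 1) - vt β i)) =
      zpt β (t.vert i) + s • (zpt β (t.vert (i + 1)) - zpt β (t.vert i)) := by
    have h1 := iso_add (t.toIso β) (vt β i) (vt β (i + 1) - vt β i)
    rw [add_sub_cancel] at h1
    rw [Complex.real_smul, Complex.real_smul, iso_add, lp_mul, ← t.toIso_vt, ← t.toIso_vt, h1,
      add_sub_cancel_left]
  simp only [Pl.seg, openSegment_eq_image', Set.mem_image, ← h]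
  refine exists_congr fun s => and_congr_right fun _ => ?_
  rw [IsometryEquiv.eq_symm_apply]

lemma Pl.seg_unique {β : ℝ} (hβ : Adm β) {t : Pl} {i j : Fin 14} {y : ℂ}
    (hi : y ∈ t.seg β i) (hj : y ∈ t.seg β j) : i = j :=
  edge_unique hβ (Pl.mem_seg_iff.1 hi) (Pl.mem_seg_iff.1 hj)

lemma Pl.near_seg {β : ℝ} (hβ : Adm β) {t : Pl} {i : Fin 14} {y : ℂ} (hy : y ∈ t.seg β i) :
    ∀ᶠ z in 𝓝 y, z ∈ t.toIso β '' tile β ↔ 0 ≤ lft (zpt β (t.src i)) (zpt β (t.tgt i)) z := by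
  have hy : y ∈ openSegment ℝ (zpt β (t.src i)) (zpt β (t.tgt i)) := by
    unfold Pl.src Pl.tgt
    split_ifs
    · rw [openSegment_symm]; exact hy
    · exact hy
  rw [openSegment_eq_image'] at hy
  obtain ⟨s, hs, rfl⟩ := hy
  simpa using near_edge hβ t i hs

open Classical in
/-- The weight counting the arcs through `y` that have `z` on their left. -/
def wt (β : ℝ) (y z : ℂ) (e : Arc) : ℤ :=
  if y ∈ openSegment ℝ (zpt β e.1) (zpt β (e.1 + e.2)) ∧ 0 < lft (zpt β e.1) (zpt β (e.1 + e.2)) z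
  then 1 else 0

/-- Points on no line through two positions. -/
def generic (β : ℝ) : Set ℂ := {z | ∀ a b : V, a ≠ b → lft (zpt β a) (zpt β b) z ≠ 0}

open Classical in
/-- The indicator function of a placed tile. -/
def Pl.ind (β : ℝ) (t : Pl) (z : ℂ) : ℤ := if z ∈ t.toIso β '' tile β then 1 else 0

lemma hx_sq (i : Fin 14) : (i.val % 2 = 0 ∧ hx i = i ∧ sq i = i + 1) ∨
    (i.val % 2 = 1 ∧ hx i = i + 1 ∧ sq i = i) := by
  unfold hx sq; split_ifs with h
  · exact .inl ⟨h, rfl, rfl⟩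
  · exact .inr ⟨by omega, rfl, rfl⟩

/-- The contribution of an edge to the evaluation of a boundary chain. -/
lemma eval_bd (ψ : Arc → ℤ) (t : Pl) : eval ψ t.bd = ∑ i : Fin 14,
    if xor (decide (i.val % 2 = 0)) t.s then ψ (t.vert (hx i), t.vert (sq i) - t.vert (hx i))
      else -ψ (t.vert (hx i), t.vert (sq i) - t.vert (hx i)) := by
  rw [Fin.sum_univ_def, eval, Pl.bd, List.map_map]
  congr 1
  apply List.map_congr_left
  intro i _
  have : lin t.s t.k (fv (sq i) - fv (hx i)) = t.vert (sq i) - t.vert (hx i) := by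
    simp only [Pl.vert, Pl.act, lin_sub]; abel
  simp only [Function.comp, this]

lemma Pl.wt_eq_zero {β : ℝ} {t : Pl} {i : Fin 14} {y : ℂ} (h : y ∉ t.seg β i) (z : ℂ) :
    wt β y z (t.vert (hx i), t.vert (sq i) - t.vert (hx i)) = 0 := by
  rw [wt, if_neg]
  rintro ⟨h1, -⟩
  simp only [add_sub_cancel] at h1
  rcases hx_sq i with ⟨-, e1, e2⟩ | ⟨-, e1, e2⟩ <;> rw [e1, e2] at h1
  · exact h h1
  · exact h (by rwa [openSegment_symm] at h1)

lemma Pl.exists_ind_eq {β : ℝ} (hβ : Adm β) (t : Pl) {y : ℂ} (hy : y ∉ Set.range (zpt β)) :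
    ∃ C : ℤ, ∀ᶠ z in 𝓝 y, z ∈ generic β → t.ind β z = C + eval (wt β y z) t.bd := by
  by_cases hseg : ∃ i, y ∈ t.seg β i
  · obtain ⟨i, hi⟩ := hseg
    have hsum (z : ℂ) : eval (wt β y z) t.bd = if xor (decide (i.val % 2 = 0)) t.s then
        wt β y z (t.vert (hx i), t.vert (sq i) - t.vert (hx i))
        else -wt β y z (t.vert (hx i), t.vert (sq i) - t.vert (hx i)) := by
      rw [eval_bd]
      refine Finset.sum_eq_single i (fun j _ hj => ?_) (by simp)
      rw [Pl.wt_eq_zero (fun h => hj (Pl.seg_unique hβ h hi)) z]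
      simp
    refine ⟨if xor (decide (i.val % 2 = 0)) t.s then 0 else 1, ?_⟩
    filter_upwards [Pl.near_seg hβ hi] with z hz hg
    have h1 := hg _ _ fun h => succ_ne i (t.vert_injective hβ h).symm
    have hi' : y ∈ openSegment ℝ (zpt β (t.vert (i + 1))) (zpt β (t.vert i)) := by
      rw [openSegment_symm]; exact hi
    have hi : y ∈ openSegment ℝ (zpt β (t.vert i)) (zpt β (t.vert (i + 1))) := hi
    have h2 := lft_swap (zpt β (t.vert i)) (zpt β (t.vert (i + 1))) z
    rw [hsum, Pl.ind, hz]
    unfold Pl.src Pl.tgt wt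
    rcases hx_sq i with ⟨e0, e1, e2⟩ | ⟨e0, e1, e2⟩ <;> rw [e1, e2] <;> cases hs : t.s <;>
      simp [e0, hi, hi', h2] <;> grind
  · push Not at hseg
    have h0 (z : ℂ) : eval (wt β y z) t.bd = 0 := by
      rw [eval_bd]
      refine Finset.sum_eq_zero fun j _ => ?_
      rw [Pl.wt_eq_zero (hseg j) z]
      simp
    simp only [h0, add_zero]
    have hy' : t.toIso β ((t.toIso β).symm y) = y := (t.toIso β).apply_symm_apply y
    rcases tile_cases hβ ((t.toIso β).symm y) with ⟨h, -⟩ | ⟨h, -⟩ | ⟨i, s, hs, h, -⟩ | ⟨i, h, -⟩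
    · refine ⟨0, ?_⟩
      have : (t.toIso β '' tile β)ᶜ ∈ 𝓝 y :=
        (isClosed_image β _).isOpen_compl.mem_nhds (by rwa [Set.mem_compl_iff, mem_image_iff])
      filter_upwards [this] with z hz _
      exact if_neg hz
    · refine ⟨1, ?_⟩
      have : t.toIso β '' tile β ∈ 𝓝 y := by
        rw [← hy']
        exact (t.toIso β).toHomeomorph.isOpenMap.image_mem_nhds (mem_interior_iff_mem_nhds.1 h)
      filter_upwards [this] with z hz _
      exact if_pos hz
    · refine absurd (Pl.mem_seg_iff.2 ?_) (hseg i)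
      rw [h, openSegment_eq_image']
      exact ⟨s, hs, by simp⟩
    · refine absurd ⟨t.vert i, ?_⟩ hy
      rw [← t.toIso_vt, ← h, hy']

lemma dense_lft_ne_zero {a b : ℂ} (h : a ≠ b) : Dense {z | lft a b z ≠ 0} := by
  intro z
  by_cases hz : lft a b z = 0
  · have hc : Tendsto (fun s : ℝ => z + s * (I * (b - a))) (𝓝[>] 0) (𝓝 z) := by
      have : Continuous fun s : ℝ => z + s * (I * (b - a)) := by fun_prop
      simpa using this.continuousWithinAt.tendsto (x := (0 : ℝ)) (s := Set.Ioi 0)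
    refine mem_closure_of_tendsto hc ?_
    filter_upwards [self_mem_nhdsWithin] with s hs
    have e : lft a b (z + s * (I * (b - a))) = lft a b z + s * normSq (b - a) := by
      simp [lft, normSq_apply]; ring
    rw [e, hz, zero_add]
    exact mul_ne_zero (ne_of_gt hs) (normSq_pos.2 (sub_ne_zero.2 h.symm)).ne'
  · exact subset_closure hz

lemma continuous_lft (a b : ℂ) : Continuous (lft a b) := by
  unfold lft; fun_prop

lemma dense_generic {β : ℝ} (hβ : Irrational β) : Dense (generic β) := by
  have e : generic β = ⋂ p : {p : V × V // p.1 ≠ p.2},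
      {z | lft (zpt β p.1.1) (zpt β p.1.2) z ≠ 0} := by
    ext z
    simp [generic]
  rw [e]
  refine dense_iInter_of_isOpen (fun p => ?_) fun p => dense_lft_ne_zero fun h =>
    p.2 (zpt_injective hβ h)
  exact isOpen_ne_fun (continuous_lft _ _) continuous_const

lemma notMem_range_of_generic {β : ℝ} {z : ℂ} (hz : z ∈ generic β) : z ∉ Set.range (zpt β) := by
  rintro ⟨a, rfl⟩
  refine hz a (a + (1, 0, 0, 0)) (by simp) ?_
  simp [lft]

lemma isPreconnected_ball_diff (c : ℂ) {r : ℝ} (hr : 0 < r) {s : Set ℂ} (hs : s.Countable) :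
    IsPreconnected (Metric.ball c r \ s) := by
  set φ := OpenPartialHomeomorph.univBall (E := ℂ) c r
  have hφ : φ.source = Set.univ := OpenPartialHomeomorph.univBall_source c r
  have hi : Set.InjOn φ Set.univ := hφ ▸ φ.injOn
  have h1 : (φ ⁻¹' s).Countable := hs.preimage_of_injOn (hi.mono (Set.subset_univ _))
  have h2 : IsPreconnected (φ ⁻¹' s)ᶜ :=
    (h1.isConnected_compl_of_one_lt_rank (by rw [rank_real_complex]; norm_num)).isPreconnected
  have h3 := h2.image φ ((hφ ▸ φ.continuousOn).mono (Set.subset_univ _))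
  have h4 := φ.image_source_eq_target
  rw [hφ, OpenPartialHomeomorph.univBall_target c hr] at h4
  convert h3 using 1
  rw [← h4]
  ext x
  constructor
  · rintro ⟨⟨w, -, rfl⟩, h⟩
    exact ⟨w, h, rfl⟩
  · rintro ⟨w, h, rfl⟩
    exact ⟨⟨w, trivial, rfl⟩, h⟩

/-- The placed tiles of the iterated substitution of the base tile. -/
def patchTiles (n : ℕ) : List Pl := (patch n).flatMap St.tiles

/-- The number of placed tiles containing `z`. -/
def mult (β : ℝ) (n : ℕ) (z : ℂ) : ℤ := ((patchTiles n).map fun p => p.ind β z).sum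

lemma sum_eval_bd (ψ : Arc → ℤ) (n : ℕ) :
    ((patchTiles n).map fun p => eval ψ p.bd).sum = eval (pull^[n] ψ) baseSt.bd := by
  rw [← eval_patch, ← eval_flatMap, ← eval_flatMap, patchTiles, List.flatMap_assoc]
  rfl

lemma exists_sum_ind_eq {β : ℝ} (hβ : Adm β) (l : List Pl) {y : ℂ} (hy : y ∉ Set.range (zpt β)) :
    ∃ C : ℤ, ∀ᶠ z in 𝓝 y, z ∈ generic β → (l.map fun p => p.ind β z).sum =
      C + (l.map fun p => eval (wt β y z) p.bd).sum := by
  induction l with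
  | nil => exact ⟨0, by simp⟩
  | cons p l ih =>
    obtain ⟨C, hC⟩ := ih
    obtain ⟨D, hD⟩ := p.exists_ind_eq hβ hy
    refine ⟨C + D, ?_⟩
    filter_upwards [hC, hD] with z h1 h2 hz
    rw [List.map_cons, List.map_cons, List.sum_cons, List.sum_cons, h1 hz, h2 hz]
    ring

lemma norm_units {β : ℝ} (hβ : Adm β) {u : V} (hu : u ∈ units) : ‖zpt β u‖ ≤ 1.2 := by
  simp only [units, List.mem_flatMap, List.mem_range, List.mem_cons, List.not_mem_nil, or_false]
    at hu
  obtain ⟨k, -, rfl | rfl⟩ := hu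
  all_goals
    rw [zpt_rot_iter, norm_mul, norm_pow, norm_om, one_pow, one_mul]
    refine (norm_zpt_le hβ _).trans ?_
    norm_num

lemma norm_sub_le_of_mem_openSegment {a u y : ℂ} (h : y ∈ openSegment ℝ a (a + u)) :
    ‖y - a‖ ≤ ‖u‖ := by
  rw [openSegment_eq_image'] at h
  obtain ⟨s, hs, rfl⟩ := h
  rw [add_sub_cancel_left, add_sub_cancel_left, norm_smul, Real.norm_of_nonneg hs.1.le]
  exact mul_le_of_le_one_left (norm_nonneg u) hs.2.le

lemma vanishes_wt {β : ℝ} (hβ : Adm β) {R : ℝ} {y : ℂ} (hy : y ∈ Metric.ball (zc β) R) (z : ℂ) :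
    Vanishes (3 * R + 13) (wt β y z) := by
  have hR := Metric.pos_of_mem_ball hy
  rintro ⟨a, u⟩ hu ha
  rw [wt, if_neg]
  rintro ⟨h, -⟩
  simp only [zpt_add] at h hu ha
  have h1 := norm_sub_le_of_mem_openSegment h
  have h2 := norm_units hβ hu
  have h3 := ha.le_norm (β := β) (by linarith [hβ.1.1]) (by linarith)
  rw [mem_ball_iff_norm] at hy
  have h4 : ‖zpt β a - zc β‖ ≤ ‖y - zpt β a‖ + ‖y - zc β‖ := by
    rw [← dist_eq_norm, ← dist_eq_norm, ← dist_eq_norm]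
    exact dist_triangle_left _ _ _
  linarith

lemma ind_baseSt {β : ℝ} {z : ℂ} (hz : z ∈ tileO β) : Pl.ind β ⟨false, 0, 0⟩ z = 1 := by
  rw [Pl.ind, if_pos]
  exact ⟨z, tileO_subset_tile hz, by simp [Pl.iso, zpt_zero]⟩

lemma patchTiles_eq (n : ℕ) : patchTiles n = ⟨false, 0, 0⟩ :: (outer n).flatMap St.tiles := rfl

lemma eventually_mult_ctr {β : ℝ} (hβ : Adm β) (n : ℕ) : ∀ᶠ z in 𝓝 ctr, mult β n z = 1 := by
  have h (l : List Pl) (hl : ∀ p ∈ l, ctr ∉ p.toIso β '' tile β) :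
      ∀ᶠ z in 𝓝 ctr, (l.map fun p => p.ind β z).sum = 0 := by
    induction l with
    | nil => simp
    | cons p l ih =>
      rw [List.forall_mem_cons] at hl
      filter_upwards [ih hl.2, (isClosed_image β (p.toIso β)).isOpen_compl.mem_nhds hl.1]
        with z h1 h2
      rw [List.map_cons, List.sum_cons, h1, add_zero]
      exact if_neg h2
  have h1 := h ((outer n).flatMap St.tiles) fun p hp => by
    obtain ⟨t, ht, hp⟩ := List.mem_flatMap.1 hp
    exact ctr_not_mem_outer hβ ht hp
  filter_upwards [h1, isOpen_tileO.mem_nhds (ctr_mem_tileO hβ.1)] with z h2 h3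
  rw [mult, patchTiles_eq, List.map_cons, List.sum_cons, h2, ind_baseSt h3, add_zero]

lemma exists_mult_eq_one {β : ℝ} (hβ : Adm β) {R : ℝ} (hR : 4 ≤ R) :
    ∃ n₀, ∀ n ≥ n₀, ∀ z ∈ Metric.ball (zc β) R, z ∈ generic β → mult β n z = 1 := by
  obtain ⟨n₀, hn₀⟩ := exists_eval_pull_eq_zero (δ := 3 * R + 13) (by linarith)
  refine ⟨n₀, fun n hn z hz hzg => ?_⟩
  have hd := dense_generic hβ.2
  set A := {y | ∀ᶠ z in 𝓝 y, z ∈ generic β → mult β n z = 1}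
  set B := {y | ∀ᶠ z in 𝓝 y, z ∈ generic β → mult β n z ≠ 1}
  have hA : IsOpen A := isOpen_setOfPred_eventually_nhds
  have hB : IsOpen B := isOpen_setOfPred_eventually_nhds
  have hAB : Disjoint A B := by
    rw [Set.disjoint_left]
    intro y h1 h2
    obtain ⟨w, hw, hwg⟩ := mem_closure_iff_nhds.1 (hd y) _ (h1.and h2)
    exact hw.2 hwg (hw.1 hwg)
  have hW : Metric.ball (zc β) R \ Set.range (zpt β) ⊆ A ∪ B := by
    rintro y ⟨hy, hy'⟩
    obtain ⟨C, hC⟩ := exists_sum_ind_eq hβ (patchTiles n) hy'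
    simp only [sum_eval_bd, hn₀ n hn _ (vanishes_wt hβ hy _), add_zero] at hC
    by_cases h : C = 1
    · rw [h] at hC; exact .inl hC
    · refine .inr (hC.mono fun w hw hwg => ?_)
      rw [mult, hw hwg]; exact h
  have hctr : ctr ∈ Metric.ball (zc β) R ∩ A := by
    refine ⟨?_, (eventually_mult_ctr hβ n).mono fun z hz _ => hz⟩
    rw [mem_ball_iff_norm']
    linarith [norm_zc_sub_ctr hβ]
  obtain ⟨w, hw, hwg⟩ := mem_closure_iff_nhds.1 (hd ctr) _
    ((Metric.isOpen_ball.inter hA).mem_nhds hctr)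
  have := (isPreconnected_ball_diff (zc β) (by linarith : 0 < R)
    (Set.countable_range (zpt β))).subset_left_of_subset_union hA hB hAB hW
    ⟨w, ⟨hw.1, notMem_range_of_generic hwg⟩, hw.2⟩ ⟨hz, notMem_range_of_generic hzg⟩
  exact this.self_of_nhds hzg

lemma outer_subset_succ (n : ℕ) : outer n ⊆ outer (n + 1) := by
  induction n with
  | zero => simp [outer]
  | succ n ih =>
    intro t ht
    rw [outer, List.mem_append, List.mem_flatMap] at ht ⊢
    exact ht.imp_right fun ⟨d, hd, h⟩ => ⟨d, ih hd, h⟩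

lemma patchTiles_mono {m n : ℕ} (h : m ≤ n) : patchTiles m ⊆ patchTiles n := by
  induction h with
  | refl => exact List.Subset.refl _
  | step _ ih =>
    refine List.Subset.trans ih fun p hp => ?_
    rw [patchTiles_eq, List.mem_cons, List.mem_flatMap] at hp ⊢
    exact hp.imp_right fun ⟨d, hd, h⟩ => ⟨d, outer_subset_succ _ hd, h⟩

lemma Pl.ind_nonneg (β : ℝ) (t : Pl) (z : ℂ) : 0 ≤ t.ind β z := by
  unfold Pl.ind; split_ifs <;> simp

lemma exists_mem_of_mult {β : ℝ} {n : ℕ} {z : ℂ} (h : mult β n z = 1) :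
    ∃ p ∈ patchTiles n, z ∈ p.toIso β '' tile β := by
  by_contra! hc
  rw [mult, List.sum_eq_zero] at h
  · exact zero_ne_one h
  · intro x hx
    obtain ⟨p, hp, rfl⟩ := List.mem_map.1 hx
    exact if_neg (hc p hp)

lemma eq_of_mult {β : ℝ} {n : ℕ} {z : ℂ} (h : mult β n z = 1) {p q : Pl}
    (hp : p ∈ patchTiles n) (hq : q ∈ patchTiles n) (hzp : z ∈ p.toIso β '' tile β)
    (hzq : z ∈ q.toIso β '' tile β) : p = q := by
  classical
  by_contra hpq
  have h1 := (List.perm_cons_erase hp).map fun p => p.ind β z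
  have h2 : q.ind β z ≤ (((patchTiles n).erase p).map fun p => p.ind β z).sum :=
    List.single_le_sum (by simp [Pl.ind_nonneg]) _ (List.mem_map_of_mem
      ((List.mem_erase_of_ne (Ne.symm hpq)).2 hq))
  rw [mult, h1.sum_eq, List.map_cons, List.sum_cons, Pl.ind, if_pos hzp] at h
  rw [Pl.ind, if_pos hzq] at h2
  linarith

/-- The prototile tiles the plane. -/
lemma exists_til {β : ℝ} (hβ : Adm β) : ∃ S, Til β S := by
  have hd := dense_generic hβ.2
  have key (x : ℂ) : ∃ R, 4 ≤ R ∧ x ∈ Metric.ball (zc β) R :=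
    ⟨‖x - zc β‖ + 4, by linarith [norm_nonneg (x - zc β)], by rw [mem_ball_iff_norm]; linarith⟩
  refine ⟨{g | ∃ n, ∃ p ∈ patchTiles n, p.toIso β = g}, fun x => ?_, ?_⟩
  · obtain ⟨R, hR, hx⟩ := key x
    obtain ⟨n, hn⟩ := exists_mult_eq_one hβ hR
    have hcl : IsClosed (⋃ p ∈ {p | p ∈ patchTiles n}, p.toIso β '' tile β) :=
      (List.finite_toSet _).isClosed_biUnion fun p _ => isClosed_image β _
    have hsub : Metric.ball (zc β) R ∩ generic β ⊆
        ⋃ p ∈ {p | p ∈ patchTiles n}, p.toIso β '' tile β := fun z hz => by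
      obtain ⟨p, hp, hz⟩ := exists_mem_of_mult (hn n le_rfl z hz.1 hz.2)
      exact Set.mem_biUnion hp hz
    have := hcl.closure_subset_iff.2 hsub (hd.open_subset_closure_inter Metric.isOpen_ball hx)
    obtain ⟨p, hp, hx⟩ := Set.mem_iUnion₂.1 this
    exact ⟨_, ⟨n, p, hp, rfl⟩, hx⟩
  · rintro _ ⟨m, p, hp, rfl⟩ _ ⟨m', q, hq, rfl⟩ hne
    rw [Set.disjoint_left]
    intro x hxp hxq
    obtain ⟨R, hR, hx⟩ := key x
    obtain ⟨n, hn⟩ := exists_mult_eq_one hβ hR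
    obtain ⟨z, ⟨⟨hzp, hzq⟩, hz⟩, hzg⟩ := mem_closure_iff_nhds.1 (hd x) _
      (((isOpen_interior.inter isOpen_interior).inter Metric.isOpen_ball).mem_nhds
        ⟨⟨hxp, hxq⟩, hx⟩)
    refine hne (congrArg _ (eq_of_mult (hn (n + m + m') (by omega) z hz hzg)
      (patchTiles_mono (by omega) hp) (patchTiles_mono (by omega) hq)
      (interior_subset hzp) (interior_subset hzq)))

/-- The identification of the complex plane with the Euclidean plane. -/
def toPlane : ℂ ≃ₗᵢ[ℝ] Plane := Complex.orthonormalBasisOneI.repr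

/-- The prototile in the Euclidean plane. -/
def proto (β : ℝ) : Set Plane := toPlane '' tile β

/-- Transport of isometries of the Euclidean plane to the complex plane. -/
def toCplx (g : Plane ≃ᵢ Plane) : ℂ ≃ᵢ ℂ :=
  toPlane.toIsometryEquiv.trans (g.trans toPlane.symm.toIsometryEquiv)

/-- Transport of isometries of the complex plane to the Euclidean plane. -/
def ofCplx (g : ℂ ≃ᵢ ℂ) : Plane ≃ᵢ Plane :=
  toPlane.symm.toIsometryEquiv.trans (g.trans toPlane.toIsometryEquiv)

lemma toCplx_apply (g : Plane ≃ᵢ Plane) (z : ℂ) : toCplx g z = toPlane.symm (g (toPlane z)) := rfl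

lemma ofCplx_apply (g : ℂ ≃ᵢ ℂ) (x : Plane) : ofCplx g x = toPlane (g (toPlane.symm x)) := rfl

lemma toCplx_image (g : Plane ≃ᵢ Plane) (β : ℝ) :
    toCplx g '' tile β = toPlane.symm '' (g '' proto β) := by
  rw [proto, Set.image_image, Set.image_image]
  rfl

lemma ofCplx_image (g : ℂ ≃ᵢ ℂ) (β : ℝ) : ofCplx g '' proto β = toPlane '' (g '' tile β) := by
  simp only [proto, Set.image_image, ofCplx_apply, LinearIsometryEquiv.symm_apply_apply]

lemma interior_image_equiv {E F : Type*} [NormedAddCommGroup E] [NormedSpace ℝ E]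
    [NormedAddCommGroup F] [NormedSpace ℝ F] (f : E ≃ₗᵢ[ℝ] F) (A : Set E) :
    interior (f '' A) = f '' interior A :=
  (f.toHomeomorph.image_interior A).symm

lemma isTiling_ofCplx {β : ℝ} {S : Set (ℂ ≃ᵢ ℂ)} (h : Til β S) :
    IsTiling (proto β) (ofCplx '' S) := by
  constructor
  · refine Set.eq_univ_of_forall fun x => ?_
    obtain ⟨g, hg, hx⟩ := h.cover (toPlane.symm x)
    rw [Set.mem_iUnion₂]
    refine ⟨_, ⟨g, hg, rfl⟩, ?_⟩
    rw [ofCplx_image]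
    exact ⟨_, hx, toPlane.apply_symm_apply x⟩
  · rintro _ ⟨g, hg, rfl⟩ _ ⟨k, hk, rfl⟩ hne
    rw [ofCplx_image, ofCplx_image, interior_image_equiv, interior_image_equiv,
      Set.disjoint_image_iff toPlane.injective]
    exact h.disj hg hk fun e => hne (e ▸ rfl)

lemma til_toCplx {β : ℝ} {S : Set (Plane ≃ᵢ Plane)} (h : IsTiling (proto β) S) :
    Til β (toCplx '' S) := by
  constructor
  · intro x
    have hx : toPlane x ∈ ⋃ g ∈ S, g '' proto β := h.1 ▸ Set.mem_univ _
    obtain ⟨g, hg, hx⟩ := Set.mem_iUnion₂.1 hx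
    refine ⟨_, ⟨g, hg, rfl⟩, ?_⟩
    rw [toCplx_image]
    exact ⟨_, hx, toPlane.symm_apply_apply x⟩
  · rintro _ ⟨g, hg, rfl⟩ _ ⟨k, hk, rfl⟩ hne
    rw [toCplx_image, toCplx_image, interior_image_equiv, interior_image_equiv,
      Set.disjoint_image_iff toPlane.symm.injective]
    exact h.2 hg hk fun e => hne (e ▸ rfl)

lemma not_tilingTransInvariant {β : ℝ} (hβ : Adm β) {S : Set (Plane ≃ᵢ Plane)}
    (hS : IsTiling (proto β) S) {v : Plane} (hv : v ≠ 0) :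
    ¬ TilingTransInvariant (proto β) S v := by
  intro h
  refine no_period hβ (til_toCplx hS) (v := toPlane.symm v) (by simpa using hv) ?_
  have h := congrArg (fun T => (fun A => toPlane.symm '' A) '' T) h
  simp only [Set.image_image, toCplx_image, map_add] at h ⊢
  exact h

lemma eq_of_areSimilar {β β' : ℝ} (hβ : Adm β) (hβ' : Adm β')
    (h : AreSimilar (proto β) (proto β')) : β = β' := by
  obtain ⟨c, g, b, hc, h⟩ := h
  refine eq_of_similar hβ hβ' hc.ne'
    (g := toCplx (g.toIsometryEquiv.trans (IsometryEquiv.addRight (c⁻¹ • b)))) ?_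
  have h := congrArg (fun T => toPlane.symm '' T) h
  simp only [proto, Set.image_image, LinearIsometryEquiv.symm_apply_apply, Set.image_id'] at h
  rw [← h]
  refine Set.image_congr fun z _ => ?_
  simp [toCplx_apply, mul_add, hc.ne']

lemma not_countable_adm : ¬ {β | Adm β}.Countable := by
  intro h
  have h1 : Set.Ioo (3 / 5 : ℝ) (2 / 3) ⊆ {β | Adm β} ∪ Set.range ((↑) : ℚ → ℝ) := fun β hβ => by
    by_cases h : Irrational β
    · exact .inl ⟨hβ, h⟩
    · exact .inr (not_not.1 h)
  have h2 := (h.union (Set.countable_range _)).mono h1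
  rw [Cardinal.Real.Ioo_countable_iff] at h2
  norm_num at h2

lemma proto_injOn : Set.InjOn proto {β | Adm β} := fun β hβ β' hβ' h =>
  eq_of_areSimilar hβ hβ' ⟨1, .refl ℝ Plane, 0, one_pos, by simpa using h⟩

lemma nonempty_homeo_proto {β : ℝ} (hβ : Adm β) :
    Nonempty (proto β ≃ₜ Metric.closedBall (0 : Plane) 1) := by
  obtain ⟨e⟩ := nonempty_homeo_tile hβ.1
  have h : toPlane '' Metric.closedBall 0 1 = Metric.closedBall (0 : Plane) 1 := by
    rw [LinearIsometryEquiv.image_closedBall, map_zero]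
  rw [← h]
  exact ⟨(toPlane.toHomeomorph.image _).symm.trans (e.trans (toPlane.toHomeomorph.image _))⟩

lemma proto_eq_closure {β : ℝ} (hβ : Adm β) : proto β = closure (interior (proto β)) := by
  have h := toPlane.toHomeomorph.image_closure (interior (tile β))
  rw [← tile_eq_closure hβ.1] at h
  rw [proto, interior_image_equiv]
  exact h

end HatFamily

/-- There is an uncountable, pairwise non-similar family of closed topological
disks, each of which tiles the plane but admits no tiling invariant under a
nonzero translation. -/
theorem uncountable_family_of_aperiodic_monotiles :
    ∃ Fam : Set (Set Plane),
      ¬ Fam.Countable ∧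
      (∀ P ∈ Fam, IsCompact P ∧ P = closure (interior P) ∧
        Nonempty (P ≃ₜ (Metric.closedBall (0 : Plane) 1))) ∧
      (∀ P ∈ Fam, ∃ S : Set (Plane ≃ᵢ Plane), IsTiling P S) ∧
      (∀ P ∈ Fam, ∀ S : Set (Plane ≃ᵢ Plane), IsTiling P S →
        ∀ v : Plane, v ≠ 0 → ¬ TilingTransInvariant P S v) ∧
      (∀ P ∈ Fam, ∀ Q ∈ Fam, P ≠ Q → ¬ AreSimilar P Q) := by
  refine ⟨HatFamily.proto '' {β | HatFamily.Adm β}, fun h => HatFamily.not_countable_adm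
    (Set.countable_of_injective_of_countable_image HatFamily.proto_injOn h), ?_, ?_, ?_, ?_⟩
  · rintro _ ⟨β, hβ, rfl⟩
    exact ⟨(HatFamily.isCompact_tile hβ.1).image HatFamily.toPlane.continuous,
      HatFamily.proto_eq_closure hβ, HatFamily.nonempty_homeo_proto hβ⟩
  · rintro _ ⟨β, hβ, rfl⟩
    obtain ⟨S, hS⟩ := HatFamily.exists_til hβ
    exact ⟨_, HatFamily.isTiling_ofCplx hS⟩
  · rintro _ ⟨β, hβ, rfl⟩ S hS v hv
    exact HatFamily.not_tilingTransInvariant hβ hS hv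
  · rintro _ ⟨β, hβ, rfl⟩ _ ⟨β', hβ', rfl⟩ hne h
    exact hne (congrArg _ (HatFamily.eq_of_areSimilar hβ hβ' h))
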